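/- For every integer g ≥ 0, every (g,1)-planar graph is contained in H ⊠ P ⊠ K_{max{4g,7}} for some planar graph H with treewidth at most 3 and for some path P. -/

import Mathlib

/-!
Common definitions: multigraphs, combinatorial (cellular) surface embeddings,
Euler genus, framed graphs, strong products, treewidth, partitions and layerings.
-/

/-- A multigraph on vertex type `V` with edge type `E`, given by its endpoints map. -/
structure Multigraph (V E : Type) where
  ends : E → Sym2 V

namespace Multigraph

variable {V E F : Type}

/-- The simple graph underlying a multigraph. -/
def simple (G : Multigraph V E) : SimpleGraph V where
  Adj u v := u ≠ v ∧ ∃ e, G.ends e = s(u, v)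
  symm := by
    constructor
    rintro u v ⟨hne, e, he⟩
    exact ⟨hne.symm, e, he.trans Sym2.eq_swap⟩
  loopless := by constructor; rintro u ⟨hne, -⟩; exact hne rfl

/-- The simple graph on `V` whose edges are the edges of `G` lying in `S`. -/
def simpleOn (G : Multigraph V E) (S : Set E) : SimpleGraph V where
  Adj u v := u ≠ v ∧ ∃ e ∈ S, G.ends e = s(u, v)
  symm := by
    constructor
    rintro u v ⟨hne, e, heS, he⟩
    exact ⟨hne.symm, e, heS, he.trans Sym2.eq_swap⟩
  loopless := by constructor; rintro u ⟨hne, -⟩; exact hne rfl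

/-- A multigraph is simple: no loops and no parallel edges. -/
def IsSimple (G : Multigraph V E) : Prop :=
  (∀ e, ¬ (G.ends e).IsDiag) ∧ Function.Injective G.ends

/-- A set `S` of edges of `G` forms a spanning tree of `G`. -/
def IsSpanningTree (G : Multigraph V E) (S : Set E) : Prop :=
  (G.simpleOn S).IsTree ∧ (∀ e ∈ S, ¬ (G.ends e).IsDiag) ∧
    ∀ e ∈ S, ∀ e' ∈ S, G.ends e = G.ends e' → e = e'

/-- A closed walk in a multigraph, recorded as periodic sequences of vertices and
edges: the walk visits `vtx 0, vtx 1, …, vtx (len - 1)` and returns to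
`vtx len = vtx 0`, traversing the edge `edge i` between `vtx i` and `vtx (i+1)`. -/
structure CWalk (G : Multigraph V E) where
  len : ℕ
  len_pos : 0 < len
  vtx : ℕ → V
  edge : ℕ → E
  vtx_per : ∀ i, vtx (i + len) = vtx i
  edge_per : ∀ i, edge (i + len) = edge i
  compat : ∀ i, G.ends (edge i) = s(vtx i, vtx (i + 1))

namespace CWalk

variable {G : Multigraph V E}

/-- The vertex `v` lies on the closed walk `W`. -/
def HasVtx (W : G.CWalk) (v : V) : Prop := ∃ i, i < W.len ∧ W.vtx i = v

/-- The edge `e` lies on the closed walk `W`. -/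
def HasEdge (W : G.CWalk) (e : E) : Prop := ∃ i, i < W.len ∧ W.edge i = e

/-- The closed walk `W` is a cycle: it repeats no vertex and no edge. -/
def IsCycle (W : G.CWalk) : Prop :=
  (∀ i j, i < W.len → j < W.len → W.vtx i = W.vtx j → i = j) ∧
  (∀ i j, i < W.len → j < W.len → W.edge i = W.edge j → i = j)

end CWalk

/-- `p = (f, i)` is an occurrence of the edge `e` in the family `bd` of closed walks:
the walk of face `f` traverses `e` at position `i`. -/
def IsOcc {G : Multigraph V E} (bd : F → G.CWalk) (e : E) (p : F × ℕ) : Prop :=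
  p.2 < (bd p.1).len ∧ (bd p.1).edge p.2 = e

/-- `c = (f, i)` is a corner of the vertex `v`: the walk of face `f` visits `v`
at position `i`. -/
def IsCorner {G : Multigraph V E} (bd : F → G.CWalk) (v : V) (c : F × ℕ) : Prop :=
  c.2 < (bd c.1).len ∧ (bd c.1).vtx c.2 = v

/-- The corner `c` is one of the two end corners of the edge occurrence `p`. -/
def EndOf {G : Multigraph V E} (bd : F → G.CWalk) (c p : F × ℕ) : Prop :=
  c.1 = p.1 ∧ (c.2 = p.2 ∨ c.2 = (p.2 + 1) % (bd p.1).len)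

/-- Two corners of `v` are linked if they are end corners (at `v`) of the two
distinct occurrences of a common edge; this is the edge-to-edge gluing relation
around the vertex `v`. -/
def CornerLinked {G : Multigraph V E} (bd : F → G.CWalk) (v : V) (c c' : F × ℕ) : Prop :=
  IsCorner bd v c ∧ IsCorner bd v c' ∧
    ∃ (e : E) (p p' : F × ℕ), p ≠ p' ∧ IsOcc bd e p ∧ IsOcc bd e p' ∧
      EndOf bd c p ∧ EndOf bd c' p'

/-- A combinatorial (cellular) embedding of a connected multigraph `G` in a closed
surface, with face set `F`: every face is given by its closed boundary walk, every
edge of `G` is traversed exactly twice in total by the boundary walks, and the link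
of every vertex is connected (so the embedding is in a genuine surface, with no
pinch points). -/
structure Embedding (G : Multigraph V E) (F : Type) where
  boundary : F → G.CWalk
  conn : G.simple.Connected
  edge_twice : ∀ e : E, {p : F × ℕ | IsOcc boundary e p}.ncard = 2
  link_conn : ∀ (v : V) (c c' : F × ℕ), IsCorner boundary v c → IsCorner boundary v c' →
    Relation.EqvGen (CornerLinked boundary v) c c'

/-- The Euler genus `2 - (|V| - |E| + |F|)` of an embedding, via Euler's formula. -/
noncomputable def Embedding.eulerGenus {G : Multigraph V E} {F : Type}
    (_ : Embedding G F) : ℤ :=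
  2 - ((Nat.card V : ℤ) - Nat.card E + Nat.card F)

/-- The simple graph underlying the framed multigraph `G^{(d)}`: two distinct
vertices are adjacent iff they are joined by an edge of `G` or lie on a common
face of length at most `d` (in which case `G^{(d)}` has a chord between them). -/
def framedGraph {G : Multigraph V E} {F : Type} (emb : Embedding G F) (d : ℕ) :
    SimpleGraph V where
  Adj u v := u ≠ v ∧ ((∃ e, G.ends e = s(u, v)) ∨
    ∃ f, (emb.boundary f).len ≤ d ∧ (emb.boundary f).HasVtx u ∧ (emb.boundary f).HasVtx v)
  symm := by
    constructor
    rintro u v ⟨hne, (⟨e, he⟩ | ⟨f, h1, h2, h3⟩)⟩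
    · exact ⟨hne.symm, Or.inl ⟨e, he.trans Sym2.eq_swap⟩⟩
    · exact ⟨hne.symm, Or.inr ⟨f, h1, h3, h2⟩⟩
  loopless := by constructor; rintro u ⟨hne, -⟩; exact hne rfl

end Multigraph

namespace SimpleGraph

/-- `G` is contained in `X`: `G` is isomorphic to a subgraph of `X`. -/
def IsContainedIn {α β : Type} (G : SimpleGraph α) (X : SimpleGraph β) : Prop :=
  ∃ f : G →g X, Function.Injective f

/-- The strong product of two simple graphs. -/
def strongProd {α β : Type} (G : SimpleGraph α) (H : SimpleGraph β) :
    SimpleGraph (α × β) where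
  Adj x y := x ≠ y ∧ (x.1 = y.1 ∨ G.Adj x.1 y.1) ∧ (x.2 = y.2 ∨ H.Adj x.2 y.2)
  symm := by
    constructor
    rintro x y ⟨hne, h1, h2⟩
    exact ⟨hne.symm, h1.imp Eq.symm (fun h => G.symm.symm _ _ h), h2.imp Eq.symm (fun h => H.symm.symm _ _ h)⟩
  loopless := by constructor; rintro x ⟨hne, -⟩; exact hne rfl

end SimpleGraph

/-- `G` has treewidth at most `k`: it has a tree-decomposition with all bags of
size at most `k + 1`. -/
def TreewidthLE {α : Type} (G : SimpleGraph α) (k : ℕ) : Prop :=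
  ∃ (ι : Type) (T : SimpleGraph ι) (B : ι → Set α),
    T.IsTree ∧
    (∀ v, ∃ i, v ∈ B i) ∧
    (∀ u v, G.Adj u v → ∃ i, u ∈ B i ∧ v ∈ B i) ∧
    (∀ v, (T.induce {i | v ∈ B i}).Connected) ∧
    ∀ i, (B i).encard ≤ (k : ℕ∞) + 1

/-- `G` has Euler genus at most `g`: `G` is (isomorphic to) a subgraph of a
multigraph having a combinatorial embedding of Euler genus at most `g`. -/
def HasEulerGenusLE {α : Type} (G : SimpleGraph α) (g : ℕ) : Prop :=
  ∃ (V' E' F' : Type), Finite V' ∧ Finite E' ∧ Finite F' ∧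
    ∃ (M : Multigraph V' E') (emb : M.Embedding F'),
      emb.eulerGenus ≤ (g : ℤ) ∧ G.IsContainedIn M.simple

/-- A planar graph: a graph of Euler genus `0`. -/
def IsPlanar {α : Type} (G : SimpleGraph α) : Prop := HasEulerGenusLE G 0

/-- An apex graph: deleting some vertex leaves a planar graph. -/
def IsApex {α : Type} (G : SimpleGraph α) : Prop :=
  ∃ v : α, IsPlanar (G.induce {w | w ≠ v})

/-- `A` indexes a partition of the vertices of `G` into nonempty parts `A x`, and the
quotient of `G` by this partition is (isomorphic to) `H`, via the indexing: this is an
`H`-partition of `G`. -/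
def IsHPartition {α W : Type} (G : SimpleGraph α) (H : SimpleGraph W) (A : W → Set α) : Prop :=
  (∀ x, (A x).Nonempty) ∧ (∀ v, ∃! x, v ∈ A x) ∧
    ∀ x y, x ≠ y → (H.Adj x y ↔ ∃ u ∈ A x, ∃ v ∈ A y, G.Adj u v)

/-- `(L 0, L 1, …)` is a layering of `G`: an ordered partition of the vertices such
that every edge joins vertices in the same or in consecutive layers. -/
def IsLayering {α : Type} (G : SimpleGraph α) (L : ℕ → Set α) : Prop :=
  (∀ v, ∃! j, v ∈ L j) ∧
    ∀ u v, G.Adj u v → ∀ i j, u ∈ L i → v ∈ L j → i ≤ j + 1 ∧ j ≤ i + 1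

/-- `b` lies on every walk from `a` to `c` in `T` (for a tree: `b` is on the unique
`a`–`c` path). -/
def BtwIn {α : Type} (T : SimpleGraph α) (a b c : α) : Prop :=
  ∀ p : T.Walk a c, b ∈ p.support

/-- `Q` is the vertex set of a vertical path in the tree `T` rooted at `r` with upper
end `w` and lower end `u`: `w` lies on the path from `r` to `u`, and `Q` is the set of
vertices of the `w`–`u` path. -/
def IsVerticalPathBtw {α : Type} (T : SimpleGraph α) (r : α) (Q : Set α) (w u : α) : Prop :=
  BtwIn T r w u ∧ Q = {x | BtwIn T w x u}

/-- `Q` is the vertex set of a vertical path in the tree `T` rooted at `r`. -/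
def IsVerticalPath {α : Type} (T : SimpleGraph α) (r : α) (Q : Set α) : Prop :=
  ∃ w u, IsVerticalPathBtw T r Q w u

/-- `Y` is the union of at most `k` vertical paths in the tree `T` rooted at `r`. -/
def IsUnionOfVPaths {α : Type} (T : SimpleGraph α) (r : α) (k : ℕ) (Y : Set α) : Prop :=
  ∃ m, m ≤ k ∧ ∃ Q : Fin m → Set α, (∀ i, IsVerticalPath T r (Q i)) ∧ Y = ⋃ i, Q i

/-- The planarization of a drawing of `G` with crossings indexed by `I`, where the
`i`-th crossing is a crossing of the edges `(a i)(b i)` and `(c i)(d i)` of `G`: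
each crossing is replaced by a new vertex of degree 4 joined to the four endpoints
of the two crossing edges, and the crossed edges are removed. -/
def planarization {V I : Type} (G : SimpleGraph V) (a b c d : I → V) :
    SimpleGraph (V ⊕ I) where
  Adj x y :=
    (∃ u v, x = Sum.inl u ∧ y = Sum.inl v ∧ G.Adj u v ∧
      ∀ i, s(u, v) ≠ s(a i, b i) ∧ s(u, v) ≠ s(c i, d i)) ∨
    (∃ u i, ((x = Sum.inl u ∧ y = Sum.inr i) ∨ (x = Sum.inr i ∧ y = Sum.inl u)) ∧
      (u = a i ∨ u = b i ∨ u = c i ∨ u = d i))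
  symm := by
    constructor
    rintro x y (⟨u, v, rfl, rfl, huv, hcr⟩ | ⟨u, i, h, hu⟩)
    · refine Or.inl ⟨v, u, rfl, rfl, huv.symm, fun i => ?_⟩
      refine ⟨?_, ?_⟩ <;> rw [Sym2.eq_swap (a := v) (b := u)]
      · exact (hcr i).1
      · exact (hcr i).2
    · exact Or.inr ⟨u, i, h.elim (fun h' => Or.inr ⟨h'.2, h'.1⟩)
        (fun h' => Or.inl ⟨h'.2, h'.1⟩), hu⟩
  loopless := by
    constructor
    rintro x (⟨u, v, rfl, h, huv, -⟩ | ⟨u, i, (⟨rfl, h⟩ | ⟨rfl, h⟩), -⟩)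
    · rw [Sum.inl.injEq] at h; subst h; exact G.loopless.irrefl _ huv
    · exact absurd h (by simp)
    · exact absurd h (by simp)

/-- `G` is `(g,1)`-planar: `G` can be drawn in a surface of Euler genus at most `g`
with every edge involved in at most one crossing.  Combinatorially: there is a
collection of crossing pairs of edges of `G`, with each edge of `G` in at most one
crossing pair, whose planarization has Euler genus at most `g`. -/
def IsG1Planar {V : Type} (G : SimpleGraph V) (g : ℕ) : Prop :=
  ∃ (I : Type) (a b c d : I → V),
    (∀ i, G.Adj (a i) (b i) ∧ G.Adj (c i) (d i)) ∧
    (∀ i, s(a i, b i) ≠ s(c i, d i)) ∧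
    (∀ i j, i ≠ j →
      ∀ e : Sym2 V, (e = s(a i, b i) ∨ e = s(c i, d i)) →
        (e = s(a j, b j) ∨ e = s(c j, d j)) → False) ∧
    HasEulerGenusLE (planarization G a b c d) g


inductive RR {V : Type} : List V → Set (Sym2 V) → Prop
  | leaf (u v : V) (E : Set (Sym2 V)) (h : E ⊆ {s(u, v)}) : RR [u, v] E
  | tri (u x v : V) (P Q : List V) (E1 E2 E : Set (Sym2 V)) (hu : P.head? = some u)
      (hv : Q.getLast? = some v) (h1 : RR (P ++ [x]) E1) (h2 : RR (x :: Q) E2)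
      (h : E ⊆ E1 ∪ E2 ∪ {s(u, v)}) : RR (P ++ x :: Q) E
  | quad (u x y v : V) (P Q S : List V) (E1 E2 E3 E : Set (Sym2 V)) (hu : P.head? = some u)
      (hv : S.getLast? = some v) (h1 : RR (P ++ [x]) E1) (h2 : RR (x :: (Q ++ [y])) E2)
      (h3 : RR (y :: S) E3)
      (h : E ⊆ E1 ∪ E2 ∪ E3 ∪ {s(u, v), s(u, y), s(x, v)}) : RR (P ++ x :: (Q ++ y :: S)) E

namespace RR
variable {V : Type}

theorem mono {l : List V} {E E' : Set (Sym2 V)} (h : RR l E) (hE : E' ⊆ E) : RR l E' := by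
  cases h with
  | leaf u v _ h => exact leaf u v _ (hE.trans h)
  | tri u x v P Q E1 E2 _ hu hv h1 h2 h => exact tri u x v P Q E1 E2 _ hu hv h1 h2 (hE.trans h)
  | quad u x y v P Q S E1 E2 E3 _ hu hv h1 h2 h3 h =>
    exact quad u x y v P Q S E1 E2 E3 _ hu hv h1 h2 h3 (hE.trans h)

theorem closing {l : List V} {E : Set (Sym2 V)} (h : RR l E) {u v : V} (hu : l.head? = some u)
    (hv : l.getLast? = some v) : RR l (E ∪ {s(u, v)}) := by
  cases h with
  | leaf a b _ h =>
    simp at hu hv; subst hu hv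
    exact leaf _ _ _ (by simpa using h)
  | tri a x b P Q E1 E2 _ ha hb h1 h2 h =>
    have : a = u := by simpa [List.head?_append, ha] using hu
    have : b = v := by simpa [List.getLast?_append, List.getLast?_cons, hb] using hv
    subst a b
    exact tri u x v P Q E1 E2 _ ha hb h1 h2 (Set.union_subset h (by simp))
  | quad a x y b P Q S E1 E2 E3 _ ha hb h1 h2 h3 h =>
    have : a = u := by simpa [List.head?_append, ha] using hu
    have : b = v := by simpa [List.getLast?_append, List.getLast?_cons, hb] using hv
    subst a b
    refine quad u x y v P Q S E1 E2 E3 _ ha hb h1 h2 h3 (Set.union_subset h ?_)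
    intro z hz; right; left; exact hz

theorem len {l : List V} {E : Set (Sym2 V)} (h : RR l E) : 2 ≤ l.length := by
  cases h with
  | leaf => simp
  | tri a x b P Q E1 E2 _ ha hb h1 h2 h =>
    rcases P with _ | ⟨p, P⟩
    · simp at ha
    · simp; omega
  | quad a x y b P Q S E1 E2 E3 _ ha hb h1 h2 h3 h => simp; omega

theorem pairE {a b : V} {E : Set (Sym2 V)} (h : RR [a, b] E) : E ⊆ {s(a, b)} := by
  generalize hl : [a, b] = l at h
  cases h with
  | leaf u v _ h => simp at hl; obtain ⟨rfl, rfl⟩ := hl; exact h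
  | tri u x v P Q E1 E2 _ hu hv h1 h2 h =>
    have := h1.len; have := h2.len
    have := congrArg List.length hl; simp at *; omega
  | quad u x y v P Q S E1 E2 E3 _ hu hv h1 h2 h3 h =>
    have := h1.len; have := h2.len; have := h3.len
    have := congrArg List.length hl; simp at *; omega

end RR

theorem split_side {V : Type} {P Q p s : List V} {b x u : V} (h : P ++ b :: Q = p ++ x :: u :: s) :
    (∃ s1, P ++ [b] = p ++ x :: u :: s1 ∧ s = s1 ++ Q) ∨
    (∃ p1, b :: Q = p1 ++ x :: u :: s ∧ p = P ++ p1) := by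
  rcases List.append_eq_append_iff.1 h with ⟨a, h1, h2⟩ | ⟨c, h1, h2⟩
  · exact Or.inr ⟨a, h2, h1⟩
  · rcases c with _ | ⟨c1, _ | ⟨c2, c⟩⟩
    · right; exact ⟨[], by simpa using h2.symm, by simpa using h1.symm⟩
    · left; simp at h2; obtain ⟨rfl, rfl, rfl⟩ := h2; exact ⟨[], by simp [h1], rfl⟩
    · left; simp at h2; obtain ⟨rfl, rfl, rfl⟩ := h2; exact ⟨c ++ [b], by simp [h1], by simp⟩

theorem graft_left {V : Type} {P p s1 : List V} {b x u : V} (m : List V) (h : P ++ [b] = p ++ x :: u :: s1) :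
    ∃ P', p ++ x :: (m ++ u :: s1) = P' ++ [b] ∧ P'.head? = P.head? := by
  rcases List.eq_nil_or_concat s1 with rfl | ⟨s, c, rfl⟩
  · have h' : P ++ [b] = (p ++ [x]) ++ [u] := by simpa using h
    obtain ⟨rfl, h2⟩ := List.append_inj' h' rfl
    simp at h2; subst h2
    exact ⟨p ++ x :: m, by simp, by simp [List.head?_append]⟩
  · have h' : P ++ [b] = (p ++ x :: u :: s) ++ [c] := by simpa using h
    obtain ⟨rfl, h2⟩ := List.append_inj' h' rfl
    simp at h2; subst h2
    exact ⟨p ++ x :: (m ++ u :: s), by simp, by simp [List.head?_append]⟩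

theorem graft_right {V : Type} {Q p s : List V} {b x u : V} (m : List V) (h : b :: Q = p ++ x :: u :: s) :
    ∃ Q', p ++ x :: (m ++ u :: s) = b :: Q' ∧ Q'.getLast? = Q.getLast? := by
  rcases p with _ | ⟨c, p⟩
  · simp at h; obtain ⟨rfl, rfl⟩ := h
    exact ⟨m ++ u :: s, by simp, by simp [List.getLast?_append, List.getLast?_cons]⟩
  · simp at h; obtain ⟨rfl, rfl⟩ := h
    exact ⟨p ++ x :: (m ++ u :: s), by simp, by simp [List.getLast?_append, List.getLast?_cons]⟩

namespace RR
variable {V : Type}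

theorem graft {L m : List V} {x u : V} {E E' : Set (Sym2 V)} (h : RR L E)
    (h' : RR (x :: (m ++ [u])) E') :
    ∀ p s, L = p ++ x :: u :: s → RR (p ++ x :: (m ++ u :: s)) (E ∪ E') := by
  induction h with
  | leaf a b E hE =>
    intro p s h
    have : p = [] := by
      rcases p with _ | ⟨c, p⟩; · rfl
      · have := congrArg List.length h; simp at this; omega
    subst this
    simp at h; obtain ⟨rfl, rfl, rfl⟩ := h
    refine (h'.closing (u := a) (v := b) (by simp) (by simp [List.getLast?_cons])).mono ?_
    exact Set.union_subset (hE.trans (by simp)) (by simp)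
  | tri a b c P Q E1 E2 E ha hc h1 h2 hE ih1 ih2 =>
    intro p s h
    rcases split_side h with ⟨s1, e1, rfl⟩ | ⟨p1, e1, rfl⟩
    · have r := ih1 p s1 e1
      obtain ⟨P', e2, e3⟩ := graft_left m e1
      rw [e2] at r
      have := tri a b c P' Q _ _ (E ∪ E') (e3.trans ha) hc r h2 (by
        intro z hz; have := @hE z; simp at this hz ⊢; tauto)
      have e4 : p ++ x :: (m ++ u :: (s1 ++ Q)) = P' ++ b :: Q := by
        have := congrArg (· ++ Q) e2; simpa using this
      rwa [e4]
    · have r := ih2 p1 s e1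
      obtain ⟨Q', e2, e3⟩ := graft_right m e1
      rw [e2] at r
      have := tri a b c P Q' _ _ (E ∪ E') ha (e3.trans hc) h1 r (by
        intro z hz; have := @hE z; simp at this hz ⊢; tauto)
      rw [← e2] at this; simpa using this
  | quad a b d c P Q S E1 E2 E3 E ha hc h1 h2 h3 hE ih1 ih2 ih3 =>
    intro p s h
    rcases split_side h with ⟨s1, e1, rfl⟩ | ⟨p1, e1, rfl⟩
    · have r := ih1 p s1 e1
      obtain ⟨P', e2, e3⟩ := graft_left m e1
      rw [e2] at r
      have := quad a b d c P' Q S _ _ _ (E ∪ E') (e3.trans ha) hc r h2 h3 (by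
        intro z hz; have := @hE z; simp at this hz ⊢; tauto)
      have e4 : p ++ x :: (m ++ u :: (s1 ++ (Q ++ d :: S))) = P' ++ b :: (Q ++ d :: S) := by
        have := congrArg (· ++ (Q ++ d :: S)) e2; simpa using this
      rwa [e4]
    · rcases split_side (P := b :: Q) (Q := S) (b := d) (by simpa using e1) with
        ⟨s1, e1', rfl⟩ | ⟨p2, e1', rfl⟩
      · have r := ih2 p1 s1 (by simpa using e1')
        obtain ⟨P', e2, e3⟩ := graft_left m e1'
        rw [e2] at r
        rcases P' with _ | ⟨b', Q'⟩
        · simp at e3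
        · simp at e3; subst e3
          have := quad a b' d c P Q' S _ _ _ (E ∪ E') ha hc h1 (by simpa using r) h3 (by
            intro z hz; have := @hE z; simp at this hz ⊢; tauto)
          have e4 : p1 ++ x :: (m ++ u :: (s1 ++ S)) = b' :: (Q' ++ d :: S) := by
            have := congrArg (· ++ S) e2; simpa using this
          have e5 : P ++ p1 ++ x :: (m ++ u :: (s1 ++ S)) = P ++ b' :: (Q' ++ d :: S) := by
            rw [← e4]; simp
          rwa [e5]
      · have r := ih3 p2 s e1'
        obtain ⟨S', e2, e3⟩ := graft_right m e1'
        rw [e2] at r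
        have := quad a b d c P Q S' _ _ _ (E ∪ E') ha (e3.trans hc) h1 h2 r (by
          intro z hz; have := @hE z; simp at this hz ⊢; tauto)
        rw [← e2] at this; simpa using this

theorem rot1 {L : List V} {E : Set (Sym2 V)} (h : RR L E) : ∀ u w, L = u :: w → RR (w ++ [u]) E := by
  induction h with
  | leaf a b E hE =>
    intro u w h; simp at h; obtain ⟨rfl, rfl⟩ := h
    exact leaf _ _ _ (by rwa [Sym2.eq_swap])
  | tri a b c P Q E1 E2 E ha hc h1 h2 hE ih1 ih2 =>
    intro u w h
    rcases P with _ | ⟨a', P'⟩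
    · simp at ha
    simp at ha h; obtain ⟨rfl, rfl⟩ := h; subst ha
    obtain ⟨Q', rfl⟩ := List.getLast?_eq_some_iff.1 hc
    have T : RR (b :: ((Q' ++ [c]) ++ [a'])) (E2 ∪ {s(c, a'), s(b, a')}) := by
      have := tri b c a' (b :: Q') [a'] E2 {s(c, a')} (E2 ∪ {s(c, a'), s(b, a')}) (by simp) (by simp)
        (by simpa using h2) (leaf _ _ _ (by simp)) (by intro z hz; simp at hz ⊢; tauto)
      simpa using this
    rcases P' with _ | ⟨p, P'⟩
    · have e := h1.pairE
      refine (T.mono ?_ : RR _ E)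
      intro z hz; have := hE hz
      rw [Sym2.eq_swap (a := c), Sym2.eq_swap (a := b)]
      have := @e z
      simp at *; tauto
    · have r := ih1 a' (p :: P' ++ [b]) (by simp)
      have := graft (m := Q' ++ [c]) r T (p :: P') [] (by simp)
      refine RR.mono (by simpa using this) ?_
      intro z hz; have := hE hz
      rw [Sym2.eq_swap (a := c)]; simp at *; tauto
  | quad a b d c P Q S E1 E2 E3 E ha hc h1 h2 h3 hE ih1 ih2 ih3 =>
    intro u w h
    rcases P with _ | ⟨a', P'⟩
    · simp at ha
    simp at ha h; obtain ⟨rfl, rfl⟩ := h; subst ha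
    obtain ⟨S', rfl⟩ := List.getLast?_eq_some_iff.1 hc
    have T : RR (b :: ((Q ++ d :: (S' ++ [c])) ++ [a']))
        (E2 ∪ E3 ∪ {s(c, a'), s(b, a'), s(b, c), s(d, a')}) := by
      have := quad b d c a' (b :: Q) S' [a'] E2 E3 {s(c, a')}
        (E2 ∪ E3 ∪ {s(c, a'), s(b, a'), s(b, c), s(d, a')}) (by simp) (by simp)
        (by simpa using h2) h3 (leaf _ _ _ (by simp)) (by intro z hz; simp at hz ⊢; tauto)
      simpa using this
    rcases P' with _ | ⟨p, P'⟩
    · have e := h1.pairE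
      refine RR.mono (by simpa using T : RR _ _) ?_
      intro z hz; have := hE hz
      rw [Sym2.eq_swap (a := c), Sym2.eq_swap (a := b) (b := a'), Sym2.eq_swap (a := d)]
      have := @e z
      simp at *; tauto
    · have r := ih1 a' (p :: P' ++ [b]) (by simp)
      have := graft (m := Q ++ d :: (S' ++ [c])) r T (p :: P') [] (by simp)
      refine RR.mono (by simpa using this) ?_
      intro z hz; have := hE hz
      rw [Sym2.eq_swap (a := c), Sym2.eq_swap (a := d)]; simp at *; tauto

theorem rot {A B : List V} {E : Set (Sym2 V)} (h : RR (A ++ B) E) : RR (B ++ A) E := by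
  induction A generalizing B with
  | nil => simpa using h
  | cons a A ih =>
    have := h.rot1 a (A ++ B) (by simp)
    have := ih (B := B ++ [a]) (by simpa using this)
    simpa using this

theorem glue {a b : List V} {u v : V} {E1 E2 : Set (Sym2 V)} (h1 : RR (v :: (a ++ [u])) E1)
    (h2 : RR (u :: (b ++ [v])) E2) : RR (v :: (a ++ u :: b)) (E1 ∪ E2) := by
  have r := h1.rot1 v (a ++ [u]) rfl
  have := graft (m := b) r h2 a [] (by simp)
  have := RR.rot (A := a ++ u :: b) (B := [v]) (by simpa using this)
  simpa using this

theorem rev {L : List V} {E : Set (Sym2 V)} (h : RR L E) : RR L.reverse E := by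
  induction h with
  | leaf a b E hE => exact leaf _ _ _ (by rwa [Sym2.eq_swap])
  | tri a b c P Q E1 E2 E ha hc h1 h2 hE ih1 ih2 =>
    have := tri c b a Q.reverse P.reverse E2 E1 E (by simpa using hc) (by simpa using ha)
      (by simpa using ih2) (by simpa using ih1)
      (by intro z hz; have := hE hz; rw [Sym2.eq_swap]; simp at *; tauto)
    simpa using this
  | quad a b d c P Q S E1 E2 E3 E ha hc h1 h2 h3 hE ih1 ih2 ih3 =>
    have := quad c d b a S.reverse Q.reverse P.reverse E3 E2 E1 E (by simpa using hc)
      (by simpa using ha)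
      (by simpa using ih3) (by simpa using ih2) (by simpa using ih1)
      (by intro z hz; have := hE hz; rw [Sym2.eq_swap (a := c), Sym2.eq_swap (a := c), Sym2.eq_swap (a := d)]; simp at *; tauto)
    simpa using this

end RR


inductive Apol : ℕ → Multiset (Finset ℕ) → (ℕ → ℕ → Prop) → Prop
  | init : Apol 3 ({0, 1, 2} ::ₘ {0, 1, 2} ::ₘ 0) (fun x y => x < 3 ∧ y < 3 ∧ x ≠ y)
  | step (n : ℕ) (M : Multiset (Finset ℕ)) (A : ℕ → ℕ → Prop) (a b c : ℕ)
      (h : Apol n ({a, b, c} ::ₘ M) A) (hab : a ≠ b) (hbc : b ≠ c) (hac : a ≠ c) :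
      Apol (n + 1) ({n, a, b} ::ₘ {n, b, c} ::ₘ {n, a, c} ::ₘ M)
        (fun x y => A x y ∨ (x = n ∧ (y = a ∨ y = b ∨ y = c)) ∨ (y = n ∧ (x = a ∨ x = b ∨ x = c)))

theorem Apol.face {n : ℕ} {M : Multiset (Finset ℕ)} {A : ℕ → ℕ → Prop} (h : Apol n M A) :
    ∀ f ∈ M, f.card = 3 ∧ (∀ x ∈ f, x < n) ∧ ∀ x ∈ f, ∀ y ∈ f, x ≠ y → A x y := by
  induction h with
  | init =>
    intro f hf
    have : f = {0, 1, 2} := by simpa using hf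
    subst this
    refine ⟨rfl, by simp, ?_⟩
    intro x hx y hy hxy
    simp at hx hy; omega
  | step n M A a b c h hab hbc hac ih =>
    have h0 := ih {a, b, c} (by simp)
    have ha : a < n := h0.2.1 a (by simp)
    have hb : b < n := h0.2.1 b (by simp)
    have hc : c < n := h0.2.1 c (by simp)
    have h1 := h0.2.2
    intro f hf
    simp only [Multiset.mem_cons] at hf
    rcases hf with rfl | rfl | rfl | hf
    · refine ⟨Finset.card_eq_three.2 ⟨n, a, b, by omega, by omega, by omega, rfl⟩, ?_, ?_⟩
      · simp; omega
      · intro x hx y hy hxy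
        simp at hx hy
        have := h1 x
        have := this (y := y)
        simp at this
        rcases hx with rfl | rfl | rfl <;> rcases hy with rfl | rfl | rfl <;> simp_all
    · refine ⟨Finset.card_eq_three.2 ⟨n, b, c, by omega, by omega, by omega, rfl⟩, ?_, ?_⟩
      · simp; omega
      · intro x hx y hy hxy
        simp at hx hy
        have := h1 x
        have := this (y := y)
        simp at this
        rcases hx with rfl | rfl | rfl <;> rcases hy with rfl | rfl | rfl <;> simp_all
    · refine ⟨Finset.card_eq_three.2 ⟨n, a, c, by omega, by omega, by omega, rfl⟩, ?_, ?_⟩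
      · simp; omega
      · intro x hx y hy hxy
        simp at hx hy
        have := h1 x
        have := this (y := y)
        simp at this
        rcases hx with rfl | rfl | rfl <;> rcases hy with rfl | rfl | rfl <;> simp_all
    · have := ih f (by simp [hf])
      refine ⟨this.1, fun x hx => (this.2.1 x hx).trans (by omega), fun x hx y hy hxy => Or.inl (this.2.2 x hx y hy hxy)⟩

def Anc {V : Type} (par : V → V) (w v : V) : Prop := ∃ k, par^[k] v = w

theorem Anc.refl {V : Type} {par : V → V} (v : V) : Anc par v v := ⟨0, rfl⟩

theorem Anc.trans {V : Type} {par : V → V} {u v w : V} (h : Anc par u v) (h' : Anc par v w) :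
    Anc par u w := by
  obtain ⟨k, rfl⟩ := h; obtain ⟨m, rfl⟩ := h'
  exact ⟨k + m, by rw [Function.iterate_add_apply]⟩

theorem Anc.par {V : Type} {par : V → V} (v : V) : Anc par (par v) v := ⟨1, rfl⟩

theorem Anc.cases' {V : Type} {par : V → V} {w v : V} (h : Anc par w v) : w = v ∨ Anc par w (par v) := by
  obtain ⟨k, rfl⟩ := h
  cases k with
  | zero => left; rfl
  | succ k => right; exact ⟨k, by rw [Function.iterate_succ_apply]⟩

theorem Anc.closed {V : Type} {par : V → V} {U : Set V} (hU : ∀ v ∈ U, par v ∈ U) {w v : V}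
    (h : Anc par w v) (hv : v ∈ U) : w ∈ U := by
  obtain ⟨k, rfl⟩ := h
  induction k with
  | zero => exact hv
  | succ k ih => rw [Function.iterate_succ_apply']; exact hU _ ih

def NC {V : Type} (B : V → Prop) (l : List V) : Prop :=
  ∀ p q s t, List.Sublist [p, q, s, t] l → (B p ∧ ¬ B q ∧ B s ∧ ¬ B t → False) ∧
    (¬ B p ∧ B q ∧ ¬ B s ∧ B t → False)

theorem NC.sub {V : Type} {B : V → Prop} {l l' : List V} (h : NC B l) (hs : List.Sublist l' l) : NC B l' :=
  fun p q s t hh => h p q s t (hh.trans hs)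

theorem NC.rot1 {V : Type} {B : V → Prop} {x : V} {l : List V} (h : NC B (x :: l)) : NC B (l ++ [x]) := by
  intro p q s t hh
  rw [List.sublist_append_iff] at hh
  obtain ⟨l1, l2, he, h1, h2⟩ := hh
  have : l2 = [] ∨ l2 = [x] := by
    cases h2 with
    | cons _ h => left; simpa using h
    | cons_cons _ h => right; simpa using h
  rcases this with rfl | rfl
  · simp at he; subst he
    exact h p q s t (h1.cons _)
  · have e : [p, q, s] ++ [t] = l1 ++ [x] := he
    obtain ⟨e1, e2⟩ := List.append_inj' e rfl
    simp at e2; subst e1 e2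
    have := h t p q s (h1.cons_cons _)
    tauto

theorem NC.rot {V : Type} {B : V → Prop} {l l' : List V} (h : NC B l) (hr : l ~r l') : NC B l' := by
  obtain ⟨n, rfl⟩ := hr
  induction n generalizing l with
  | zero => simpa using h
  | succ n ih =>
    cases l with
    | nil => simpa using h
    | cons x l => rw [List.rotate_cons_succ]; exact ih h.rot1

theorem RR.isRot {V : Type} {E : Set (Sym2 V)} {l l' : List V} (h : RR l E) (hr : l ~r l') : RR l' E := by
  obtain ⟨n, rfl⟩ := hr
  induction n generalizing l with
  | zero => simpa using h
  | succ n ih =>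
    cases l with
    | nil => simpa using h
    | cons x l => rw [List.rotate_cons_succ]; exact ih (h.rot1 x l rfl)

theorem isRot_append {V : Type} (A B : List V) : (A ++ B) ~r (B ++ A) := ⟨A.length, by simp⟩

theorem bi_of_sorted {V : Type} (rk : V → ℕ) {r r' : ℕ} (hr : r < r') : ∀ (l : List V)
    (_ : l.Pairwise (fun x y => rk x ≤ rk y)) (_ : ∀ x ∈ l, rk x = r ∨ rk x = r'),
    ∃ X Y, l = X ++ Y ∧ (∀ x ∈ X, rk x = r) ∧ (∀ y ∈ Y, rk y = r')
  | [], _, _ => ⟨[], [], by simp⟩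
  | a :: l, h, hc => by
    rw [List.pairwise_cons] at h
    obtain ⟨X, Y, rfl, hX, hY⟩ := bi_of_sorted rk hr l h.2 (fun x hx => hc x (by simp [hx]))
    rcases hc a (by simp) with ha | ha
    · exact ⟨a :: X, Y, by simp, by simpa [ha] using hX, hY⟩
    · refine ⟨[], a :: (X ++ Y), by simp, by simp, ?_⟩
      intro y hy
      simp only [List.mem_cons] at hy
      rcases hy with rfl | hy
      · exact ha
      · have := h.1 y hy
        rcases hc y (by simp at hy ⊢; tauto) with h' | h' <;> omega

theorem contig_aux {V : Type} (B : V → Prop) : ∀ (l : List V)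
    (_ : ∀ q p, List.Sublist [q, p] l → B q → ¬ B p → False),
    ∃ C W, l = C ++ W ∧ (∀ x ∈ C, ¬ B x) ∧ (∀ x ∈ W, B x)
  | [], _ => ⟨[], [], by simp⟩
  | a :: l, h => by
    by_cases ha : B a
    · refine ⟨[], a :: l, by simp, by simp, ?_⟩
      intro x hx
      simp only [List.mem_cons] at hx
      rcases hx with rfl | hx
      · exact ha
      · by_contra hB
        exact h a x (by simpa using hx) ha hB
    · obtain ⟨C, W, rfl, hC, hW⟩ := contig_aux B l (fun q p hs => h q p (hs.cons _))
      exact ⟨a :: C, W, by simp, by simpa [ha] using hC, hW⟩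

theorem contig {V : Type} (B : V → Prop) : ∀ (l : List V)
    (_ : ∀ p1 q p2, List.Sublist [p1, q, p2] l → ¬ B p1 → B q → ¬ B p2 → False),
    ∃ P C W, l = P ++ (C ++ W) ∧ (∀ x ∈ P, B x) ∧ (∀ x ∈ C, ¬ B x) ∧ (∀ x ∈ W, B x)
  | [], _ => ⟨[], [], [], by simp⟩
  | a :: l, h => by
    by_cases ha : B a
    · obtain ⟨P, C, W, rfl, hP, hC, hW⟩ := contig B l (fun p q p2 hs => h p q p2 (hs.cons _))
      exact ⟨a :: P, C, W, by simp, by simpa [ha] using hP, hC, hW⟩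
    · obtain ⟨C, W, rfl, hC, hW⟩ := contig_aux B l (fun q p hs h1 h2 => h a q p (hs.cons_cons _) ha h1 h2)
      exact ⟨[], a :: C, W, by simp, by simp, by simpa [ha] using hC, hW⟩

structure St (V : Type) where
  U : Set V
  c : V → ℕ
  n : ℕ
  M : Multiset (Finset ℕ)
  A : ℕ → ℕ → Prop

structure WF {V : Type} (par : V → V) (Z : Set V) (S : St V) : Prop where
  apol : Apol S.n S.M S.A
  closed : ∀ v ∈ S.U, par v ∈ S.U
  reach : ∀ v, ∃ k, par^[k] v ∈ S.U
  cpar : ∀ v, v ∉ S.U → S.c v = S.c (par v)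
  clt : ∀ v, S.c v < S.n
  parts : ∀ h, h ≠ 0 → ∃ T : List V, T.length ≤ 3 ∧ ∀ v ∈ S.U, S.c v = h → ∃ t ∈ T, Anc par v t
  zero : ∀ v ∈ S.U, S.c v = 0 → v ∈ Z
  npos : 0 < S.n

structure SExt {V : Type} (par : V → V) (S S' : St V) (l : List V) : Prop where
  U : ∀ v ∈ S.U, v ∈ S'.U
  c : ∀ v ∈ S.U, S'.c v = S.c v
  A : ∀ x y, S.A x y → S'.A x y
  new : ∀ v ∈ S'.U, v ∉ S.U → ∃ t ∈ l, Anc par v t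

theorem SExt.trans {V : Type} {par : V → V} {S S1 S2 : St V} {l1 l2 l : List V} (h1 : SExt par S S1 l1)
    (h2 : SExt par S1 S2 l2) (hl1 : ∀ x ∈ l1, x ∈ l) (hl2 : ∀ x ∈ l2, x ∈ l) : SExt par S S2 l where
  U v hv := h2.U v (h1.U v hv)
  c v hv := (h2.c v (h1.U v hv)).trans (h1.c v hv)
  A x y h := h2.A x y (h1.A x y h)
  new v hv hv' := by
    by_cases h : v ∈ S1.U
    · obtain ⟨t, ht, hh⟩ := h1.new v h hv'; exact ⟨t, hl1 t ht, hh⟩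
    · obtain ⟨t, ht, hh⟩ := h2.new v hv h; exact ⟨t, hl2 t ht, hh⟩

def Okay {V : Type} (S : St V) (x y : V) : Prop :=
  x ∈ S.U ∧ y ∈ S.U ∧ (S.c x = S.c y ∨ S.A (S.c x) (S.c y))

theorem Okay.ext {V : Type} {par : V → V} {S S' : St V} {l : List V} {x y : V} (h : Okay S x y)
    (he : SExt par S S' l) : Okay S' x y := by
  refine ⟨he.U _ h.1, he.U _ h.2.1, ?_⟩
  rw [he.c _ h.1, he.c _ h.2.1]
  exact h.2.2.imp id (he.A _ _)

def Cov (N : Multiset (Finset ℕ)) (f : Finset ℕ) : Prop :=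
  ∀ x ∈ f, ∀ y ∈ f, ∃ g ∈ N, x ∈ g ∧ y ∈ g

def TriF {V : Type} (S : St V) (f : Finset ℕ) (l : List V) : Prop :=
  ∃ P X Y W h1 h2 h3, l = P ++ (X ++ (Y ++ W)) ∧ f = {h1, h2, h3} ∧ (∀ x ∈ P, S.c x = h3) ∧
    (∀ x ∈ X, S.c x = h1) ∧ (∀ x ∈ Y, S.c x = h2) ∧ (∀ x ∈ W, S.c x = h3)

def Job {V : Type} (par : V → V) (S : St V) (f : Finset ℕ) (l : List V) (E : Set (Sym2 V)) : Prop :=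
  (l = [] ∧ E = ∅) ∨
  (RR l E ∧ (∀ w, w ∉ S.U → NC (Anc par w) l) ∧ TriF S f l)

def Done {V : Type} (par : V → V) (Z : Set V) (S : St V) (f : Finset ℕ) (R : Multiset (Finset ℕ))
    (l : List V) (E : Set (Sym2 V)) : Prop :=
  ∃ S', WF par Z S' ∧ SExt par S S' l ∧ (∀ x ∈ l, x ∈ S'.U) ∧
    (∃ N, S'.M = N + R ∧ Cov N f) ∧ ∀ x y, s(x, y) ∈ E → Okay S' x y

def PL {V : Type} (par : V → V) (Z : Set V) (N : ℕ) : Prop :=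
  ∀ (S : St V) (f : Finset ℕ) (R : Multiset (Finset ℕ)) (l : List V) (E : Set (Sym2 V)),
    l.length < N → WF par Z S → S.M = f ::ₘ R → Job par S f l E → Done par Z S f R l E

def Disj {V : Type} (par : V → V) (S : St V) (l l' : List V) : Prop :=
  ∀ z, z ∉ S.U → ∀ x ∈ l, ∀ y ∈ l', Anc par z x → Anc par z y → False

theorem Disj.ext {V : Type} {par : V → V} {S S' : St V} {l l' t : List V} (h : Disj par S l l')
    (he : SExt par S S' t) : Disj par S' l l' :=
  fun z hz x hx y hy h1 h2 => h z (fun hh => hz (he.U z hh)) x hx y hy h1 h2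

theorem SExt.col_eq {V : Type} {par : V → V} {Z : Set V} {S S' : St V} {l : List V} (hS : WF par Z S)
    (hS' : WF par Z S') (he : SExt par S S' l) {v : V}
    (hv : ∀ z, z ∉ S.U → Anc par z v → ∀ y ∈ l, ¬ Anc par z y) : S'.c v = S.c v := by
  obtain ⟨k, hk⟩ := hS.reach v
  induction k generalizing v with
  | zero => exact he.c v hk
  | succ k ih =>
    by_cases h : v ∈ S.U
    · exact he.c v h
    have h' : v ∉ S'.U := by
      intro h'
      obtain ⟨t, ht, ha⟩ := he.new v h' h
      exact hv v h (Anc.refl v) t ht ha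
    rw [hS'.cpar v h', hS.cpar v h]
    exact ih (fun z hz ha => hv z hz (ha.trans (Anc.par v))) hk

theorem Job.ext {V : Type} {par : V → V} {Z : Set V} {S S' : St V} {l t : List V} {f : Finset ℕ}
    {E : Set (Sym2 V)} (hS : WF par Z S)
    (hS' : WF par Z S') (he : SExt par S S' t) (hd : Disj par S l t) (hj : Job par S f l E) :
    Job par S' f l E := by
  rcases hj with h | ⟨h1, h2, P, X, Y, W, a, b, c, rfl, hf, hP, hX, hY, hW⟩
  · exact Or.inl h
  · have key : ∀ v ∈ P ++ (X ++ (Y ++ W)), S'.c v = S.c v := fun v hv =>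
      he.col_eq hS hS' (fun z hz ha y hy hb => hd z hz v hv y hy ha hb)
    refine Or.inr ⟨h1, fun w hw => h2 w (fun h => hw (he.U w h)), P, X, Y, W, a, b, c, rfl, hf, ?_⟩
    refine ⟨fun x hx => ?_, fun x hx => ?_, fun x hx => ?_, fun x hx => ?_⟩ <;>
      rw [key x (by simp [hx])]
    exacts [hP x hx, hX x hx, hY x hx, hW x hx]

theorem runJobs {V : Type} {par : V → V} {Z : Set V} {N : ℕ} (pl : PL par Z N) {S : St V}
    (hS : WF par Z S) {f1 f2 f3 : Finset ℕ} {R : Multiset (Finset ℕ)}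
    (hM : S.M = f1 ::ₘ f2 ::ₘ f3 ::ₘ R) (l1 l2 l3 l4 : List V) (E1 E2 E3 E4 : Set (Sym2 V))
    (j1 : Job par S f1 l1 E1) (j2 : Job par S f2 l2 E2) (j3 : Job par S f3 l3 E3)
    {n α : ℕ} (hn : n ∈ f1 ∧ α ∈ f1 ∨ n ∈ f2 ∧ α ∈ f2 ∨ n ∈ f3 ∧ α ∈ f3)
    (j4 : ∀ g : Finset ℕ, g.card = 3 → n ∈ g → α ∈ g → Job par S g l4 E4)
    (d12 : Disj par S l2 l1) (d13 : Disj par S l3 l1) (d23 : Disj par S l3 l2)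
    (d14 : Disj par S l4 l1) (d24 : Disj par S l4 l2) (d34 : Disj par S l4 l3)
    (n1 : l1.length < N) (n2 : l2.length < N) (n3 : l3.length < N) (n4 : l4.length < N)
    (l : List V) (hl : ∀ x, x ∈ l1 ∨ x ∈ l2 ∨ x ∈ l3 ∨ x ∈ l4 → x ∈ l) :
    ∃ S', WF par Z S' ∧ SExt par S S' l ∧ (∀ x, x ∈ l1 ∨ x ∈ l2 ∨ x ∈ l3 ∨ x ∈ l4 → x ∈ S'.U) ∧
    (∃ N, S'.M = N + R ∧ Cov N f1 ∧ Cov N f2 ∧ Cov N f3) ∧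
    ∀ x y, s(x, y) ∈ E1 ∪ E2 ∪ E3 ∪ E4 → Okay S' x y := by
  obtain ⟨S1, w1, e1, u1, ⟨N1, m1, c1⟩, o1⟩ := pl S f1 _ l1 E1 n1 hS hM j1
  obtain ⟨S2, w2, e2, u2, ⟨N2, m2, c2⟩, o2⟩ := pl S1 f2 (f3 ::ₘ (N1 + R)) l2 E2 n2 w1
    (by rw [m1]; simp [← Multiset.singleton_add, add_comm, add_left_comm, add_assoc]) (j2.ext hS w1 e1 d12)
  obtain ⟨S3, w3, e3, u3, ⟨N3, m3, c3⟩, o3⟩ := pl S2 f3 (N2 + (N1 + R)) l3 E3 n3 w2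
    (by rw [m2]; simp [← Multiset.singleton_add, add_comm, add_left_comm, add_assoc])
    ((j3.ext hS w1 e1 d13).ext w1 w2 e2 (d23.ext e1))
  set K := N3 + N2 + N1 with hK
  have cK : Cov K f1 ∧ Cov K f2 ∧ Cov K f3 := by
    refine ⟨fun x hx y hy => ?_, fun x hx y hy => ?_, fun x hx y hy => ?_⟩
    · obtain ⟨g, hg, h⟩ := c1 x hx y hy; exact ⟨g, by simp [hK, hg], h⟩
    · obtain ⟨g, hg, h⟩ := c2 x hx y hy; exact ⟨g, by simp [hK, hg], h⟩
    · obtain ⟨g, hg, h⟩ := c3 x hx y hy; exact ⟨g, by simp [hK, hg], h⟩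
  have mK : S3.M = K + R := by rw [m3, hK]; simp [add_assoc]
  obtain ⟨g, hg, hng, hαg⟩ : ∃ g ∈ K, n ∈ g ∧ α ∈ g := by
    rcases hn with h | h | h
    · exact cK.1 n h.1 α h.2
    · exact cK.2.1 n h.1 α h.2
    · exact cK.2.2 n h.1 α h.2
  obtain ⟨K', hK'⟩ := Multiset.exists_cons_of_mem hg
  have hg3 : g.card = 3 := (w3.apol.face g (by rw [mK]; simp [hg])).1
  obtain ⟨S4, w4, e4, u4, ⟨N4, m4, c4⟩, o4⟩ := pl S3 g (K' + R) l4 E4 n4 w3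
    (by rw [mK, hK']; simp)
    ((((j4 g hg3 hng hαg).ext hS w1 e1 d14).ext w1 w2 e2 (d24.ext e1)).ext w2 w3 e3 ((d34.ext e1).ext e2))
  have cT : ∀ f, Cov K f → Cov (N4 + K') f := by
    intro f hf x hx y hy
    obtain ⟨g', hg', h1, h2⟩ := hf x hx y hy
    rw [hK'] at hg'
    rcases Multiset.mem_cons.1 hg' with rfl | hg'
    · obtain ⟨g'', h3, h4⟩ := c4 x h1 y h2
      exact ⟨g'', by simp [h3], h4⟩
    · exact ⟨g', by simp [hg'], h1, h2⟩
  refine ⟨S4, w4, ?_, ?_, ⟨N4 + K', by rw [m4, add_assoc], cT _ cK.1, cT _ cK.2.1, cT _ cK.2.2⟩, ?_⟩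
  · have e12 : SExt par S S2 l := e1.trans e2 (fun x hx => hl x (by tauto)) (fun x hx => hl x (by tauto))
    have e13 : SExt par S S3 l := e12.trans e3 (fun x hx => hx) (fun x hx => hl x (by tauto))
    exact e13.trans e4 (fun x hx => hx) (fun x hx => hl x (by tauto))
  · rintro x (h | h | h | h)
    · exact e4.U _ (e3.U _ (e2.U _ (u1 x h)))
    · exact e4.U _ (e3.U _ (u2 x h))
    · exact e4.U _ (u3 x h)
    · exact u4 x h
  · rintro x y (((h | h) | h) | h)
    · exact (((o1 x y h).ext e2).ext e3).ext e4
    · exact ((o2 x y h).ext e3).ext e4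
    · exact (o3 x y h).ext e4
    · exact o4 x y h


noncomputable def insS {V : Type} (par : V → V) (S : St V) (T : List V) (a b c : ℕ) (R : Multiset (Finset ℕ)) : St V where
  U := {v | v ∈ S.U ∨ ∃ t ∈ T, Anc par v t}
  c := fun v => open Classical in if (∃ d, d ∉ S.U ∧ (∃ t ∈ T, Anc par d t) ∧ Anc par d v) then S.n else S.c v
  n := S.n + 1
  M := {S.n, a, b} ::ₘ {S.n, b, c} ::ₘ {S.n, a, c} ::ₘ R
  A := fun x y => S.A x y ∨ (x = S.n ∧ (y = a ∨ y = b ∨ y = c)) ∨ (y = S.n ∧ (x = a ∨ x = b ∨ x = c))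

theorem insS_c {V : Type} {par : V → V} {S : St V} {T : List V} {a b c : ℕ} {R : Multiset (Finset ℕ)} (v : V) :
    ((∃ d, d ∉ S.U ∧ (∃ t ∈ T, Anc par d t) ∧ Anc par d v) ∧ (insS par S T a b c R).c v = S.n) ∨
    (¬ (∃ d, d ∉ S.U ∧ (∃ t ∈ T, Anc par d t) ∧ Anc par d v) ∧ (insS par S T a b c R).c v = S.c v) := by
  unfold insS
  by_cases h : (∃ d, d ∉ S.U ∧ (∃ t ∈ T, Anc par d t) ∧ Anc par d v)
  · left; exact ⟨h, if_pos h⟩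
  · right; exact ⟨h, if_neg h⟩

theorem insS_wf {V : Type} {par : V → V} {Z : Set V} {S : St V} (hS : WF par Z S) {T : List V} (hT : T.length ≤ 3)
    {a b c : ℕ} {R : Multiset (Finset ℕ)} (hab : a ≠ b) (hbc : b ≠ c) (hac : a ≠ c)
    (hM : S.M = {a, b, c} ::ₘ R) : WF par Z (insS par S T a b c R) where
  apol := by
    have := hS.apol
    rw [hM] at this
    exact Apol.step _ _ _ a b c this hab hbc hac
  closed := by
    rintro v (h | ⟨t, ht, h⟩)
    · exact Or.inl (hS.closed v h)
    · exact Or.inr ⟨t, ht, (Anc.par v).trans h⟩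
  reach v := by
    obtain ⟨k, hk⟩ := hS.reach v
    exact ⟨k, Or.inl hk⟩
  cpar v hv := by
    have hv1 : v ∉ S.U := fun h => hv (Or.inl h)
    have hv2 : ¬ ∃ t ∈ T, Anc par v t := fun h => hv (Or.inr h)
    have key : (∃ d, d ∉ S.U ∧ (∃ t ∈ T, Anc par d t) ∧ Anc par d v) ↔
      (∃ d, d ∉ S.U ∧ (∃ t ∈ T, Anc par d t) ∧ Anc par d (par v)) := by
      constructor
      · rintro ⟨d, h1, h2, h3⟩
        rcases h3.cases' with rfl | h3
        · exact absurd h2 hv2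
        · exact ⟨d, h1, h2, h3⟩
      · rintro ⟨d, h1, h2, h3⟩
        exact ⟨d, h1, h2, h3.trans (Anc.par v)⟩
    rcases insS_c (par := par) (S := S) (T := T) (a := a) (b := b) (c := c) (R := R) v with h | h <;>
    rcases insS_c (par := par) (S := S) (T := T) (a := a) (b := b) (c := c) (R := R) (par v) with h' | h'
    · rw [h.2, h'.2]
    · exact absurd (key.1 h.1) h'.1
    · exact absurd (key.2 h'.1) h.1
    · rw [h.2, h'.2, hS.cpar v hv1]
  clt v := by
    have := hS.clt v
    rcases insS_c (par := par) (S := S) (T := T) (a := a) (b := b) (c := c) (R := R) v with h | h <;> rw [h.2] <;>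
      simp only [insS] <;> omega
  parts h hh := by
    by_cases hn : h = S.n
    · refine ⟨T, hT, ?_⟩
      subst hn
      rintro v hv hc
      rcases insS_c (par := par) (S := S) (T := T) (a := a) (b := b) (c := c) (R := R) v with h | h
      · obtain ⟨⟨d, h1, h2, h3⟩, -⟩ := h
        rcases hv with hv | hv
        · exact absurd (h3.closed hS.closed hv) h1
        · exact hv
      · have := hS.clt v; rw [h.2] at hc; omega
    · obtain ⟨T', hT', hh'⟩ := hS.parts h hh
      refine ⟨T', hT', fun v hv hc => ?_⟩
      rcases insS_c (par := par) (S := S) (T := T) (a := a) (b := b) (c := c) (R := R) v with h1 | h1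
      · exact absurd (hc.symm.trans h1.2) hn
      · refine hh' v ?_ (h1.2.symm.trans hc)
        by_contra hvU
        rcases hv with hv | hv
        · exact hvU hv
        · exact h1.1 ⟨v, hvU, hv, Anc.refl v⟩
  zero v hv hc := by
    rcases insS_c (par := par) (S := S) (T := T) (a := a) (b := b) (c := c) (R := R) v with h1 | h1
    · have := hS.npos; rw [h1.2] at hc; omega
    · refine hS.zero v ?_ (h1.2.symm.trans hc)
      by_contra hvU
      rcases hv with hv | hv
      · exact hvU hv
      · exact h1.1 ⟨v, hvU, hv, Anc.refl v⟩
  npos := by simp [insS]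

theorem insS_ext {V : Type} {par : V → V} {Z : Set V} {S : St V} (hS : WF par Z S) {T l : List V} (hT : ∀ t ∈ T, t ∈ l)
    {a b c : ℕ} {R : Multiset (Finset ℕ)} : SExt par S (insS par S T a b c R) l where
  U v hv := Or.inl hv
  c v hv := by
    rcases insS_c (par := par) (S := S) (T := T) (a := a) (b := b) (c := c) (R := R) v with h | h
    · obtain ⟨⟨d, h1, h2, h3⟩, -⟩ := h
      exact absurd (h3.closed hS.closed hv) h1
    · exact h.2
  A x y h := Or.inl h
  new v hv hv' := by
    rcases hv with hv | ⟨t, ht, h⟩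
    · exact absurd hv hv'
    · exact ⟨t, hT t ht, h⟩

def SegF {V : Type} (l K : List V) (σ : List V) (E : Set (Sym2 V)) (O : V → Prop) : Prop :=
  (σ = [] ∧ E = ∅) ∨ ∃ i m j r, σ = i :: (m ++ [j]) ∧ l ~r (i :: (m ++ j :: r)) ∧ i ∈ K ∧ j ∈ K ∧
    (∀ t ∈ K, t = i ∨ t = j ∨ t ∈ r) ∧ (∀ y, O y → y ∈ K ∨ y ∈ r) ∧ RR σ E

def Bi {V : Type} (S : St V) (a b : ℕ) (σ : List V) : Prop :=
  ∃ X Y, σ = X ++ Y ∧ (∀ x ∈ X, S.c x = a) ∧ ∀ y ∈ Y, S.c y = b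

theorem SegF.subset {V : Type} {l K σ : List V} {E : Set (Sym2 V)} {O : V → Prop} (h : SegF l K σ E O) :
    ∀ x ∈ σ, x ∈ l := by
  rcases h with ⟨rfl, -⟩ | ⟨i, m, j, r, rfl, hr, -⟩
  · simp
  · intro x hx
    rw [hr.perm.mem_iff]; simp at hx ⊢; tauto

/-- segments are disjoint w.r.t. the new state -/
theorem SegF.disj {V : Type} {par : V → V} {Z : Set V} {S : St V} (hS : WF par Z S) {T K l σ τ : List V}
    {a b c : ℕ} {R : Multiset (Finset ℕ)} {E : Set (Sym2 V)} {O : V → Prop}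
    (hNC : ∀ w, w ∉ S.U → NC (Anc par w) l)
    (hKT : ∀ k ∈ K, k ∈ S.U ∨ k ∈ T) (h : SegF l K σ E O) (hO : ∀ y ∈ τ, O y) :
    Disj par (insS par S T a b c R) σ τ := by
  rcases h with ⟨rfl, -⟩ | ⟨i, m, j, r, rfl, hr, hi, hj, hK, hOr, -⟩
  · intro z _ x hx; simp at hx
  intro z hz x hx y hy h1 h2
  have hzU : z ∉ S.U := fun h => hz (Or.inl h)
  have nK : ∀ k ∈ K, ¬ Anc par z k := by
    intro k hk ha
    rcases hKT k hk with h | h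
    · exact hzU (ha.closed hS.closed h)
    · exact hz (Or.inr ⟨k, h, ha⟩)
  have hxm : x ∈ m := by
    simp at hx
    rcases hx with rfl | hx | rfl
    · exact absurd h1 (nK _ hi)
    · exact hx
    · exact absurd h1 (nK _ hj)
  have hyr : y ∈ r := by
    rcases hOr y (hO y hy) with h | h
    · exact absurd h2 (nK _ h)
    · exact h
  have := (hNC z hzU).rot hr i x j y (by
    refine List.Sublist.cons_cons _ ?_
    exact List.Sublist.append (l₁ := [x]) (by simpa using hxm) (List.Sublist.cons_cons _ (by simpa using hyr)))
  exact this.2 ⟨nK _ hi, h1, nK _ hj, h2⟩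

theorem SegF.job {V : Type} {par : V → V} {Z : Set V} {S : St V} (hS : WF par Z S) {T K l σ : List V}
    {a b c a1 b1 : ℕ} {f : Finset ℕ} {R : Multiset (Finset ℕ)} {E : Set (Sym2 V)} {O : V → Prop}
    (hNC : ∀ w, w ∉ S.U → NC (Anc par w) l) (hTK : ∀ t ∈ T, t ∈ K)
    (h : SegF l K σ E O) (hb : Bi S a1 b1 σ) (hf : f = {a1, b1, S.n}) :
    Job par (insS par S T a b c R) f σ E := by
  rcases h with h | ⟨i, m, j, r, he, hr, hi, hj, hK, hOr, hRR⟩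
  · exact Or.inl h
  refine Or.inr ⟨hRR, ?_, ?_⟩
  · intro w hw
    refine ((hNC w (fun h => hw (Or.inl h))).rot hr).sub ?_
    rw [he]
    exact List.Sublist.cons_cons _ (List.Sublist.append (List.Sublist.refl _) (by simp))
  obtain ⟨P, C, W, hσ, hP, hC, hW⟩ := contig (fun v => (∃ d, d ∉ S.U ∧ (∃ t ∈ T, Anc par d t) ∧ Anc par d v)) σ (by
    intro p1 q p2 hsub h1 ⟨d, hd, ⟨t, ht, hdt⟩, hdq⟩ h2
    have h1' : ¬ Anc par d p1 := fun hh => h1 ⟨d, hd, ⟨t, ht, hdt⟩, hh⟩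
    have h2' : ¬ Anc par d p2 := fun hh => h2 ⟨d, hd, ⟨t, ht, hdt⟩, hh⟩
    have n1 : p1 ≠ t := fun hh => h1' (hh ▸ hdt)
    have n2 : p2 ≠ t := fun hh => h2' (hh ▸ hdt)
    have nc := (hNC d hd).rot hr
    rw [he] at hsub
    rcases hK t (hTK t ht) with rfl | rfl | htr
    · have hs : List.Sublist [p1, q, p2] (m ++ [j]) := by
        cases hsub with
        | cons _ h => exact h
        | cons_cons _ h => exact absurd rfl n1
      have := nc t p1 q p2 (List.Sublist.cons_cons _ (hs.trans (List.Sublist.append (List.Sublist.refl _) (by simp))))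
      exact this.1 ⟨hdt, h1', hdq, h2'⟩
    · have hs : List.Sublist [p1, q, p2] (i :: m) := by
        have hsub' : List.Sublist [p1, q, p2] ((i :: m) ++ [t]) := by simpa using hsub
        have := List.reverse_sublist.2 hsub'
        simp only [List.reverse_append, List.reverse_cons, List.reverse_nil, List.nil_append, List.cons_append] at this
        cases this with
        | cons _ h => have := List.reverse_sublist.2 h; simpa using this
        | cons_cons _ h => exact absurd rfl n2
      have := nc p1 q p2 t (by
        have := List.Sublist.append hs (show List.Sublist [t] (t :: r) by simp)
        simpa using this)
      exact this.2 ⟨h1', hdq, h2', hdt⟩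
    · have := nc p1 q p2 t (by
        have := List.Sublist.append hsub (show List.Sublist [t] r by simpa using htr)
        simpa using this)
      exact this.2 ⟨h1', hdq, h2', hdt⟩)
  obtain ⟨X, Y, hXY, hX, hY⟩ := hb
  have hCs : List.Sublist C (X ++ Y) := by
    rw [← hXY, hσ]
    exact (List.sublist_append_left C W).trans (List.sublist_append_right _ _)
  rw [List.sublist_append_iff] at hCs
  obtain ⟨C1, C2, rfl, hC1, hC2⟩ := hCs
  have pos : ∀ v, (∃ d, d ∉ S.U ∧ (∃ t ∈ T, Anc par d t) ∧ Anc par d v) → (insS par S T a b c R).c v = S.n := by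
    intro v hv
    rcases insS_c (par := par) (S := S) (T := T) (a := a) (b := b) (c := c) (R := R) v with h | h
    · exact h.2
    · exact absurd hv h.1
  have neg : ∀ v, ¬ (∃ d, d ∉ S.U ∧ (∃ t ∈ T, Anc par d t) ∧ Anc par d v) → (insS par S T a b c R).c v = S.c v := by
    intro v hv
    rcases insS_c (par := par) (S := S) (T := T) (a := a) (b := b) (c := c) (R := R) v with h | h
    · exact absurd h.1 hv
    · exact h.2
  refine ⟨P, C1, C2, W, a1, b1, S.n, by simpa using hσ, hf, fun x hx => pos x (hP x hx), ?_, ?_, fun x hx => pos x (hW x hx)⟩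
  · intro x hx
    rw [neg x (hC x (by simp [hx]))]; exact hX x (hC1.subset hx)
  · intro x hx
    rw [neg x (hC x (by simp [hx]))]; exact hY x (hC2.subset hx)

theorem stepL {V : Type} {par : V → V} {Z : Set V} {N : ℕ} (pl : PL par Z N) {S : St V} (hS : WF par Z S)
    {a b c : ℕ} {R : Multiset (Finset ℕ)} (hab : a ≠ b) (hbc : b ≠ c) (hac : a ≠ c)
    (hM : S.M = {a, b, c} ::ₘ R) (T K l : List V) (hT3 : T.length ≤ 3) (hTK : ∀ t ∈ T, t ∈ K)
    (hTU : ∀ t ∈ T, t ∉ S.U)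
    (hKT : ∀ k ∈ K, k ∈ S.U ∨ k ∈ T) (hKl : ∀ k ∈ K, k ∈ l)
    (hNC : ∀ w, w ∉ S.U → NC (Anc par w) l)
    (hcol : ∀ k ∈ K, S.c k = a ∨ S.c k = b ∨ S.c k = c)
    (l1 l2 l3 l4 : List V) (E1 E2 E3 E4 : Set (Sym2 V))
    (s1 : SegF l K l1 E1 (fun y => y ∈ l2 ∨ y ∈ l3 ∨ y ∈ l4))
    (s2 : SegF l K l2 E2 (fun y => y ∈ l1 ∨ y ∈ l3 ∨ y ∈ l4))
    (s3 : SegF l K l3 E3 (fun y => y ∈ l1 ∨ y ∈ l2 ∨ y ∈ l4))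
    (s4 : SegF l K l4 E4 (fun y => y ∈ l1 ∨ y ∈ l2 ∨ y ∈ l3))
    (b1 : Bi S a b l1) (b2 : Bi S b c l2) (b3 : Bi S c a l3) (α : ℕ) (hα : α = a ∨ α = b ∨ α = c)
    (b4 : ∀ x ∈ l4, S.c x = α)
    (n1 : l1.length < N) (n2 : l2.length < N) (n3 : l3.length < N) (n4 : l4.length < N)
    (hcov : ∀ x ∈ l, x ∈ K ∨ x ∈ l1 ∨ x ∈ l2 ∨ x ∈ l3 ∨ x ∈ l4) :
    ∃ S', WF par Z S' ∧ SExt par S S' l ∧ (∀ x ∈ l, x ∈ S'.U) ∧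
    (∃ N, S'.M = N + R ∧ Cov N {a, b, c}) ∧
    (∀ x y, s(x, y) ∈ E1 ∪ E2 ∪ E3 ∪ E4 → Okay S' x y) ∧ (∀ x ∈ K, ∀ y ∈ K, Okay S' x y) ∧
    ∀ o ∈ T, ∀ nb ∈ T, ∀ x, Okay S' x nb → Okay S' x o := by
  have w := insS_wf hS hT3 hab hbc hac hM
  have hface := (hS.apol.face {a, b, c} (by rw [hM]; simp)).2
  have e := insS_ext (par := par) hS (T := T) (l := l) (fun t ht => hKl t (hTK t ht)) (a := a) (b := b) (c := c) (R := R)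
  obtain ⟨S', w', e', u', ⟨N, hN, c1, c2, c3⟩, ok⟩ := runJobs pl w (n := S.n) (α := α) rfl l1 l2 l3 l4 E1 E2 E3 E4
    (s1.job hS hNC hTK b1 (by ext; simp; try tauto)) (s2.job hS hNC hTK b2 (by ext; simp; try tauto))
    (s3.job hS hNC hTK b3 (by ext; simp; try tauto)) (by simp; tauto)
    (by
      intro g hg hn hag
      have hne : α ≠ S.n := by
        have h1 := hface.1
        simp at h1
        omega
      have h2 : ({α, S.n} : Finset ℕ) ⊆ g := by intro x; simp; rintro (rfl | rfl) <;> assumption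
      obtain ⟨β, hβ⟩ : ∃ β, g = {α, β, S.n} := by
        have h3 : (g \ {α, S.n}).card = 1 := by
          rw [Finset.card_sdiff_of_subset h2, hg, Finset.card_pair hne]
        obtain ⟨β, hβ⟩ := Finset.card_eq_one.1 h3
        refine ⟨β, ?_⟩
        rw [← Finset.sdiff_union_of_subset h2, hβ]
        ext; simp
      exact s4.job hS hNC hTK ⟨l4, [], by simp, b4, by simp⟩ hβ)
    (s2.disj hS hNC hKT (by tauto)) (s3.disj hS hNC hKT (by tauto)) (s3.disj hS hNC hKT (by tauto))
    (s4.disj hS hNC hKT (by tauto)) (s4.disj hS hNC hKT (by tauto)) (s4.disj hS hNC hKT (by tauto))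
    n1 n2 n3 n4 l (by
      rintro x (h | h | h | h)
      · exact s1.subset x h
      · exact s2.subset x h
      · exact s3.subset x h
      · exact s4.subset x h)
  have hKU1 : ∀ k ∈ K, k ∈ (insS par S T a b c R).U := by
    intro k hk
    rcases hKT k hk with h | h
    · exact Or.inl h
    · exact Or.inr ⟨k, h, Anc.refl k⟩
  have hTn : ∀ t ∈ T, (insS par S T a b c R).c t = S.n := by
    intro t ht
    rcases insS_c (par := par) (S := S) (T := T) (a := a) (b := b) (c := c) (R := R) t with h | h
    · exact h.2
    · exact absurd ⟨t, hTU t ht, ⟨t, ht, Anc.refl t⟩, Anc.refl t⟩ h.1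
  have hKc : ∀ k ∈ K, (insS par S T a b c R).c k = S.n ∨ (insS par S T a b c R).c k = a ∨
      (insS par S T a b c R).c k = b ∨ (insS par S T a b c R).c k = c := by
    intro k hk
    rcases hKT k hk with h | h
    · rw [e.c k h]; right; exact hcol k hk
    · left; exact hTn k h
  refine ⟨S', w', e.trans e' (fun _ h => h) (fun _ h => h), ?_, ⟨N, hN, ?_⟩, ok, ?_, ?_⟩
  · intro x hx
    rcases hcov x hx with h | h
    · exact e'.U _ (hKU1 x h)
    · exact u' x h
  · intro x hx y hy
    simp at hx hy
    rcases hx with rfl | rfl | rfl <;> rcases hy with rfl | rfl | rfl <;>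
      first
        | (refine c1 _ ?_ _ ?_ <;> (simp; done))
        | (refine c2 _ ?_ _ ?_ <;> (simp; done))
        | (refine c3 _ ?_ _ ?_ <;> (simp; done))
  · intro x hx y hy
    refine Okay.ext (S := insS par S T a b c R) ⟨hKU1 x hx, hKU1 y hy, ?_⟩ e'
    have hA := hface.2
    have h1 := hKc x hx
    have h2 := hKc y hy
    by_cases hxy : (insS par S T a b c R).c x = (insS par S T a b c R).c y
    · exact Or.inl hxy
    right
    generalize (insS par S T a b c R).c x = p at *
    generalize (insS par S T a b c R).c y = q at *
    have := hA p
    have := this (y := q)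
    simp at this
    simp only [insS]
    rcases h1 with rfl | h1
    · rcases h2 with rfl | h2
      · exact absurd rfl hxy
      · right; left; exact ⟨rfl, h2⟩
    · rcases h2 with rfl | h2
      · right; right; exact ⟨rfl, h1⟩
      · left; exact this h1 h2 hxy
  · intro o ho nb hnb x ⟨h1, h2, h3⟩
    have ho1 := hKU1 o (hTK o ho)
    have hnb1 := hKU1 nb (hTK nb hnb)
    refine ⟨h1, e'.U _ ho1, ?_⟩
    rw [e'.c _ ho1, hTn o ho]
    rwa [e'.c _ hnb1, hTn nb hnb] at h3


def Found3 {V : Type} (rk : V → ℕ) (l : List V) (E : Set (Sym2 V)) : Prop :=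
  ∃ p i m1 j m2 k s E1 E2 E3, l = p ++ i :: (m1 ++ j :: (m2 ++ k :: s)) ∧ rk i = 0 ∧ rk j = 1 ∧ rk k = 2 ∧
    RR (i :: (m1 ++ [j])) E1 ∧ RR (j :: (m2 ++ [k])) E2 ∧ RR (p ++ i :: k :: s) E3 ∧
    E ⊆ E1 ∪ E2 ∪ E3 ∪ {s(i, k)}

def Found4 {V : Type} (rk : V → ℕ) (l : List V) (E : Set (Sym2 V)) : Prop :=
  ∃ p i m1 j m2 k m3 t s E1 E2 E3 E4, l = p ++ i :: (m1 ++ j :: (m2 ++ k :: (m3 ++ t :: s))) ∧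
    rk i = 0 ∧ rk t = 2 ∧ (rk j = 0 ∧ rk k = 1 ∨ rk j = 1 ∧ rk k = 1 ∨ rk j = 1 ∧ rk k = 2) ∧
    RR (i :: (m1 ++ [j])) E1 ∧ RR (j :: (m2 ++ [k])) E2 ∧ RR (k :: (m3 ++ [t])) E3 ∧ RR (p ++ i :: t :: s) E4 ∧
    E ⊆ E1 ∪ E2 ∪ E3 ∪ E4 ∪ {s(i, t), s(i, k), s(j, t)}

def Ctx {V : Type} (A l2 B : List V) (Ec : Set (Sym2 V)) : Prop :=
  ∀ l2' E2', RR l2' E2' → l2'.head? = l2.head? → l2'.getLast? = l2.getLast? → RR (A ++ l2' ++ B) (E2' ∪ Ec)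

theorem Found3.lift {V : Type} {rk : V → ℕ} {A l2 B : List V} {Ec E2 E : Set (Sym2 V)} (hc : Ctx A l2 B Ec)
    (h : Found3 rk l2 E2) (hE : E ⊆ E2 ∪ Ec) : Found3 rk (A ++ l2 ++ B) E := by
  obtain ⟨p, i, m1, j, m2, k, s, F1, F2, F3, rfl, hi, hj, hk, h1, h2, h3, hF⟩ := h
  refine ⟨A ++ p, i, m1, j, m2, k, s ++ B, F1, F2, F3 ∪ Ec, by simp, hi, hj, hk, h1, h2, ?_, ?_⟩
  · have := hc _ _ h3 (by simp [List.head?_append]) (by simp [List.getLast?_append, List.getLast?_cons])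
    simpa using this
  · intro z hz
    have h1 := hE hz
    have h2 := @hF z
    simp at *; tauto

theorem Found4.lift {V : Type} {rk : V → ℕ} {A l2 B : List V} {Ec E2 E : Set (Sym2 V)} (hc : Ctx A l2 B Ec)
    (h : Found4 rk l2 E2) (hE : E ⊆ E2 ∪ Ec) : Found4 rk (A ++ l2 ++ B) E := by
  obtain ⟨p, i, m1, j, m2, k, m3, t, s, F1, F2, F3, F4, rfl, hi, hj, hk, h1, h2, h3, h4, hF⟩ := h
  refine ⟨A ++ p, i, m1, j, m2, k, m3, t, s ++ B, F1, F2, F3, F4 ∪ Ec, by simp, hi, hj, hk, h1, h2, h3, ?_, ?_⟩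
  · have := hc _ _ h4 (by simp [List.head?_append]) (by simp [List.getLast?_append, List.getLast?_cons])
    simpa using this
  · intro z hz
    have h1 := hE hz
    have h2 := @hF z
    simp at *; tauto

theorem head_cons {V : Type} {l : List V} {u : V} (h : l.head? = some u) : ∃ t, l = u :: t := by
  cases l with
  | nil => simp at h
  | cons a t => simp at h; subst h; exact ⟨t, rfl⟩

set_option maxHeartbeats 8000000 in
theorem find3 {V : Type} (rk : V → ℕ) {l : List V} {E : Set (Sym2 V)} (h : RR l E) :
    ∀ (_ : l.Pairwise (fun x y => rk x ≤ rk y)) (_ : ∀ x ∈ l, rk x ≤ 2) (_ : ∀ u, l.head? = some u → rk u = 0)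
      (_ : ∀ v, l.getLast? = some v → rk v = 2) (_ : ∃ x ∈ l, rk x = 1), Found3 rk l E ∨ Found4 rk l E := by
  induction h with
  | leaf u v E hE =>
    intro _ _ h1 h2 h3
    simp at h1 h2 h3; omega
  | tri u x v P Q E1 E2 E hu hv h1 h2 h ih1 ih2 =>
    intro hs h2' hh hl hx
    have hu0 : rk u = 0 := hh u (by simp [List.head?_append, hu])
    have hv2 : rk v = 2 := hl v (by simp [List.getLast?_append, List.getLast?_cons, hv])
    have hx2 : rk x ≤ 2 := h2' x (by simp)
    have s1 : (P ++ [x]).Pairwise (fun x y => rk x ≤ rk y) :=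
      hs.sublist (List.Sublist.append (List.Sublist.refl _) (by simp))
    have s2 : (x :: Q).Pairwise (fun x y => rk x ≤ rk y) :=
      hs.sublist (by simp)
    obtain ⟨y, hy, hy1⟩ := hx
    obtain h0 | h0 | h0 : rk x = 0 ∨ rk x = 1 ∨ rk x = 2 := by omega
    · have hy' : y ∈ x :: Q := by
        simp at hy ⊢
        rcases hy with hy | hy
        · have := (List.pairwise_append.1 s1).2.2 y hy x (by simp); omega
        · exact hy
      have r := ih2 s2 (fun z hz => h2' z (by simp at hz ⊢; clear * - hz; tauto)) (by simp [h0])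
        (by intro w hw; simp [List.getLast?_cons, hv] at hw; subst hw; exact hv2) ⟨y, hy', hy1⟩
      have hc : Ctx P (x :: Q) [] (E1 ∪ {s(u, v)}) := by
        intro l' E' r' hd hla
        obtain ⟨t, rfl⟩ := head_cons (u := x) (by simpa using hd)
        have hr := r'.len
        have : RR (P ++ x :: t) (E' ∪ (E1 ∪ {s(u, v)})) := RR.tri u x v P t E1 E' _ hu (by
          rcases t with _ | ⟨a, t⟩
          · simp at hr
          · simpa [List.getLast?_cons, hv] using hla) h1 r' (by intro z hz; clear * - hz; simp at *; tauto)
        simpa using this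
      have hE' : E ⊆ E2 ∪ (E1 ∪ {s(u, v)}) := by intro z hz; have := h hz; clear * - this; simp at *; tauto
      rcases r with r | r
      · left; simpa using r.lift hc hE'
      · right; simpa using r.lift hc hE'
    · left
      obtain ⟨P', rfl⟩ := head_cons hu
      obtain ⟨Q', rfl⟩ := List.getLast?_eq_some_iff.1 hv
      exact ⟨[], u, P', x, Q', v, [], E1, E2, ∅, by simp, hu0, h0, hv2, by simpa using h1, by simpa using h2,
        RR.leaf _ _ _ (by simp), by simpa using h⟩
    · have hy' : y ∈ P ++ [x] := by
        simp at hy ⊢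
        rcases hy with hy | hy | hy
        · exact Or.inl hy
        · exact Or.inr hy
        · rw [List.pairwise_cons] at s2; have := s2.1 y hy; omega
      have r := ih1 s1 (fun z hz => h2' z (by simp at hz ⊢; clear * - hz; tauto)) (by intro w hw; simp [List.head?_append, hu] at hw; subst hw; exact hu0)
        (by intro w hw; simp at hw; subst hw; exact h0) ⟨y, hy', hy1⟩
      have hc : Ctx [] (P ++ [x]) Q (E2 ∪ {s(u, v)}) := by
        intro l' E' r' hd hla
        obtain ⟨t, rfl⟩ := List.getLast?_eq_some_iff.1 (show l'.getLast? = some x by simpa using hla)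
        have hr := r'.len
        have : RR (t ++ x :: Q) (E' ∪ (E2 ∪ {s(u, v)})) := RR.tri u x v t Q E' E2 _ (by
          rcases t with _ | ⟨a, t⟩
          · simp at hr
          · simpa [List.head?_append, hu] using hd) hv r' h2 (by intro z hz; clear * - hz; simp at *; tauto)
        simpa using this
      have hE' : E ⊆ E1 ∪ (E2 ∪ {s(u, v)}) := by intro z hz; have := h hz; clear * - this; simp at *; tauto
      rcases r with r | r
      · left; simpa using r.lift hc hE'
      · right; simpa using r.lift hc hE'
  | quad u x y v P Q S E1 E2 E3 E hu hv h1 h2 h3 h ih1 ih2 ih3 =>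
    intro hs h2' hh hl hx
    have hu0 : rk u = 0 := hh u (by simp [List.head?_append, hu])
    have hv2 : rk v = 2 := hl v (by simp [List.getLast?_append, List.getLast?_cons, hv])
    have hx2 : rk x ≤ 2 := h2' x (by simp)
    have hy2 : rk y ≤ 2 := h2' y (by simp)
    have s1 : (P ++ [x]).Pairwise (fun x y => rk x ≤ rk y) :=
      hs.sublist (List.Sublist.append (List.Sublist.refl _) (by simp))
    have s2 : (x :: (Q ++ [y])).Pairwise (fun x y => rk x ≤ rk y) :=
      hs.sublist ((List.Sublist.cons_cons x (List.Sublist.append (List.Sublist.refl Q) (by simp : List.Sublist [y] (y :: S)))).trans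
        (List.sublist_append_right P _))
    have s3 : (y :: S).Pairwise (fun x y => rk x ≤ rk y) :=
      hs.sublist (((List.sublist_append_right Q (y :: S)).trans (List.sublist_cons_self x _)).trans (List.sublist_append_right P _))
    obtain ⟨w, hw, hw1⟩ := hx
    have hPx : ∀ z ∈ P, rk z ≤ rk x := fun z hz => (List.pairwise_append.1 s1).2.2 z hz x (by simp)
    have hxQ : ∀ z ∈ Q, rk x ≤ rk z := fun z hz => (List.pairwise_cons.1 s2).1 z (by simp [hz])
    have hxy : rk x ≤ rk y := (List.pairwise_cons.1 s2).1 y (by simp)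
    have hQy : ∀ z ∈ Q, rk z ≤ rk y := fun z hz => (List.pairwise_append.1 (List.pairwise_cons.1 s2).2).2.2 z hz y (by simp)
    have hyS : ∀ z ∈ S, rk y ≤ rk z := fun z hz => (List.pairwise_cons.1 s3).1 z (by simp [hz])
    simp only [List.mem_append, List.mem_cons] at hw
    obtain h0 | h0 | h0 | h0 : (rk x = 0 ∧ rk y = 0) ∨ rk x = 2 ∨ (rk x = 0 ∧ rk y = 2) ∨
        (rk x = 0 ∧ rk y = 1 ∨ rk x = 1 ∧ rk y = 1 ∨ rk x = 1 ∧ rk y = 2) := by omega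
    · have hw' : w ∈ y :: S := by
        simp only [List.mem_cons]
        rcases hw with hw | rfl | hw | rfl | hw
        · have := hPx w hw; omega
        · omega
        · have := hQy w hw; omega
        · exact Or.inl rfl
        · exact Or.inr hw
      have r := ih3 s3 (fun z hz => h2' z (by simp at hz ⊢; clear * - hz; tauto)) (by simp [h0.2])
        (by intro w hw; simp [List.getLast?_cons, hv] at hw; subst hw; exact hv2) ⟨w, hw', hw1⟩
      have hc : Ctx (P ++ x :: Q) (y :: S) [] (E1 ∪ E2 ∪ {s(u, v), s(u, y), s(x, v)}) := by
        intro l' E' r' hd hla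
        obtain ⟨t, rfl⟩ := head_cons (u := y) (by simpa using hd)
        have hr := r'.len
        have : RR (P ++ x :: (Q ++ y :: t)) (E' ∪ (E1 ∪ E2 ∪ {s(u, v), s(u, y), s(x, v)})) :=
          RR.quad u x y v P Q t E1 E2 E' _ hu (by
            rcases t with _ | ⟨a, t⟩
            · simp at hr
            · simpa [List.getLast?_cons, hv] using hla) h1 h2 r' (by intro z hz; clear * - hz; simp at *; tauto)
        simpa using this
      have hE' : E ⊆ E3 ∪ (E1 ∪ E2 ∪ {s(u, v), s(u, y), s(x, v)}) := by
        intro z hz; have := h hz; clear * - this; simp at *; tauto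
      rcases r with r | r
      · left; simpa using r.lift hc hE'
      · right; simpa using r.lift hc hE'
    · have hw' : w ∈ P ++ [x] := by
        simp only [List.mem_append, List.mem_singleton]
        rcases hw with hw | rfl | hw | rfl | hw
        · exact Or.inl hw
        · exact Or.inr rfl
        · have := hxQ w hw; omega
        · omega
        · have := hyS w hw; omega
      have r := ih1 s1 (fun z hz => h2' z (by simp at hz ⊢; clear * - hz; tauto)) (by intro w hw; simp [List.head?_append, hu] at hw; subst hw; exact hu0)
        (by intro w hw; simp at hw; subst hw; exact h0) ⟨w, hw', hw1⟩
      have hc : Ctx [] (P ++ [x]) (Q ++ y :: S) (E2 ∪ E3 ∪ {s(u, v), s(u, y), s(x, v)}) := by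
        intro l' E' r' hd hla
        obtain ⟨t, rfl⟩ := List.getLast?_eq_some_iff.1 (show l'.getLast? = some x by simpa using hla)
        have hr := r'.len
        have : RR (t ++ x :: (Q ++ y :: S)) (E' ∪ (E2 ∪ E3 ∪ {s(u, v), s(u, y), s(x, v)})) :=
          RR.quad u x y v t Q S E' E2 E3 _ (by
            rcases t with _ | ⟨a, t⟩
            · simp at hr
            · simpa [List.head?_append, hu] using hd) hv r' h2 h3 (by intro z hz; clear * - hz; simp at *; tauto)
        simpa using this
      have hE' : E ⊆ E1 ∪ (E2 ∪ E3 ∪ {s(u, v), s(u, y), s(x, v)}) := by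
        intro z hz; have := h hz; clear * - this; simp at *; tauto
      rcases r with r | r
      · left; simpa using r.lift hc hE'
      · right; simpa using r.lift hc hE'
    · have hw' : w ∈ x :: (Q ++ [y]) := by
        simp only [List.mem_append, List.mem_singleton, List.mem_cons]
        rcases hw with hw | rfl | hw | rfl | hw
        · have := hPx w hw; omega
        · omega
        · exact Or.inr (Or.inl hw)
        · simp
        · have := hyS w hw; omega
      have r := ih2 s2 (fun z hz => h2' z (by simp at hz ⊢; clear * - hz; tauto)) (by simp [h0.1])
        (by intro w hw; simp [List.getLast?_cons] at hw; subst hw; exact h0.2) ⟨w, hw', hw1⟩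
      have hc : Ctx P (x :: (Q ++ [y])) S (E1 ∪ E3 ∪ {s(u, v), s(u, y), s(x, v)}) := by
        intro l' E' r' hd hla
        obtain ⟨t, rfl⟩ := head_cons (u := x) (by simpa using hd)
        have hr := r'.len
        obtain ⟨t', rfl⟩ : ∃ t', t = t' ++ [y] := by
          rcases t with _ | ⟨a, t⟩
          · simp at hr
          · apply List.getLast?_eq_some_iff.1
            simpa [List.getLast?_cons] using hla
        have : RR (P ++ x :: (t' ++ y :: S)) (E' ∪ (E1 ∪ E3 ∪ {s(u, v), s(u, y), s(x, v)})) :=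
          RR.quad u x y v P t' S E1 E' E3 _ hu hv h1 r' h3 (by intro z hz; clear * - hz; simp at *; tauto)
        simpa using this
      have hE' : E ⊆ E2 ∪ (E1 ∪ E3 ∪ {s(u, v), s(u, y), s(x, v)}) := by
        intro z hz; have := h hz; clear * - this; simp at *; tauto
      rcases r with r | r
      · left; simpa using r.lift hc hE'
      · right; simpa using r.lift hc hE'
    · right
      obtain ⟨P', rfl⟩ := head_cons hu
      obtain ⟨S', rfl⟩ := List.getLast?_eq_some_iff.1 hv
      exact ⟨[], u, P', x, Q, y, S', v, [], E1, E2, E3, ∅, by simp, hu0, hv2, h0, by simpa using h1, h2, by simpa using h3,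
        RR.leaf _ _ _ (by simp), by simpa using h⟩

def Out {V : Type} (par : V → V) (Z : Set V) (S : St V) (f : Finset ℕ) (R : Multiset (Finset ℕ))
    (l K : List V) (E : Set (Sym2 V)) : Prop :=
  ∃ S', WF par Z S' ∧ SExt par S S' l ∧ (∀ x ∈ l, x ∈ S'.U) ∧
    (∃ N, S'.M = N + R ∧ Cov N f) ∧ (∀ x y, s(x, y) ∈ E → Okay S' x y) ∧ (∀ x ∈ K, ∀ y ∈ K, Okay S' x y) ∧
    ∀ o ∈ K, ∀ nb ∈ K, o ∉ S.U → nb ∉ S.U → ∀ x, Okay S' x nb → Okay S' x o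

def OSeg {V : Type} (i : V) (m : List V) (j : V) (σ : List V) (E : Set (Sym2 V)) : Prop :=
  (σ = [] ∧ E = ∅ ∧ m = []) ∨ (σ = i :: (m ++ [j]) ∧ RR σ E)

theorem OSeg.mem {V : Type} {i j : V} {m σ : List V} {E : Set (Sym2 V)} (h : OSeg i m j σ E) :
    ∀ x ∈ σ, x = i ∨ x = j ∨ x ∈ m := by
  rcases h with ⟨rfl, -⟩ | ⟨rfl, -⟩
  · simp
  · intro x hx; simp at hx; tauto

theorem OSeg.mem' {V : Type} {i j : V} {m σ : List V} {E : Set (Sym2 V)} (h : OSeg i m j σ E) :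
    ∀ x ∈ m, x ∈ σ := by
  rcases h with ⟨rfl, -, rfl⟩ | ⟨rfl, -⟩
  · simp
  · intro x hx; simp; tauto

theorem OSeg.len {V : Type} {i j : V} {m σ : List V} {E : Set (Sym2 V)} (h : OSeg i m j σ E) :
    σ.length ≤ m.length + 2 := by
  rcases h with ⟨rfl, -, rfl⟩ | ⟨rfl, -⟩ <;> simp

theorem OSeg.seg {V : Type} {i j : V} {m r σ l K : List V} {E : Set (Sym2 V)} {O : V → Prop} (h : OSeg i m j σ E)
    (hr : l ~r (i :: (m ++ j :: r))) (hi : i ∈ K) (hj : j ∈ K) (hK : ∀ t ∈ K, t = i ∨ t = j ∨ t ∈ r)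
    (hO : ∀ y, O y → y ∈ K ∨ y ∈ r) : SegF l K σ E O := by
  rcases h with ⟨h1, h2, -⟩ | ⟨h1, h2⟩
  · exact Or.inl ⟨h1, h2⟩
  · exact Or.inr ⟨i, m, j, r, h1, hr, hi, hj, hK, hO, h2⟩

set_option maxHeartbeats 8000000 in
theorem do3 {V : Type} {par : V → V} {Z : Set V} {S : St V} (hS : WF par Z S)
    {a b c : ℕ} {R : Multiset (Finset ℕ)} (hab : a ≠ b) (hbc : b ≠ c) (hac : a ≠ c)
    (hM : S.M = {a, b, c} ::ₘ R) (l : List V) (pl : PL par Z l.length)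
    (hNC : ∀ w, w ∉ S.U → NC (Anc par w) l)
    (hcol : ∀ k ∈ l, S.c k = a ∨ S.c k = b ∨ S.c k = c)
    (i j k : V) (m1 m2 m3 : List V) (hl : l ~r (i :: (m1 ++ j :: (m2 ++ k :: m3))))
    (l1 l2 l3 : List V) (E1 E2 E3 : Set (Sym2 V)) (o1 : OSeg i m1 j l1 E1) (o2 : OSeg j m2 k l2 E2)
    (o3 : OSeg k m3 i l3 E3) (b1 : Bi S a b l1) (b2 : Bi S b c l2) (b3 : Bi S c a l3) :
    Out par Z S {a, b, c} R l [i, j, k] (E1 ∪ E2 ∪ E3) := by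
  classical
  have hl2 : l ~r (j :: (m2 ++ k :: (m3 ++ i :: m1))) := by
    have := hl.trans (isRot_append (i :: m1) (j :: (m2 ++ k :: m3))); simpa using this
  have hl3 : l ~r (k :: (m3 ++ i :: (m1 ++ j :: m2))) := by
    have := hl2.trans (isRot_append (j :: m2) (k :: (m3 ++ i :: m1))); simpa using this
  have mem : ∀ x, x ∈ l ↔ x ∈ (i :: (m1 ++ j :: (m2 ++ k :: m3))) := fun x => hl.perm.mem_iff
  have hlen := hl.perm.length_eq
  have g1 := o1.mem; have g2 := o2.mem; have g3 := o3.mem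
  have g1' := o1.mem'; have g2' := o2.mem'; have g3' := o3.mem'
  have n1 := o1.len; have n2 := o2.len; have n3 := o3.len
  simp at hlen
  obtain ⟨S', w, e, u, N, ok, okK, cl⟩ := stepL pl hS hab hbc hac hM ([i, j, k].filter (fun v => v ∉ S.U)) [i, j, k] l
    (List.length_filter_le _ _) (by intro t ht; exact (List.mem_filter.1 ht).1) (by intro t ht; simpa using (List.mem_filter.1 ht).2)
    (by intro v hv; by_cases h : v ∈ S.U
        · exact Or.inl h
        · right; simp only [List.mem_filter]; exact ⟨hv, by simpa using h⟩)
    (by intro v hv; rw [mem]; clear * - hv; simp at hv ⊢; tauto) hNC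
    (by intro v hv; apply hcol; rw [mem]; clear * - hv; simp at hv ⊢; tauto)
    l1 l2 l3 [] E1 E2 E3 ∅
    (o1.seg hl (by simp) (by simp) (by simp) (by
      intro y hy; have h1 := g2 y; have h2 := g3 y; clear * - hy h1 h2; simp at hy ⊢; tauto))
    (o2.seg hl2 (by simp) (by simp) (by simp) (by
      intro y hy; have h1 := g1 y; have h2 := g3 y; clear * - hy h1 h2; simp at hy ⊢; tauto))
    (o3.seg hl3 (by simp) (by simp) (by simp) (by
      intro y hy; have h1 := g1 y; have h2 := g2 y; clear * - hy h1 h2; simp at hy ⊢; tauto))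
    (Or.inl ⟨rfl, rfl⟩) b1 b2 b3 a (Or.inl rfl) (by simp) (by omega) (by omega) (by omega) (by simp; omega)
    (by intro x hx; rw [mem] at hx; have h1 := g1' x; have h2 := g2' x; have h3 := g3' x; clear * - hx h1 h2 h3; simp at hx ⊢; tauto)
  refine ⟨S', w, e, u, N, by simpa using ok, okK, ?_⟩
  intro o ho nb hnb h1 h2 x hx
  exact cl o (List.mem_filter.2 ⟨ho, by simpa using h1⟩) nb (List.mem_filter.2 ⟨hnb, by simpa using h2⟩) x hx

set_option maxHeartbeats 8000000 in
theorem do4 {V : Type} {par : V → V} {Z : Set V} {S : St V} (hS : WF par Z S)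
    {a b c : ℕ} {R : Multiset (Finset ℕ)} (hab : a ≠ b) (hbc : b ≠ c) (hac : a ≠ c)
    (hM : S.M = {a, b, c} ::ₘ R) (l : List V) (pl : PL par Z l.length)
    (hNC : ∀ w, w ∉ S.U → NC (Anc par w) l)
    (hcol : ∀ k ∈ l, S.c k = a ∨ S.c k = b ∨ S.c k = c)
    (i j k t : V) (m1 m2 m3 m4 : List V) (hl : l ~r (i :: (m1 ++ j :: (m2 ++ k :: (m3 ++ t :: m4)))))
    (hU : i ∈ S.U ∨ j ∈ S.U ∨ k ∈ S.U ∨ t ∈ S.U)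
    (l1 l2 l3 l4 : List V) (E1 E2 E3 E4 : Set (Sym2 V)) (o1 : OSeg i m1 j l1 E1) (o2 : OSeg j m2 k l2 E2)
    (o3 : OSeg k m3 t l3 E3) (o4 : OSeg t m4 i l4 E4) (α : ℕ) (hα : α = a ∨ α = b ∨ α = c)
    (b1 : ∀ x ∈ l1, S.c x = α) (b2 : Bi S a b l2) (b3 : Bi S b c l3) (b4 : Bi S c a l4) :
    Out par Z S {a, b, c} R l [i, j, k, t] (E1 ∪ E2 ∪ E3 ∪ E4) := by
  classical
  have hl2 : l ~r (j :: (m2 ++ k :: (m3 ++ t :: (m4 ++ i :: m1)))) := by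
    have := hl.trans (isRot_append (i :: m1) (j :: (m2 ++ k :: (m3 ++ t :: m4)))); simpa using this
  have hl3 : l ~r (k :: (m3 ++ t :: (m4 ++ i :: (m1 ++ j :: m2)))) := by
    have := hl2.trans (isRot_append (j :: m2) (k :: (m3 ++ t :: (m4 ++ i :: m1)))); simpa using this
  have hl4 : l ~r (t :: (m4 ++ i :: (m1 ++ j :: (m2 ++ k :: m3)))) := by
    have := hl3.trans (isRot_append (k :: m3) (t :: (m4 ++ i :: (m1 ++ j :: m2)))); simpa using this
  have mem : ∀ x, x ∈ l ↔ x ∈ (i :: (m1 ++ j :: (m2 ++ k :: (m3 ++ t :: m4)))) := fun x => hl.perm.mem_iff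
  have hlen := hl.perm.length_eq
  have g1 := o1.mem; have g2 := o2.mem; have g3 := o3.mem; have g4 := o4.mem
  have g1' := o1.mem'; have g2' := o2.mem'; have g3' := o3.mem'; have g4' := o4.mem'
  have n1 := o1.len; have n2 := o2.len; have n3 := o3.len; have n4 := o4.len
  simp at hlen
  obtain ⟨S', w, e, u, N, ok, okK, cl⟩ := stepL pl hS hab hbc hac hM ([i, j, k, t].filter (fun v => v ∉ S.U)) [i, j, k, t] l
    (by
      have : ([i, j, k, t].filter (fun v => v ∉ S.U)).length < [i, j, k, t].length := by
        rw [List.length_filter_lt_length_iff_exists]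
        simpa using hU
      simpa using Nat.le_of_lt_succ this) (by intro t ht; exact (List.mem_filter.1 ht).1) (by intro t ht; simpa using (List.mem_filter.1 ht).2)
    (by intro v hv; by_cases h : v ∈ S.U
        · exact Or.inl h
        · right; simp only [List.mem_filter]; exact ⟨hv, by simpa using h⟩)
    (by intro v hv; rw [mem]; clear * - hv; simp at hv ⊢; tauto) hNC
    (by intro v hv; apply hcol; rw [mem]; clear * - hv; simp at hv ⊢; tauto)
    l2 l3 l4 l1 E2 E3 E4 E1
    (o2.seg hl2 (by simp) (by simp) (by simp) (by
      intro y hy; have h1 := g1 y; have h2 := g3 y; have h3 := g4 y; clear * - hy h1 h2 h3; simp at hy ⊢; tauto))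
    (o3.seg hl3 (by simp) (by simp) (by simp) (by
      intro y hy; have h1 := g1 y; have h2 := g2 y; have h3 := g4 y; clear * - hy h1 h2 h3; simp at hy ⊢; tauto))
    (o4.seg hl4 (by simp) (by simp) (by simp) (by
      intro y hy; have h1 := g1 y; have h2 := g2 y; have h3 := g3 y; clear * - hy h1 h2 h3; simp at hy ⊢; tauto))
    (o1.seg hl (by simp) (by simp) (by simp) (by
      intro y hy; have h1 := g2 y; have h2 := g3 y; have h3 := g4 y; clear * - hy h1 h2 h3; simp at hy ⊢; tauto))
    b2 b3 b4 α hα b1 (by omega) (by omega) (by omega) (by omega)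
    (by intro x hx; rw [mem] at hx; have h1 := g1' x; have h2 := g2' x; have h3 := g3' x; have h4 := g4' x; clear * - hx h1 h2 h3 h4; simp at hx ⊢; tauto)
  refine ⟨S', w, e, u, N, ?_, okK, ?_⟩
  · intro x y h; apply ok; clear * - h; simp at h ⊢; tauto
  intro o ho nb hnb h1 h2 x hx
  exact cl o (List.mem_filter.2 ⟨ho, by simpa using h1⟩) nb (List.mem_filter.2 ⟨hnb, by simpa using h2⟩) x hx


def KP {V : Type} (K : List V) : Set (Sym2 V) := {z | ∃ x ∈ K, ∃ y ∈ K, z = s(x, y)}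

theorem Okay.symm {V : Type} {par : V → V} {Z : Set V} {S : St V} (hA : ∀ x y, S.A x y → S.A y x) {x y : V} (h : Okay S x y) :
    Okay S y x := ⟨h.2.1, h.1, h.2.2.imp Eq.symm (hA _ _)⟩

theorem Apol.symm {n : ℕ} {M : Multiset (Finset ℕ)} {A : ℕ → ℕ → Prop} (h : Apol n M A) : ∀ x y, A x y → A y x := by
  induction h with
  | init => intro x y h; exact ⟨h.2.1, h.1, h.2.2.symm⟩
  | step n M A a b c h hab hbc hac ih =>
    rintro x y (h | h | h)
    · exact Or.inl (ih _ _ h)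
    · exact Or.inr (Or.inr h)
    · exact Or.inr (Or.inl h)

theorem Done.mono {V : Type} {par : V → V} {Z : Set V} {S : St V} {f : Finset ℕ} {R : Multiset (Finset ℕ)}
    {l : List V} {E E' : Set (Sym2 V)} (h : Done par Z S f R l E) (hE : E' ⊆ E) : Done par Z S f R l E' := by
  obtain ⟨S', h1, h2, h3, h4, h5⟩ := h
  exact ⟨S', h1, h2, h3, h4, fun x y h => h5 x y (hE h)⟩

theorem Done.perm {V : Type} {par : V → V} {Z : Set V} {S : St V} {f : Finset ℕ} {R : Multiset (Finset ℕ)}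
    {l l' : List V} {E : Set (Sym2 V)} (h : Done par Z S f R l E) (hl : l ~r l') : Done par Z S f R l' E := by
  obtain ⟨S', h1, h2, h3, h4, h5⟩ := h
  refine ⟨S', h1, ⟨h2.U, h2.c, h2.A, fun v a b => ?_⟩, fun x hx => h3 x (hl.perm.mem_iff.2 hx), h4, h5⟩
  obtain ⟨t, ht, h⟩ := h2.new v a b
  exact ⟨t, hl.perm.mem_iff.1 ht, h⟩

theorem Out.done {V : Type} {par : V → V} {Z : Set V} {S : St V} {f : Finset ℕ} {R : Multiset (Finset ℕ)}
    {l K : List V} {E : Set (Sym2 V)} (h : Out par Z S f R l K E) : Done par Z S f R l (E ∪ KP K) := by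
  obtain ⟨S', h1, h2, h3, h4, h5, h6, -⟩ := h
  refine ⟨S', h1, h2, h3, h4, fun x y h => ?_⟩
  rcases h with h | ⟨p, hp, q, hq, h⟩
  · exact h5 x y h
  · rcases Sym2.eq_iff.1 h with ⟨rfl, rfl⟩ | ⟨rfl, rfl⟩
    · exact h6 _ hp _ hq
    · exact h6 _ hq _ hp

theorem drop4 {V : Type} {par : V → V} {Z : Set V} {S : St V} (hS : WF par Z S)
    {a b c : ℕ} {R : Multiset (Finset ℕ)} (hab : a ≠ b) (hbc : b ≠ c) (hac : a ≠ c)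
    (hM : S.M = {a, b, c} ::ₘ R) (l : List V) (pl : PL par Z l.length)
    (hNC : ∀ w, w ∉ S.U → NC (Anc par w) l)
    (hcol : ∀ k ∈ l, S.c k = a ∨ S.c k = b ∨ S.c k = c)
    (i j k t : V) (m1 m2 m3 m4 : List V) (hl : l ~r (i :: (m1 ++ j :: (m2 ++ k :: (m3 ++ t :: m4)))))
    (hU : ¬ (i ∈ S.U ∨ j ∈ S.U ∨ k ∈ S.U ∨ t ∈ S.U))
    (l3 l4 : List V) (E1 E2 E3 E4 : Set (Sym2 V)) (r1 : RR (i :: (m1 ++ [j])) E1) (r2 : RR (j :: (m2 ++ [k])) E2)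
    (o3 : OSeg k m3 t l3 E3) (o4 : OSeg t m4 i l4 E4)
    (b1 : Bi S a b (i :: (m1 ++ j :: (m2 ++ [k])))) (b3 : Bi S b c l3) (b4 : Bi S c a l4) :
    Done par Z S {a, b, c} R l (E1 ∪ E2 ∪ E3 ∪ E4 ∪ KP [i, j, k, t]) := by
  have r1' := r1.closing (u := i) (v := j) (by simp) (by simp [List.getLast?_cons])
  have r2' := r2.closing (u := j) (v := k) (by simp) (by simp [List.getLast?_cons])
  have rr : RR (i :: ((m1 ++ j :: m2) ++ [k])) ((E1 ∪ {s(i, j)}) ∪ (E2 ∪ {s(j, k)}) ∪ {s(i, k)}) := by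
    have := RR.tri i j k (i :: m1) (m2 ++ [k]) _ _ _ (by simp) (by simp) r1' r2' subset_rfl
    simpa using this
  have hl' : l ~r (i :: ((m1 ++ j :: m2) ++ k :: (m3 ++ t :: m4))) := by simpa using hl
  obtain ⟨S', h1, h2, h3, h4, h5, h6, h7⟩ := do3 hS hab hbc hac hM l pl hNC hcol i k t _ m3 m4 hl' _ l3 l4 _ E3 E4 (Or.inr ⟨rfl, rr⟩) o3 o4
    (by simpa using b1) b3 b4
  have sy : ∀ x y, Okay S' x y → Okay S' y x := fun x y h => Okay.symm (par := par) (Z := Z) h1.apol.symm h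
  push Not at hU
  have hji : Okay S' j i := sy _ _ (h5 _ _ (by simp))
  have hjk : Okay S' j k := h5 _ _ (by simp)
  have hjt : Okay S' j t := h7 t (by simp) k (by simp) hU.2.2.2 hU.2.2.1 j hjk
  have hjj : Okay S' j j := ⟨hji.1, hji.1, Or.inl rfl⟩
  have key : ∀ p ∈ [i, j, k, t], ∀ q ∈ [i, j, k, t], Okay S' p q := by
    have hK : ∀ x ∈ [i, k, t], Okay S' j x := by
      intro x hx; simp at hx; rcases hx with rfl | rfl | rfl <;> assumption
    have hs : ∀ p ∈ [i, j, k, t], p = j ∨ p ∈ [i, k, t] := by intro p; clear * - p; simp; tauto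
    intro p hp q hq
    rcases hs p hp with rfl | hp'
    · rcases hs q hq with rfl | hq'
      · exact hjj
      · exact hK q hq'
    · rcases hs q hq with rfl | hq'
      · exact sy _ _ (hK p hp')
      · exact h6 p hp' q hq'
  refine ⟨S', h1, h2, h3, h4, fun x y h => ?_⟩
  rcases h with h | ⟨p, hp, q, hq, h⟩
  · apply h5; clear * - h; simp at h ⊢; tauto
  · rcases Sym2.eq_iff.1 h with ⟨rfl, rfl⟩ | ⟨rfl, rfl⟩
    · exact key _ hp _ hq
    · exact key _ hq _ hp

theorem Bi.monoL {V : Type} {S : St V} {a b : ℕ} {σ : List V} (h : ∀ x ∈ σ, S.c x = a) : Bi S a b σ :=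
  ⟨σ, [], by simp, h, by simp⟩
theorem Bi.monoR {V : Type} {S : St V} {a b : ℕ} {σ : List V} (h : ∀ x ∈ σ, S.c x = b) : Bi S a b σ :=
  ⟨[], σ, by simp, by simp, h⟩

theorem Bi.sub {V : Type} {S : St V} {a b : ℕ} {σ τ : List V} (h : Bi S a b σ) (hs : List.Sublist τ σ) : Bi S a b τ := by
  obtain ⟨X, Y, rfl, hX, hY⟩ := h
  obtain ⟨X', Y', rfl, h1, h2⟩ := List.sublist_append_iff.1 hs
  exact ⟨X', Y', rfl, fun x hx => hX x (h1.subset hx), fun x hx => hY x (h2.subset hx)⟩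

theorem Bi.order {V : Type} {S : St V} {a b : ℕ} {σ : List V} (h : Bi S a b σ) (hab : a ≠ b) {x y : V}
    (hs : List.Sublist [x, y] σ) : (S.c x = b → S.c y = b) ∧ (S.c y = a → S.c x = a) := by
  obtain ⟨X, Y, e, hX, hY⟩ := h.sub hs
  rcases X with _ | ⟨p, _ | ⟨q, X⟩⟩
  · simp at e; subst e; simp at hY; simp [hY]
  · simp at e; obtain ⟨rfl, rfl⟩ := e; simp at hX hY; simp [hX, hY]
  · simp at e; obtain ⟨rfl, rfl, h⟩ := e; simp at hX; simp [hX]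

theorem Bi.mem {V : Type} {S : St V} {a b : ℕ} {σ : List V} (h : Bi S a b σ) : ∀ x ∈ σ, S.c x = a ∨ S.c x = b := by
  obtain ⟨X, Y, rfl, hX, hY⟩ := h
  intro x hx
  rcases List.mem_append.1 hx with h | h
  · exact Or.inl (hX x h)
  · exact Or.inr (hY x h)

theorem Bi.init {V : Type} {S : St V} {a b : ℕ} {σ : List V} {x : V} (h : Bi S a b (σ ++ [x])) (hab : a ≠ b)
    (hx : S.c x = a) : ∀ y ∈ σ ++ [x], S.c y = a := by
  intro y hy
  rcases List.mem_append.1 hy with h' | h'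
  · refine (h.order hab (x := y) (y := x) ?_).2 hx
    exact List.Sublist.append (List.singleton_sublist.2 h') (List.Sublist.refl [x])
  · simp at h'; subst h'; exact hx

theorem Bi.tail {V : Type} {S : St V} {a b : ℕ} {σ : List V} {x : V} (h : Bi S a b (x :: σ)) (hab : a ≠ b)
    (hx : S.c x = b) : ∀ y ∈ x :: σ, S.c y = b := by
  intro y hy
  rcases List.mem_cons.1 hy with h' | h'
  · subst h'; exact hx
  · exact (h.order hab (x := x) (y := y) ((List.singleton_sublist.2 h').cons_cons x)).1 hx


theorem proc2 {V : Type} {par : V → V} {Z : Set V} {S : St V} (hS : WF par Z S)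
    {a b c : ℕ} {R : Multiset (Finset ℕ)} (hab : a ≠ b) (hbc : b ≠ c) (hac : a ≠ c)
    (hM : S.M = {a, b, c} ::ₘ R) (l : List V) (E : Set (Sym2 V)) (pl : PL par Z l.length)
    (hNC : ∀ w, w ∉ S.U → NC (Anc par w) l) (hb : Bi S a b l) (h : RR l E) :
    Done par Z S {a, b, c} R l E := by
  classical
  have hcol : ∀ k ∈ l, S.c k = a ∨ S.c k = b ∨ S.c k = c := fun k hk => (hb.mem k hk).imp id Or.inl
  have hcol' : ∀ k ∈ l, S.c k = c ∨ S.c k = a ∨ S.c k = b := fun k hk => Or.inr (hb.mem k hk)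
  have e1 : ({a, b, c} : Finset ℕ) = {c, a, b} := by clear * -; ext; simp; tauto
  have hM' : S.M = {c, a, b} ::ₘ R := e1 ▸ hM
  cases h with
  | leaf u v E hE =>
    obtain ⟨S', w, e, u', N, ok, okK, -⟩ := stepL pl hS hab hbc hac hM ([u, v].filter (fun v => v ∉ S.U)) [u, v] [u, v]
      ((List.length_filter_le _ _).trans (by simp)) (by intro t ht; exact (List.mem_filter.1 ht).1)
      (by intro t ht; simpa using (List.mem_filter.1 ht).2)
      (by intro v hv; by_cases h : v ∈ S.U
          · exact Or.inl h
          · right; simp only [List.mem_filter]; exact ⟨hv, by simpa using h⟩)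
      (by simp) hNC hcol [] [] [] [] ∅ ∅ ∅ ∅ (Or.inl ⟨rfl, rfl⟩) (Or.inl ⟨rfl, rfl⟩) (Or.inl ⟨rfl, rfl⟩) (Or.inl ⟨rfl, rfl⟩)
      (Bi.monoL (by simp)) (Bi.monoL (by simp)) (Bi.monoL (by simp)) a (Or.inl rfl) (by simp) (by simp) (by simp) (by simp) (by simp)
      (by simp)
    refine ⟨S', w, e, u', N, fun x y h => ?_⟩
    have := hE h
    simp only [Set.mem_singleton_iff, Sym2.eq_iff] at this
    rcases this with ⟨rfl, rfl⟩ | ⟨rfl, rfl⟩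
    · exact okK _ (by simp) _ (by simp)
    · exact okK _ (by simp) _ (by simp)
  | tri u x v P Q E1 E2 E hu hv h1 h2 h =>
    obtain ⟨P', rfl⟩ := head_cons hu
    obtain ⟨Q', rfl⟩ := List.getLast?_eq_some_iff.1 hv
    have hl : ((u :: P') ++ x :: (Q' ++ [v])) ~r (u :: (P' ++ x :: (Q' ++ v :: []))) := by simpa using List.IsRotated.refl _
    have bb1 : Bi S a b (u :: (P' ++ [x])) := hb.sub (by
      have : List.Sublist ((u :: P') ++ [x]) ((u :: P') ++ x :: (Q' ++ [v])) := List.Sublist.append (List.Sublist.refl _) (by simp)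
      simpa using this)
    have bb2 : Bi S a b (x :: (Q' ++ [v])) := hb.sub (List.sublist_append_right _ _)
    have hfin : E ⊆ E1 ∪ E2 ∪ ∅ ∪ KP [u, x, v] := by
      intro z hz
      rcases h hz with h | rfl
      · left; left; exact h
      · right; exact ⟨u, by simp, v, by simp, rfl⟩
    rcases hb.mem x (by simp) with hx | hx
    · rw [e1]
      have := do3 hS hac.symm hab hbc.symm hM' _ pl hNC hcol' u x v P' Q' [] hl _ _ [] E1 E2 ∅ (Or.inr ⟨rfl, h1⟩)
        (Or.inr ⟨rfl, h2⟩) (Or.inl ⟨rfl, rfl, rfl⟩) (Bi.monoR (by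
          intro y hy; exact Bi.init (σ := u :: P') (by simpa using bb1) hab hx y (by simpa using hy))) bb2 (Bi.monoL (by simp))
      exact this.done.mono hfin
    · have := do3 hS hab hbc hac hM _ pl hNC hcol u x v P' Q' [] hl _ _ [] E1 E2 ∅ (Or.inr ⟨rfl, h1⟩)
        (Or.inr ⟨rfl, h2⟩) (Or.inl ⟨rfl, rfl, rfl⟩) bb1 (Bi.monoL (Bi.tail bb2 hab hx)) (Bi.monoL (by simp))
      exact this.done.mono hfin
  | quad u x y v P Q T E1 E2 E3 E hu hv h1 h2 h3 h =>
    obtain ⟨P', rfl⟩ := head_cons hu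
    obtain ⟨T', rfl⟩ := List.getLast?_eq_some_iff.1 hv
    have h1' : RR (u :: (P' ++ [x])) E1 := by simpa using h1
    have hl : ((u :: P') ++ x :: (Q ++ y :: (T' ++ [v]))) ~r (u :: (P' ++ x :: (Q ++ y :: (T' ++ v :: [])))) := by simpa using List.IsRotated.refl _
    have hl2 : ((u :: P') ++ x :: (Q ++ y :: (T' ++ [v]))) ~r (x :: (Q ++ y :: (T' ++ v :: ([] ++ u :: P')))) := by
      have := isRot_append (u :: P') (x :: (Q ++ y :: (T' ++ [v]))); simpa using this
    have hl3 : ((u :: P') ++ x :: (Q ++ y :: (T' ++ [v]))) ~r (y :: (T' ++ v :: ([] ++ u :: (P' ++ x :: Q)))) := by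
      have := isRot_append (u :: (P' ++ x :: Q)) (y :: (T' ++ [v])); simpa using this
    have hl4 : ((u :: P') ++ x :: (Q ++ y :: (T' ++ [v]))) ~r (v :: ([] ++ u :: (P' ++ x :: (Q ++ y :: T')))) := by
      have := isRot_append (u :: (P' ++ x :: (Q ++ y :: T'))) [v]; simpa using this
    have bm : Bi S a b (u :: (P' ++ x :: (Q ++ [y]))) := hb.sub (by
      have : List.Sublist ((u :: (P' ++ x :: Q)) ++ [y]) ((u :: (P' ++ x :: Q)) ++ y :: (T' ++ [v])) := List.Sublist.append (List.Sublist.refl _) (by simp)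
      simpa using this)
    have bb1 : Bi S a b (u :: (P' ++ [x])) := bm.sub (by
      have : List.Sublist ((u :: P') ++ [x]) ((u :: P') ++ x :: (Q ++ [y])) := List.Sublist.append (List.Sublist.refl _) (by simp)
      simpa using this)
    have bb2 : Bi S a b (x :: (Q ++ [y])) := bm.sub (by
      have := List.sublist_append_right (u :: P') (x :: (Q ++ [y])); simpa using this)
    have bb3 : Bi S a b (y :: (T' ++ [v])) := hb.sub (by
      have := List.sublist_append_right (u :: (P' ++ x :: Q)) (y :: (T' ++ [v])); simpa using this)
    have hsub : ∀ K : List V, u ∈ K → x ∈ K → y ∈ K → v ∈ K → ∀ E', E1 ∪ E2 ∪ E3 ⊆ E' → E ⊆ E' ∪ KP K := by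
      intro K k1 k2 k3 k4 E' hE z hz
      rcases h hz with h | (rfl | rfl | rfl)
      · left; exact hE h
      · right; exact ⟨u, k1, v, k4, rfl⟩
      · right; exact ⟨u, k1, y, k3, rfl⟩
      · right; exact ⟨x, k2, v, k4, rfl⟩
    have bc1 : S.c x = a → ∀ z ∈ u :: (P' ++ [x]), S.c z = a := fun hx z hz => Bi.init (σ := u :: P') (by simpa using bb1) hab hx z (by simpa using hz)
    have bc2 : S.c y = a → ∀ z ∈ x :: (Q ++ [y]), S.c z = a := fun hx z hz => Bi.init (σ := x :: Q) (by simpa using bb2) hab hx z (by simpa using hz)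
    have bcm : S.c y = a → ∀ z ∈ u :: (P' ++ x :: (Q ++ [y])), S.c z = a := fun hx z hz => Bi.init (σ := u :: (P' ++ x :: Q)) (by simpa using bm) hab hx z (by simpa using hz)
    have bd2 : S.c x = b → ∀ z ∈ x :: (Q ++ [y]), S.c z = b := Bi.tail bb2 hab
    have bd3 : S.c y = b → ∀ z ∈ y :: (T' ++ [v]), S.c z = b := Bi.tail bb3 hab
    by_cases hU : u ∈ S.U ∨ x ∈ S.U ∨ y ∈ S.U ∨ v ∈ S.U
    · rcases hb.mem x (by simp) with hx | hx
      · rcases hb.mem y (by simp) with hy | hy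
        · have := do4 hS hab hbc hac hM _ pl hNC hcol x y v u Q T' [] P' hl2 (by clear * - hU; tauto) _ _ [] _ E2 E3 ∅ E1
            (Or.inr ⟨rfl, h2⟩) (Or.inr ⟨rfl, h3⟩) (Or.inl ⟨rfl, rfl, rfl⟩) (Or.inr ⟨rfl, h1'⟩) a (Or.inl rfl) (bc2 hy) bb3
            (Bi.monoL (by simp)) (Bi.monoR (bc1 hx))
          exact this.done.mono (hsub _ (by simp) (by simp) (by simp) (by simp) _ (by intro z; clear * -; simp <;> tauto))
        · rw [e1]
          have := do4 hS hac.symm hab hbc.symm hM' _ pl hNC hcol' v u x y [] P' Q T' hl4 (by clear * - hU; tauto) [] _ _ _ ∅ E1 E2 E3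
            (Or.inl ⟨rfl, rfl, rfl⟩) (Or.inr ⟨rfl, h1'⟩) (Or.inr ⟨rfl, h2⟩) (Or.inr ⟨rfl, h3⟩) a (by simp) (by simp)
            (Bi.monoR (bc1 hx)) bb2 (Bi.monoL (bd3 hy))
          exact this.done.mono (hsub _ (by simp) (by simp) (by simp) (by simp) _ (by intro z; clear * -; simp <;> tauto))
      · have hy : S.c y = b := bd2 hx y (by simp)
        rw [e1]
        have := do4 hS hac.symm hab hbc.symm hM' _ pl hNC hcol' y v u x T' [] P' Q hl3 (by clear * - hU; tauto) _ [] _ _ E3 ∅ E1 E2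
            (Or.inr ⟨rfl, h3⟩) (Or.inl ⟨rfl, rfl, rfl⟩) (Or.inr ⟨rfl, h1'⟩) (Or.inr ⟨rfl, h2⟩) b (by simp) (bd3 hy)
            (Bi.monoL (by simp)) bb1 (Bi.monoL (bd2 hx))
        exact this.done.mono (hsub _ (by simp) (by simp) (by simp) (by simp) _ (by intro z; clear * -; simp <;> tauto))
    · rcases hb.mem y (by simp) with hy | hy
      · rw [e1]
        have := drop4 hS hac.symm hab hbc.symm hM' _ pl hNC hcol' u x y v P' Q T' [] hl hU _ [] E1 E2 E3 ∅ h1' h2 (Or.inr ⟨rfl, h3⟩)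
          (Or.inl ⟨rfl, rfl, rfl⟩) (Bi.monoR (bcm hy)) bb3 (Bi.monoL (by simp))
        exact this.mono (hsub _ (by simp) (by simp) (by simp) (by simp) _ (by simp))
      · have := drop4 hS hab hbc hac hM _ pl hNC hcol u x y v P' Q T' [] hl hU _ [] E1 E2 E3 ∅ h1' h2 (Or.inr ⟨rfl, h3⟩)
          (Or.inl ⟨rfl, rfl, rfl⟩) bm (Bi.monoL (bd3 hy)) (Bi.monoL (by simp))
        exact this.mono (hsub _ (by simp) (by simp) (by simp) (by simp) _ (by simp))


theorem sbl {V : Type} (A B m : List V) (x y : V) : List.Sublist (x :: (m ++ [y])) (A ++ x :: (m ++ y :: B)) := by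
  have h : List.Sublist ((x :: m) ++ [y]) (A ++ (x :: m) ++ (y :: B)) :=
    List.Sublist.append (List.sublist_append_right _ _) (by simp)
  simpa using h

theorem seg_bd {V : Type} {rk : V → ℕ} {m : List V} {x y : V} (h : (x :: (m ++ [y])).Pairwise (fun x y => rk x ≤ rk y)) :
    ∀ z ∈ x :: (m ++ [y]), rk x ≤ rk z ∧ rk z ≤ rk y := by
  rw [List.pairwise_cons, List.pairwise_append] at h
  intro z hz
  have h1 := h.1 z; have h2 := h.1 y; have h3 := h.2.2.2 z
  simp at hz h1 h2 h3
  rcases hz with rfl | hz | rfl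
  · exact ⟨le_rfl, h2⟩
  · exact ⟨h1 (Or.inl hz), h3 hz⟩
  · exact ⟨h2, le_rfl⟩

theorem pw_mid {V : Type} {r : V → V → Prop} (hr : ∀ x, r x x) {A B : List V} {x : V} (h : (A ++ x :: B).Pairwise r) :
    (∀ y ∈ A, r y x) ∧ (∀ y ∈ x :: B, r x y) := by
  rw [List.pairwise_append, List.pairwise_cons] at h
  refine ⟨fun y hy => h.2.2 y hy x (by simp), fun y hy => ?_⟩
  rcases List.mem_cons.1 hy with rfl | hy
  · exact hr _
  · exact h.2.1.1 y hy

theorem proc3 {V : Type} {par : V → V} {Z : Set V} {S : St V} (hS : WF par Z S)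
    {a b c : ℕ} {R : Multiset (Finset ℕ)} (hab : a ≠ b) (hbc : b ≠ c) (hac : a ≠ c)
    (hM : S.M = {a, b, c} ::ₘ R) (l : List V) (E : Set (Sym2 V)) (pl : PL par Z l.length)
    (hNC : ∀ w, w ∉ S.U → NC (Anc par w) l) (X Y W : List V) (hl : l = X ++ (Y ++ W)) (hX : ∀ x ∈ X, S.c x = a)
    (hY : ∀ x ∈ Y, S.c x = b) (hW : ∀ x ∈ W, S.c x = c) (nX : X ≠ []) (nY : Y ≠ []) (nW : W ≠ []) (h : RR l E) :
    Done par Z S {a, b, c} R l E := by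
  classical
  obtain ⟨rk, hrk⟩ : ∃ rk : V → ℕ, rk = fun x => if S.c x = a then 0 else if S.c x = b then 1 else 2 := ⟨_, rfl⟩
  have hcol : ∀ k ∈ l, S.c k = a ∨ S.c k = b ∨ S.c k = c := by
    intro k hk; rw [hl] at hk; have h1 := hX k; have h2 := hY k; have h3 := hW k
    simp at hk; clear * - hk h1 h2 h3; tauto
  have ra : ∀ x, S.c x = a → rk x = 0 := by intro x hx; simp [hrk, hx]
  have rb : ∀ x, S.c x = b → rk x = 1 := by intro x hx; simp [hrk, hx, hab.symm]
  have rc : ∀ x, S.c x = c → rk x = 2 := by intro x hx; simp [hrk, hx, hbc.symm, hac.symm]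
  have r0 : ∀ x ∈ l, rk x ≤ 0 → S.c x = a := by
    intro x hx h; rcases hcol x hx with h' | h' | h'
    · exact h'
    · rw [rb x h'] at h; omega
    · rw [rc x h'] at h; omega
  have r1 : ∀ x ∈ l, rk x = 1 → S.c x = b := by
    intro x hx h; rcases hcol x hx with h' | h' | h'
    · rw [ra x h'] at h; omega
    · exact h'
    · rw [rc x h'] at h; omega
  have r2 : ∀ x ∈ l, 2 ≤ rk x → S.c x = c := by
    intro x hx h; rcases hcol x hx with h' | h' | h'
    · rw [ra x h'] at h; omega
    · rw [rb x h'] at h; omega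
    · exact h'
  have hs : l.Pairwise (fun x y => rk x ≤ rk y) := by
    rw [hl, List.pairwise_append, List.pairwise_append]
    refine ⟨?_, ⟨?_, ?_, ?_⟩, ?_⟩
    · exact List.Pairwise.imp_of_mem (R := fun _ _ => True) (fun {x y} hx hy _ => by rw [ra x (hX x hx)]; omega) (by simp [List.pairwise_iff_getElem])
    · exact List.Pairwise.imp_of_mem (R := fun _ _ => True) (fun {x y} hx hy _ => by rw [rb x (hY x hx), rb y (hY y hy)]) (by simp [List.pairwise_iff_getElem])
    · exact List.Pairwise.imp_of_mem (R := fun _ _ => True) (fun {x y} hx hy _ => by rw [rc x (hW x hx), rc y (hW y hy)]) (by simp [List.pairwise_iff_getElem])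
    · intro x hx y hy; rw [rb x (hY x hx), rc y (hW y hy)]; omega
    · intro x hx y hy; rw [ra x (hX x hx)]; omega
  have hle : ∀ x ∈ l, rk x ≤ 2 := by intro x hx; simp only [hrk]; split_ifs <;> omega
  have hsl : ∀ {m : List V}, List.Sublist m l → m.Pairwise (fun x y => rk x ≤ rk y) := fun h => hs.sublist h
  have bab : ∀ m : List V, List.Sublist m l → (∀ x ∈ m, rk x ≤ 1) → Bi S a b m := by
    intro m hm hh
    obtain ⟨X, Y, e, hX, hY⟩ := bi_of_sorted rk (r := 0) (r' := 1) (by omega) m (hsl hm) (by intro x hx; have := hh x hx; omega)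
    exact ⟨X, Y, e, fun x hx => r0 x (hm.subset (by simp [e, hx])) (hX x hx).le, fun x hx => r1 x (hm.subset (by simp [e, hx])) (hY x hx)⟩
  have bbc : ∀ m : List V, List.Sublist m l → (∀ x ∈ m, 1 ≤ rk x) → Bi S b c m := by
    intro m hm hh
    obtain ⟨X, Y, e, hX, hY⟩ := bi_of_sorted rk (r := 1) (r' := 2) (by omega) m (hsl hm) (by
      intro x hx; have := hh x hx; have := hle x (hm.subset hx); omega)
    exact ⟨X, Y, e, fun x hx => r1 x (hm.subset (by simp [e, hx])) (hX x hx), fun x hx => r2 x (hm.subset (by simp [e, hx])) (hY x hx).ge⟩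
  have e1 : ({a, b, c} : Finset ℕ) = {c, a, b} := by clear * -; ext; simp; tauto
  have e2 : ({a, b, c} : Finset ℕ) = {b, c, a} := by clear * -; ext; simp; tauto
  have fnd := find3 rk h hs hle
    (by intro u hu; apply ra; apply hX; rw [hl] at hu; cases X with
        | nil => exact absurd rfl nX
        | cons x X => simp at hu; simp [hu])
    (by intro u hu; apply rc; apply hW; rw [hl] at hu
        rw [List.getLast?_append, List.getLast?_append] at hu
        obtain ⟨w, hw⟩ := Option.isSome_iff_exists.1 (List.getLast?_isSome.2 nW)
        simp [hw] at hu; subst hu; exact List.mem_of_getLast? hw)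
    (by obtain ⟨y, hy⟩ := List.exists_mem_of_ne_nil Y nY
        exact ⟨y, by rw [hl]; simp [hy], rb y (hY y hy)⟩)
  have hrr : ∀ x : V, rk x ≤ rk x := fun x => le_rfl
  rcases fnd with ⟨p, i, m1, j, m2, k, s, E1, E2, E3, rfl, hi, hj, hk, R1, R2, R3, hE⟩ |
    ⟨p, i, m1, j, m2, k, m3, t, s, E1, E2, E3, E4, rfl, hi, ht, hjk, R1, R2, R3, R4, hE⟩
  · have sb1 := sbl p (m2 ++ k :: s) m1 i j
    have sb2 : List.Sublist (j :: (m2 ++ [k])) (p ++ i :: (m1 ++ j :: (m2 ++ k :: s))) := by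
      simpa using sbl (p ++ i :: m1) s m2 j k
    have q1 := seg_bd (hsl sb1)
    have q2 := seg_bd (hsl sb2)
    have q3 := (pw_mid hrr hs).1
    have q4 : ∀ y ∈ k :: s, rk k ≤ rk y := by
      have : ((p ++ i :: (m1 ++ j :: m2)) ++ k :: s).Pairwise (fun x y => rk x ≤ rk y) := by simpa using hs
      exact (pw_mid hrr this).2
    have hrot : (p ++ i :: (m1 ++ j :: (m2 ++ k :: s))) ~r (i :: (m1 ++ j :: (m2 ++ k :: (s ++ p)))) := by
      have := isRot_append p (i :: (m1 ++ j :: (m2 ++ k :: s))); simpa using this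
    have R3' : RR (k :: ((s ++ p) ++ [i])) E3 := by
      have : RR ((p ++ [i]) ++ (k :: s)) E3 := by simpa using R3
      simpa using this.rot
    have := do3 hS hab hbc hac hM _ pl hNC hcol i j k m1 m2 (s ++ p) hrot _ _ _ E1 E2 E3 (Or.inr ⟨rfl, R1⟩) (Or.inr ⟨rfl, R2⟩)
      (Or.inr ⟨rfl, R3'⟩) (bab _ sb1 (fun x hx => by have := q1 x hx; omega)) (bbc _ sb2 (fun x hx => by have := q2 x hx; omega))
      ⟨k :: s, p ++ [i], by simp, fun x hx => r2 x (by clear * - hx; simp at hx ⊢; tauto) (by have := q4 x hx; omega),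
        fun x hx => by
          simp at hx
          rcases hx with hx | rfl
          · exact r0 x (by simp [hx]) (by have := q3 x hx; omega)
          · exact r0 x (by simp) hi.le⟩
    refine this.done.mono (fun z hz => ?_)
    rcases hE hz with h | rfl
    · exact Or.inl h
    · exact Or.inr ⟨i, by simp, k, by simp, rfl⟩
  · have sb1 := sbl p (m2 ++ k :: (m3 ++ t :: s)) m1 i j
    have sb2 : List.Sublist (j :: (m2 ++ [k])) (p ++ i :: (m1 ++ j :: (m2 ++ k :: (m3 ++ t :: s)))) := by
      simpa using sbl (p ++ i :: m1) (m3 ++ t :: s) m2 j k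
    have sb3 : List.Sublist (k :: (m3 ++ [t])) (p ++ i :: (m1 ++ j :: (m2 ++ k :: (m3 ++ t :: s)))) := by
      simpa using sbl (p ++ i :: (m1 ++ j :: m2)) s m3 k t
    have sb12 : List.Sublist (i :: (m1 ++ j :: (m2 ++ [k]))) (p ++ i :: (m1 ++ j :: (m2 ++ k :: (m3 ++ t :: s)))) := by
      simpa using sbl p (m3 ++ t :: s) (m1 ++ j :: m2) i k
    have sb23 : List.Sublist (j :: (m2 ++ k :: (m3 ++ [t]))) (p ++ i :: (m1 ++ j :: (m2 ++ k :: (m3 ++ t :: s)))) := by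
      simpa using sbl (p ++ i :: m1) s (m2 ++ k :: m3) j t
    have q1 := seg_bd (hsl sb1)
    have q2 := seg_bd (hsl sb2)
    have q3 := seg_bd (hsl sb3)
    have q12 : ∀ z ∈ i :: (m1 ++ j :: (m2 ++ [k])), rk i ≤ rk z ∧ rk z ≤ rk k := by
      intro z hz; exact seg_bd (m := m1 ++ j :: m2) (by simpa using hsl sb12) z (by simpa using hz)
    have q23 : ∀ z ∈ j :: (m2 ++ k :: (m3 ++ [t])), rk j ≤ rk z ∧ rk z ≤ rk t := by
      intro z hz; exact seg_bd (m := m2 ++ k :: m3) (by simpa using hsl sb23) z (by simpa using hz)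
    have q5 := (pw_mid hrr hs).1
    have q4 : ∀ y ∈ t :: s, rk t ≤ rk y := by
      have : ((p ++ i :: (m1 ++ j :: (m2 ++ k :: m3))) ++ t :: s).Pairwise (fun x y => rk x ≤ rk y) := by simpa using hs
      exact (pw_mid hrr this).2
    have hrot : (p ++ i :: (m1 ++ j :: (m2 ++ k :: (m3 ++ t :: s)))) ~r (i :: (m1 ++ j :: (m2 ++ k :: (m3 ++ t :: (s ++ p))))) := by
      have := isRot_append p (i :: (m1 ++ j :: (m2 ++ k :: (m3 ++ t :: s)))); simpa using this
    have hrot2 : (p ++ i :: (m1 ++ j :: (m2 ++ k :: (m3 ++ t :: s)))) ~r (j :: (m2 ++ k :: (m3 ++ t :: ((s ++ p) ++ i :: m1)))) := by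
      have := isRot_append (p ++ i :: m1) (j :: (m2 ++ k :: (m3 ++ t :: s))); simpa using this
    have hrot3 : (p ++ i :: (m1 ++ j :: (m2 ++ k :: (m3 ++ t :: s)))) ~r (k :: (m3 ++ t :: ((s ++ p) ++ i :: (m1 ++ j :: m2)))) := by
      have := isRot_append (p ++ i :: (m1 ++ j :: m2)) (k :: (m3 ++ t :: s)); simpa using this
    have R4' : RR (t :: ((s ++ p) ++ [i])) E4 := by
      have : RR ((p ++ [i]) ++ (t :: s)) E4 := by simpa using R4
      simpa using this.rot
    have B4 : Bi S c a (t :: ((s ++ p) ++ [i])) :=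
      ⟨t :: s, p ++ [i], by simp, fun x hx => r2 x (by clear * - hx; simp at hx ⊢; tauto) (by have := q4 x hx; omega),
        fun x hx => by
          simp at hx
          rcases hx with hx | rfl
          · exact r0 x (by simp [hx]) (by have := q5 x hx; omega)
          · exact r0 x (by simp) hi.le⟩
    have hsub : ∀ K : List V, i ∈ K → j ∈ K → k ∈ K → t ∈ K → ∀ E', E1 ∪ E2 ∪ E3 ∪ E4 ⊆ E' → E ⊆ E' ∪ KP K := by
      intro K k1 k2 k3 k4 E' hE' z hz
      rcases hE hz with h | (rfl | rfl | rfl)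
      · left; exact hE' h
      · right; exact ⟨i, k1, t, k4, rfl⟩
      · right; exact ⟨i, k1, k, k3, rfl⟩
      · right; exact ⟨j, k2, t, k4, rfl⟩
    have M1 : S.M = {c, a, b} ::ₘ R := e1 ▸ hM
    have M2 : S.M = {b, c, a} ::ₘ R := e2 ▸ hM
    have hcol1 : ∀ x ∈ (p ++ i :: (m1 ++ j :: (m2 ++ k :: (m3 ++ t :: s)))), S.c x = c ∨ S.c x = a ∨ S.c x = b := by
      intro x hx; have := hcol x hx; clear * - this; tauto
    have hcol2 : ∀ x ∈ (p ++ i :: (m1 ++ j :: (m2 ++ k :: (m3 ++ t :: s)))), S.c x = b ∨ S.c x = c ∨ S.c x = a := by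
      intro x hx; have := hcol x hx; clear * - this; tauto
    by_cases hU : i ∈ S.U ∨ j ∈ S.U ∨ k ∈ S.U ∨ t ∈ S.U
    · rcases hjk with hjk | hjk | hjk
      · have := do4 hS hab hbc hac hM _ pl hNC hcol i j k t m1 m2 m3 (s ++ p) hrot hU _ _ _ _ E1 E2 E3 E4
          (Or.inr ⟨rfl, R1⟩) (Or.inr ⟨rfl, R2⟩) (Or.inr ⟨rfl, R3⟩) (Or.inr ⟨rfl, R4'⟩) a (by simp)
          (fun x hx => r0 x (sb1.subset hx) (by have := q1 x hx; omega)) (bab _ sb2 (fun x hx => by have := q2 x hx; omega))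
          (bbc _ sb3 (fun x hx => by have := q3 x hx; omega)) B4
        exact this.done.mono (hsub _ (by simp) (by simp) (by simp) (by simp) _ (by intro z; clear * -; simp <;> tauto))
      · rw [e2]
        have := do4 hS hbc hac.symm hab.symm M2 _ pl hNC hcol2 j k t i m2 m3 (s ++ p) m1 hrot2 (by clear * - hU; tauto) _ _ _ _ E2 E3 E4 E1
          (Or.inr ⟨rfl, R2⟩) (Or.inr ⟨rfl, R3⟩) (Or.inr ⟨rfl, R4'⟩) (Or.inr ⟨rfl, R1⟩) b (by simp)
          (fun x hx => r1 x (sb2.subset hx) (by have := q2 x hx; omega)) (bbc _ sb3 (fun x hx => by have := q3 x hx; omega))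
          B4 (bab _ sb1 (fun x hx => by have := q1 x hx; omega))
        exact this.done.mono (hsub _ (by simp) (by simp) (by simp) (by simp) _ (by intro z; clear * -; simp <;> tauto))
      · rw [e1]
        have := do4 hS hac.symm hab hbc.symm M1 _ pl hNC hcol1 k t i j m3 (s ++ p) m1 m2 hrot3 (by clear * - hU; tauto) _ _ _ _ E3 E4 E1 E2
          (Or.inr ⟨rfl, R3⟩) (Or.inr ⟨rfl, R4'⟩) (Or.inr ⟨rfl, R1⟩) (Or.inr ⟨rfl, R2⟩) c (by simp)
          (fun x hx => r2 x (sb3.subset hx) (by have := q3 x hx; omega)) 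
          B4 (bab _ sb1 (fun x hx => by have := q1 x hx; omega)) (bbc _ sb2 (fun x hx => by have := q2 x hx; omega))
        exact this.done.mono (hsub _ (by simp) (by simp) (by simp) (by simp) _ (by intro z; clear * -; simp <;> tauto))
    · by_cases hk : rk k = 1
      · have := drop4 hS hab hbc hac hM _ pl hNC hcol i j k t m1 m2 m3 (s ++ p) hrot hU _ _ E1 E2 E3 E4 R1 R2 (Or.inr ⟨rfl, R3⟩)
          (Or.inr ⟨rfl, R4'⟩) (bab _ sb12 (fun x hx => by have := q12 x hx; omega)) (bbc _ sb3 (fun x hx => by have := q3 x hx; omega)) B4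
        exact this.mono (hsub _ (by simp) (by simp) (by simp) (by simp) _ (by intro z; clear * -; simp <;> tauto))
      · have hj : rk j = 1 := by clear * - hjk hk; omega
        rw [e2]
        have := drop4 hS hbc hac.symm hab.symm M2 _ pl hNC hcol2 j k t i m2 m3 (s ++ p) m1 hrot2 (by clear * - hU; tauto) _ _ E2 E3 E4 E1 R2 R3
          (Or.inr ⟨rfl, R4'⟩) (Or.inr ⟨rfl, R1⟩) (bbc _ sb23 (fun x hx => by have := q23 x hx; omega)) B4
          (bab _ sb1 (fun x hx => by have := q1 x hx; omega))
        exact this.mono (hsub _ (by simp) (by simp) (by simp) (by simp) _ (by intro z; clear * -; simp <;> tauto))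

theorem PL_succ {V : Type} {par : V → V} {Z : Set V} {N : ℕ} (pl : PL par Z N) : PL par Z (N + 1) := by
  intro S f R l E hlen hS hM hJ
  rcases Nat.lt_succ_iff_lt_or_eq.1 hlen with h | h
  · exact pl S f R l E h hS hM hJ
  rw [← h] at pl
  have hface := hS.apol.face f (by rw [hM]; simp)
  rcases hJ with ⟨rfl, rfl⟩ | ⟨hR, hNC, P, X, Y, W, a, b, c, rfl, rfl, hP, hX, hY, hW⟩
  · refine ⟨S, hS, ⟨fun _ h => h, fun _ _ => rfl, fun _ _ h => h, fun v h h' => absurd h h'⟩, by simp, ⟨{f}, by simpa using hM, ?_⟩, by simp⟩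
    intro x hx y hy; exact ⟨f, by simp, hx, hy⟩
  · have hc : ({a, b, c} : Finset ℕ).card = 3 := hface.1
    have hab : a ≠ b := by
      rintro rfl; rw [Finset.insert_eq_of_mem (by simp)] at hc; have := Finset.card_le_two (a := a) (b := c); omega
    have hac : a ≠ c := by
      rintro rfl; rw [Finset.insert_eq_of_mem (by simp)] at hc; have := Finset.card_le_two (a := b) (b := a); omega
    have hbc : b ≠ c := by
      rintro rfl; rw [Finset.insert_eq_of_mem (a := b) (s := {b}) (by simp)] at hc; have := Finset.card_le_two (a := a) (b := b); omega
    have hrot : (P ++ (X ++ (Y ++ W))) ~r (X ++ (Y ++ (W ++ P))) := by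
      have := isRot_append P (X ++ (Y ++ W)); simpa using this
    have hlen := hrot.perm.length_eq
    rw [hlen] at pl
    have hNC' : ∀ w, w ∉ S.U → NC (Anc par w) (X ++ (Y ++ (W ++ P))) := fun w hw => (hNC w hw).rot hrot
    have hR' := hR.isRot hrot
    have hWP : ∀ x ∈ W ++ P, S.c x = c := by
      intro x hx; rcases List.mem_append.1 hx with h | h
      · exact hW x h
      · exact hP x h
    refine Done.perm ?_ hrot.symm
    generalize W ++ P = Q at *
    by_cases nX : X = []
    · subst nX
      have e2 : ({a, b, c} : Finset ℕ) = {b, c, a} := by clear * -; ext; simp; tauto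
      rw [e2] at hM ⊢
      exact proc2 hS hbc hac.symm hab.symm hM _ E pl hNC' ⟨Y, Q, by simp, hY, hWP⟩ hR'
    by_cases nY : Y = []
    · subst nY
      have e2 : ({a, b, c} : Finset ℕ) = {a, c, b} := by clear * -; ext; simp; tauto
      rw [e2] at hM ⊢
      exact proc2 hS hac hbc.symm hab hM _ E pl hNC' ⟨X, Q, by simp, hX, hWP⟩ hR'
    by_cases nQ : Q = []
    · subst nQ
      exact proc2 hS hab hbc hac hM _ E pl hNC' ⟨X, Y, by simp, hX, hY⟩ hR'
    exact proc3 hS hab hbc hac hM _ E pl hNC' X Y Q rfl hX hY hWP nX nY nQ hR'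

theorem PL_all {V : Type} {par : V → V} {Z : Set V} (N : ℕ) : PL par Z N := by
  induction N with
  | zero => intro S f R l E h; omega
  | succ N ih => exact PL_succ ih

theorem coreIII {V : Type} (par : V → V) (Z : Set V) (hZ : ∀ v ∈ Z, par v ∈ Z) (hreach : ∀ v, ∃ k, par^[k] v ∈ Z)
    (l : List V) (E : Set (Sym2 V)) (hR : RR l E) (hNC : ∀ w, w ∉ Z → NC (Anc par w) l) :
    ∃ S : St V, WF par Z S ∧ (∀ v ∈ Z, v ∈ S.U) ∧ (∀ x ∈ l, x ∈ S.U) ∧ ∀ x y, s(x, y) ∈ E → Okay S x y := by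
  have hS : WF par Z ⟨Z, fun _ => 0, 3, {0, 1, 2} ::ₘ {0, 1, 2} ::ₘ 0, fun x y => x < 3 ∧ y < 3 ∧ x ≠ y⟩ := by
    refine ⟨Apol.init, hZ, hreach, fun _ _ => rfl, fun _ => by simp, ?_, fun v hv _ => hv, by simp⟩
    intro h hh
    exact ⟨[], by simp, fun v _ h' => absurd h'.symm hh⟩
  obtain ⟨S', h1, h2, h3, -, h5⟩ := PL_all (l.length + 1) _ {0, 1, 2} ({0, 1, 2} ::ₘ 0) l E (by omega) hS rfl
    (Or.inr ⟨hR, hNC, [], l, [], [], 0, 1, 2, by simp, rfl, by simp, by simp, by simp, by simp⟩)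
  exact ⟨S', h1, h2.U, h3, h5⟩


def leafG {ι : Type} (T : SimpleGraph ι) (i0 : ι) : SimpleGraph (Option ι) where
  Adj x y := (∃ i j, x = some i ∧ y = some j ∧ T.Adj i j) ∨ (x = none ∧ y = some i0) ∨ (y = none ∧ x = some i0)
  symm := by
    constructor
    rintro x y (⟨i, j, h1, h2, h⟩ | h | h)
    · exact Or.inl ⟨j, i, h2, h1, h.symm⟩
    · exact Or.inr (Or.inr h)
    · exact Or.inr (Or.inl h)
  loopless := by
    constructor
    rintro x (⟨i, j, h1, h2, h⟩ | h | h)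
    · rw [h1] at h2; cases h2; exact T.loopless.irrefl _ h
    · rw [h.1] at h; cases h.2
    · rw [h.1] at h; cases h.2

theorem leafG_conn {ι : Type} (T : SimpleGraph ι) (i0 : ι) (s : Set ι) (hs : (T.induce s).Connected) (t : Set (Option ι))
    (h : ∀ i, some i ∈ t ↔ i ∈ s) (hn : none ∈ t → i0 ∈ s) : ((leafG T i0).induce t).Connected := by
  obtain ⟨b⟩ := hs.nonempty
  rw [SimpleGraph.connected_iff_exists_forall_reachable]
  refine ⟨⟨some b.1, (h _).2 b.2⟩, ?_⟩
  let φ : T.induce s →g (leafG T i0).induce t := ⟨fun i => ⟨some i.1, (h _).2 i.2⟩, fun {x y} hxy => by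
    refine Or.inl ⟨x.1, y.1, rfl, rfl, hxy⟩⟩
  have key : ∀ i (hi : i ∈ s), ((leafG T i0).induce t).Reachable ⟨some b.1, (h _).2 b.2⟩ ⟨some i, (h _).2 hi⟩ := by
    intro i hi
    exact (hs.preconnected b ⟨i, hi⟩).map φ
  rintro ⟨_ | i, hi⟩
  · refine (key i0 (hn hi)).trans (SimpleGraph.Adj.reachable ?_)
    exact Or.inr (Or.inr ⟨rfl, rfl⟩)
  · exact key i ((h i).1 hi)

theorem leafG_tree {ι : Type} [Finite ι] (T : SimpleGraph ι) (i0 : ι) (h : T.IsTree) : (leafG T i0).IsTree := by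
  rw [SimpleGraph.isTree_iff_connected_and_card] at h ⊢
  constructor
  · have h1 : (T.induce Set.univ).Connected := (SimpleGraph.induceUnivIso T).connected_iff.2 h.1
    have := leafG_conn T i0 Set.univ h1 Set.univ (by simp) (by simp)
    exact (SimpleGraph.induceUnivIso _).connected_iff.1 this
  · have : (leafG T i0).edgeSet = insert s(none, some i0) (Sym2.map some '' T.edgeSet) := by
      ext e
      induction e with | _ x y
      simp only [SimpleGraph.mem_edgeSet, Set.mem_insert_iff, Set.mem_image, Sym2.eq_iff]
      constructor
      · rintro (⟨i, j, rfl, rfl, h⟩ | h | h)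
        · exact Or.inr ⟨s(i, j), h, rfl⟩
        · exact Or.inl (Or.inl h)
        · exact Or.inl (Or.inr h.symm)
      · rintro ((h | h) | ⟨e, he, h⟩)
        · exact Or.inr (Or.inl h)
        · exact Or.inr (Or.inr h.symm)
        · induction e with | _ i j
          simp only [Sym2.map_mk, Sym2.eq_iff] at h
          rcases h with ⟨rfl, rfl⟩ | ⟨rfl, rfl⟩
          · exact Or.inl ⟨i, j, rfl, rfl, he⟩
          · exact Or.inl ⟨j, i, rfl, rfl, he.symm⟩
    rw [this, Nat.card_coe_set_eq, Set.ncard_insert_of_notMem _ (Set.toFinite _), Set.ncard_image_of_injective _ (Sym2.map.injective (Option.some_injective _)),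
      ← Nat.card_coe_set_eq, h.2, Finite.card_option]
    rintro ⟨e, -, he⟩
    induction e with | _ i j
    simp [Sym2.eq_iff] at he

theorem Apol.lt {n : ℕ} {M : Multiset (Finset ℕ)} {A : ℕ → ℕ → Prop} (h : Apol n M A) : ∀ x y, A x y → x < n ∧ y < n ∧ x ≠ y := by
  induction h with
  | init => intro x y h; exact h
  | step n M A a b c h hab hbc hac ih =>
    have hf := (h.face {a, b, c} (by simp)).2.1
    have ha := hf a (by simp); have hb := hf b (by simp); have hc := hf c (by simp)
    rintro x y (h | ⟨rfl, rfl | rfl | rfl⟩ | ⟨rfl, rfl | rfl | rfl⟩)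
    · have := ih _ _ h; omega
    all_goals omega

theorem Apol.tw {n : ℕ} {M : Multiset (Finset ℕ)} {A : ℕ → ℕ → Prop} (h : Apol n M A) :
    ∃ (ι : Type) (_ : Finite ι) (T : SimpleGraph ι) (B : ι → Set ℕ), T.IsTree ∧ (∀ v < n, ∃ i, v ∈ B i) ∧
      (∀ u v, A u v → ∃ i, u ∈ B i ∧ v ∈ B i) ∧ (∀ v < n, (T.induce {i | v ∈ B i}).Connected) ∧
      (∀ i, (B i).encard ≤ 4) ∧ (∀ i, ∀ v ∈ B i, v < n) ∧ ∀ f ∈ M, ∃ i, ∀ x ∈ f, x ∈ B i := by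
  induction h with
  | init =>
    refine ⟨Unit, inferInstance, ⊤, fun _ => {0, 1, 2}, ?_, ?_, ?_, ?_, ?_, ?_, ?_⟩
    · exact SimpleGraph.IsTree.of_subsingleton
    · intro v hv; refine ⟨(), ?_⟩; simp; omega
    · rintro u v ⟨h1, h2, -⟩; refine ⟨(), ?_, ?_⟩ <;> simp <;> omega
    · intro v hv
      have : Nonempty ({i : Unit | v ∈ ({0, 1, 2} : Set ℕ)} : Set Unit) := ⟨⟨(), by simp; omega⟩⟩
      exact (SimpleGraph.IsTree.of_subsingleton).1
    · intro i
      refine (Set.encard_insert_le _ _).trans ?_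
      refine (add_le_add_left (Set.encard_insert_le _ _) 1).trans ?_
      rw [Set.encard_singleton]; norm_num
    · intro i v hv; simp at hv; omega
    · intro f hf; refine ⟨(), fun x hx => ?_⟩
      simp at hf; subst hf; simpa using hx
  | step n M A a b c h hab hbc hac ih =>
    obtain ⟨ι, _, T, B, hT, h1, h2, h3, h4, h5, h6⟩ := ih
    obtain ⟨i0, hi0⟩ := h6 {a, b, c} (by simp)
    have ha := hi0 a (by simp); have hb := hi0 b (by simp); have hc := hi0 c (by simp)
    refine ⟨Option ι, inferInstance, leafG T i0, fun o => o.elim {n, a, b, c} B, leafG_tree T i0 hT, ?_, ?_, ?_, ?_, ?_, ?_⟩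
    · intro v hv
      rcases Nat.lt_succ_iff_lt_or_eq.1 hv with hv | rfl
      · obtain ⟨i, hi⟩ := h1 v hv; exact ⟨some i, hi⟩
      · exact ⟨none, by simp⟩
    · rintro x y (h | ⟨rfl, h⟩ | ⟨rfl, h⟩)
      · obtain ⟨i, hi⟩ := h2 x y h; exact ⟨some i, hi⟩
      · exact ⟨none, by simp, by simp; tauto⟩
      · exact ⟨none, by simp; tauto, by simp⟩
    · intro v hv
      rcases Nat.lt_succ_iff_lt_or_eq.1 hv with hv | rfl
      · refine leafG_conn T i0 {i | v ∈ B i} (h3 v hv) _ (fun i => Iff.rfl) ?_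
        intro h
        have : v = n ∨ v = a ∨ v = b ∨ v = c := by simpa using h
        rcases this with rfl | rfl | rfl | rfl
        · omega
        all_goals assumption
      · have hs : {i : Option ι | v ∈ (i.elim {v, a, b, c} B : Set ℕ)} = {none} := by
          ext i
          rcases i with _ | i
          · simp
          · simp; intro h; exact absurd (h5 i v h) (by omega)
        rw [hs]
        exact (SimpleGraph.IsTree.of_subsingleton).1
    · rintro (_ | i)
      · show Set.encard {n, a, b, c} ≤ 4
        have h1 := Set.encard_insert_le {a, b, c} n
        have h2 := Set.encard_insert_le {b, c} a
        have h3 := Set.encard_insert_le {c} b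
        rw [Set.encard_singleton] at h3
        calc _ ≤ _ := h1
          _ ≤ 1 + 1 + 1 + 1 := by gcongr; exact h2.trans (by gcongr)
          _ = 4 := by norm_num
      · exact h4 i
    · rintro (_ | i) v hv
      · have : v = n ∨ v = a ∨ v = b ∨ v = c := by simpa using hv
        rcases this with rfl | rfl | rfl | rfl
        · omega
        · have := h5 _ _ ha; omega
        · have := h5 _ _ hb; omega
        · have := h5 _ _ hc; omega
      · have := h5 i v hv; omega
    · intro f hf
      simp only [Multiset.mem_cons] at hf
      rcases hf with rfl | rfl | rfl | hf
      · exact ⟨none, fun x hx => by simp at hx ⊢; tauto⟩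
      · exact ⟨none, fun x hx => by simp at hx ⊢; tauto⟩
      · exact ⟨none, fun x hx => by simp at hx ⊢; tauto⟩
      · obtain ⟨i, hi⟩ := h6 f (by simp [hf]); exact ⟨some i, hi⟩

def HG (n : ℕ) (A : ℕ → ℕ → Prop) (hA : ∀ x y, A x y → A y x) (hA' : ∀ x y, A x y → x ≠ y) : SimpleGraph (Fin n) where
  Adj x y := A x y
  symm := ⟨fun x y h => hA _ _ h⟩
  loopless := ⟨fun x h => hA' _ _ h rfl⟩

theorem Apol.treewidth {n : ℕ} {M : Multiset (Finset ℕ)} {A : ℕ → ℕ → Prop} (h : Apol n M A) (hA hA') :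
    TreewidthLE (HG n A hA hA') 3 := by
  obtain ⟨ι, _, T, B, hT, h1, h2, h3, h4, h5, h6⟩ := h.tw
  refine ⟨ι, T, fun i => {v | v.1 ∈ B i}, hT, fun v => h1 v v.2, fun u v h => h2 u v h, fun v => h3 v v.2, fun i => ?_⟩
  have : (Fin.val '' {v : Fin n | v.1 ∈ B i}).encard ≤ 4 := le_trans (Set.encard_le_encard (by rintro _ ⟨v, hv, rfl⟩; exact hv)) (h4 i)
  rw [Fin.val_injective.encard_image] at this
  refine this.trans (by norm_num)


def Lk {D E : Type} (nx : D → D) (src : D → ℕ) (fe : D → E) (c c' : D) : Prop :=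
  src c = src c' ∧ ∃ p p', p ≠ p' ∧ fe p = fe p' ∧ (c = p ∨ c = nx p) ∧ (c' = p' ∨ c' = nx p')

structure DE {D E : Type} (nx : D → D) (src : D → ℕ) (fe : D → E) (ends : E → Sym2 ℕ) (n : ℕ) : Prop where
  src_lt : ∀ d, src d < n
  nx3 : ∀ d, nx (nx (nx d)) = d
  nxne : ∀ d, nx d ≠ d
  twice : ∀ e, ∃ p p', p ≠ p' ∧ ∀ d, fe d = e ↔ d = p ∨ d = p'
  hends : ∀ d, ends (fe d) = s(src d, src (nx d))
  conn : ∀ v < n, Relation.EqvGen (fun x y => ∃ e, ends e = s(x, y)) 0 v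
  link : ∀ c c', src c = src c' → Relation.EqvGen (Lk nx src fe) c c'
  
def fac {D : Type} (nx : D → D) (src : D → ℕ) (d : D) : Finset ℕ := {src d, src (nx d), src (nx (nx d))}

open Classical in
noncomputable def nx6 {D : Type} (nx : D → D) (d0 : D) : D ⊕ Fin 6 → D ⊕ Fin 6
  | .inl d => if d = d0 then .inr 0 else if d = nx d0 then .inr 2 else if d = nx (nx d0) then .inr 4 else .inl (nx d)
  | .inr 0 => .inr 1
  | .inr 1 => .inl d0
  | .inr 2 => .inr 3
  | .inr 3 => .inl (nx d0)
  | .inr 4 => .inr 5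
  | .inr 5 => .inl (nx (nx d0))

def src6 {D : Type} (nx : D → D) (src : D → ℕ) (n : ℕ) (d0 : D) : D ⊕ Fin 6 → ℕ
  | .inl d => src d
  | .inr 0 => src (nx d0)
  | .inr 1 => n
  | .inr 2 => src (nx (nx d0))
  | .inr 3 => n
  | .inr 4 => src d0
  | .inr 5 => n

def fe6 {D E : Type} (fe : D → E) : D ⊕ Fin 6 → E ⊕ Fin 3
  | .inl d => .inl (fe d)
  | .inr 0 => .inr 1
  | .inr 1 => .inr 0
  | .inr 2 => .inr 2
  | .inr 3 => .inr 1
  | .inr 4 => .inr 0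
  | .inr 5 => .inr 2

def ends3 {D E : Type} (nx : D → D) (src : D → ℕ) (n : ℕ) (d0 : D) (ends : E → Sym2 ℕ) : E ⊕ Fin 3 → Sym2 ℕ
  | .inl e => ends e
  | .inr 0 => s(n, src d0)
  | .inr 1 => s(n, src (nx d0))
  | .inr 2 => s(n, src (nx (nx d0)))

theorem Relation.EqvGen.mono' {α : Type} {r r' : α → α → Prop} (h : ∀ x y, r x y → Relation.EqvGen r' x y) {x y : α}
    (hx : Relation.EqvGen r x y) : Relation.EqvGen r' x y := by
  induction hx with
  | rel x y h' => exact h _ _ h'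
  | refl x => exact .refl _
  | symm x y _ ih => exact .symm _ _ ih
  | trans x y z _ _ h1 h2 => exact .trans _ _ _ h1 h2

theorem Relation.EqvGen.map' {α β : Type} {r : α → α → Prop} {r' : β → β → Prop} (f : α → β) (h : ∀ x y, r x y → Relation.EqvGen r' (f x) (f y)) {x y : α}
    (hx : Relation.EqvGen r x y) : Relation.EqvGen r' (f x) (f y) := by
  induction hx with
  | rel x y h' => exact h _ _ h'
  | refl x => exact .refl _
  | symm x y _ ih => exact .symm _ _ ih
  | trans x y z _ _ h1 h2 => exact .trans _ _ _ h1 h2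

theorem DE.step {D E : Type} {nx : D → D} {src : D → ℕ} {fe : D → E} {ends : E → Sym2 ℕ} {n : ℕ} (h : DE nx src fe ends n) (d0 : D) :
    DE (nx6 nx d0) (src6 nx src n d0) (fe6 fe) (ends3 nx src n d0 ends) (n + 1) := by
  have n0 := h.nxne d0
  have n1 := h.nxne (nx d0)
  have n2 := h.nxne (nx (nx d0))
  rw [h.nx3] at n2
  have inj : ∀ x y, nx x = nx y → x = y := fun x y e => by rw [← h.nx3 x, e, h.nx3]
  have N0 : nx6 nx d0 (.inl d0) = .inr 0 := by simp [nx6]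
  have N1 : nx6 nx d0 (.inl (nx d0)) = .inr 2 := by simp [nx6, n0]
  have N2 : nx6 nx d0 (.inl (nx (nx d0))) = .inr 4 := by simp [nx6, n1, n2.symm]
  have N3 : ∀ d, d ≠ d0 → d ≠ nx d0 → d ≠ nx (nx d0) → nx6 nx d0 (.inl d) = .inl (nx d) := by
    intro d h1 h2 h3; simp [nx6, h1, h2, h3]
  have cs : ∀ d, d = d0 ∨ d = nx d0 ∨ d = nx (nx d0) ∨ (d ≠ d0 ∧ d ≠ nx d0 ∧ d ≠ nx (nx d0)) := by intro d; tauto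
  have l1 : Relation.EqvGen (Lk (nx6 nx d0) (src6 nx src n d0) (fe6 fe)) (.inl (nx d0)) (.inr 0) :=
    .rel _ _ ⟨rfl, .inr 3, .inr 0, by simp, rfl, Or.inr rfl, Or.inl rfl⟩
  have l2 : Relation.EqvGen (Lk (nx6 nx d0) (src6 nx src n d0) (fe6 fe)) (.inl (nx (nx d0))) (.inr 2) :=
    .rel _ _ ⟨rfl, .inr 5, .inr 2, by simp, rfl, Or.inr rfl, Or.inl rfl⟩
  have l0 : Relation.EqvGen (Lk (nx6 nx d0) (src6 nx src n d0) (fe6 fe)) (.inl d0) (.inr 4) :=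
    .rel _ _ ⟨rfl, .inr 1, .inr 4, by simp, rfl, Or.inr rfl, Or.inl rfl⟩
  have k1 : Relation.EqvGen (Lk (nx6 nx d0) (src6 nx src n d0) (fe6 fe)) (.inr 1) (.inr 3) :=
    .rel _ _ ⟨rfl, .inr 0, .inr 3, by simp, rfl, Or.inr rfl, Or.inl rfl⟩
  have k2 : Relation.EqvGen (Lk (nx6 nx d0) (src6 nx src n d0) (fe6 fe)) (.inr 3) (.inr 5) :=
    .rel _ _ ⟨rfl, .inr 2, .inr 5, by simp, rfl, Or.inr rfl, Or.inl rfl⟩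
  have snx : ∀ p, src6 nx src n d0 (nx6 nx d0 (.inl p)) = src (nx p) ∧
      Relation.EqvGen (Lk (nx6 nx d0) (src6 nx src n d0) (fe6 fe)) (.inl (nx p)) (nx6 nx d0 (.inl p)) := by
    intro p
    rcases cs p with rfl | rfl | rfl | ⟨h1, h2, h3⟩
    · rw [N0]; exact ⟨rfl, l1⟩
    · rw [N1]; exact ⟨rfl, l2⟩
    · rw [N2, h.nx3]; exact ⟨rfl, l0⟩
    · rw [N3 p h1 h2 h3]; exact ⟨rfl, .refl _⟩
  constructor
  · rintro (d | d)
    · have := h.src_lt d; simp only [src6]; omega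
    · have a0 := h.src_lt d0; have a1 := h.src_lt (nx d0); have a2 := h.src_lt (nx (nx d0))
      fin_cases d <;> simp only [src6] <;> omega
  · rintro (d | d)
    · rcases cs d with rfl | rfl | rfl | ⟨h1, h2, h3⟩
      · rw [N0]; rfl
      · rw [N1]; rfl
      · rw [N2]; rfl
      · have g1 : nx d ≠ d0 := fun e => h3 (by rw [← e, h.nx3])
        have g2 : nx d ≠ nx d0 := fun e => h1 (inj _ _ e)
        have g3 : nx d ≠ nx (nx d0) := fun e => h2 (inj _ _ e)
        rw [N3 d h1 h2 h3, N3 _ g1 g2 g3, N3, h.nx3]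
        · intro e; apply h2; rw [← h.nx3 d, e]
        · exact fun e => g1 (inj _ _ e)
        · exact fun e => g2 (inj _ _ e)
    · have M0 : nx6 nx d0 (.inr 0) = .inr 1 := rfl
      have M1 : nx6 nx d0 (.inr 1) = .inl d0 := rfl
      have M2 : nx6 nx d0 (.inr 2) = .inr 3 := rfl
      have M3 : nx6 nx d0 (.inr 3) = .inl (nx d0) := rfl
      have M4 : nx6 nx d0 (.inr 4) = .inr 5 := rfl
      have M5 : nx6 nx d0 (.inr 5) = .inl (nx (nx d0)) := rfl
      fin_cases d <;> simp [M0, M1, M2, M3, M4, M5, N0, N1, N2]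
  · rintro (d | d)
    · rcases cs d with rfl | rfl | rfl | ⟨h1, h2, h3⟩
      · rw [N0]; simp
      · rw [N1]; simp
      · rw [N2]; simp
      · rw [N3 d h1 h2 h3]; simpa using h.nxne d
    · fin_cases d <;> simp [nx6]
  · rintro (e | e)
    · obtain ⟨p, p', hne, hp⟩ := h.twice e
      refine ⟨.inl p, .inl p', by simpa using hne, ?_⟩
      rintro (d | d)
      · simpa [fe6] using hp d
      · fin_cases d <;> simp [fe6]
    · fin_cases e
      · refine ⟨.inr 1, .inr 4, by simp, ?_⟩
        rintro (d | d)
        · simp [fe6]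
        · fin_cases d <;> simp [fe6]
      · refine ⟨.inr 0, .inr 3, by simp, ?_⟩
        rintro (d | d)
        · simp [fe6]
        · fin_cases d <;> simp [fe6]
      · refine ⟨.inr 2, .inr 5, by simp, ?_⟩
        rintro (d | d)
        · simp [fe6]
        · fin_cases d <;> simp [fe6]
  · rintro (d | d)
    · rw [(snx d).1]; exact h.hends d
    · fin_cases d <;> simp [fe6, ends3, src6, nx6, Sym2.eq_swap]
  · intro v hv
    have key : ∀ v < n, Relation.EqvGen (fun x y => ∃ e, ends3 nx src n d0 ends e = s(x, y)) 0 v := fun v hv =>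
      (h.conn v hv).mono' (fun x y ⟨e, he⟩ => .rel _ _ ⟨.inl e, he⟩)
    rcases Nat.lt_succ_iff_lt_or_eq.1 hv with hv | rfl
    · exact key v hv
    · exact .trans _ _ _ (key _ (h.src_lt d0)) (.rel _ _ ⟨.inr 0, by simp [ends3, Sym2.eq_swap]⟩)
  · have old : ∀ c c', src c = src c' → Relation.EqvGen (Lk (nx6 nx d0) (src6 nx src n d0) (fe6 fe)) (.inl c) (.inl c') := by
      intro c c' hcc
      refine (h.link c c' hcc).map' Sum.inl ?_
      rintro x y ⟨hs, p, p', hne, hfe, h1, h2⟩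
      have t : ∀ x p, (x = p ∨ x = nx p) → ∃ x', (x' = .inl p ∨ x' = nx6 nx d0 (.inl p)) ∧ src6 nx src n d0 x' = src x ∧
          Relation.EqvGen (Lk (nx6 nx d0) (src6 nx src n d0) (fe6 fe)) (.inl x) x' := by
        rintro x p (rfl | rfl)
        · exact ⟨.inl x, Or.inl rfl, rfl, .refl _⟩
        · exact ⟨_, Or.inr rfl, (snx p).1, (snx p).2⟩
      obtain ⟨x', a1, a2, a3⟩ := t x p h1
      obtain ⟨y', b1, b2, b3⟩ := t y p' h2
      refine .trans _ _ _ a3 (.trans _ _ _ (.rel _ _ ⟨?_, .inl p, .inl p', by simpa using hne, by simpa [fe6] using hfe, a1, b1⟩) (.symm _ _ b3))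
      rw [a2, b2, hs]
    have red : ∀ x, (∃ d, src6 nx src n d0 x = src d ∧ Relation.EqvGen (Lk (nx6 nx d0) (src6 nx src n d0) (fe6 fe)) (.inl d) x) ∨
        (src6 nx src n d0 x = n ∧ Relation.EqvGen (Lk (nx6 nx d0) (src6 nx src n d0) (fe6 fe)) (.inr 1) x) := by
      rintro (d | d)
      · exact Or.inl ⟨d, rfl, .refl _⟩
      · fin_cases d
        · exact Or.inl ⟨_, rfl, l1⟩
        · exact Or.inr ⟨rfl, .refl _⟩
        · exact Or.inl ⟨_, rfl, l2⟩
        · exact Or.inr ⟨rfl, k1⟩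
        · exact Or.inl ⟨_, rfl, l0⟩
        · exact Or.inr ⟨rfl, .trans _ _ _ k1 k2⟩
    intro c c' hcc
    rcases red c with ⟨d, h1, h2⟩ | ⟨h1, h2⟩ <;> rcases red c' with ⟨d', h3, h4⟩ | ⟨h3, h4⟩
    · exact .trans _ _ _ (.symm _ _ h2) (.trans _ _ _ (old d d' (by omega)) h4)
    · have := h.src_lt d; omega
    · have := h.src_lt d'; omega
    · exact .trans _ _ _ (.symm _ _ h2) h4


def nxI (d : Bool × Fin 3) : Bool × Fin 3 := if d.1 then (true, d.2 - 1) else (false, d.2 + 1)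
def srcI (d : Bool × Fin 3) : ℕ := (d.2 : ℕ)
def feI (d : Bool × Fin 3) : Fin 3 := if d.1 then d.2 - 1 else d.2
def endsI (e : Fin 3) : Sym2 ℕ := s((e : ℕ), ((e + 1 : Fin 3) : ℕ))

theorem DE.init : DE nxI srcI feI endsI 3 := by
  constructor
  · rintro ⟨b, i⟩; exact i.2
  · decide
  · decide
  · have : ∀ e, ∀ d, feI d = e ↔ d = (false, e) ∨ d = (true, e + 1) := by decide
    exact fun e => ⟨(false, e), (true, e + 1), by simp, this e⟩
  · decide
  · intro v hv
    have h1 : endsI 0 = s(0, 1) := rfl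
    have h2 : endsI 2 = s(0, 2) := by decide
    interval_cases v
    · exact .refl _
    · exact .rel _ _ ⟨_, h1⟩
    · exact .rel _ _ ⟨_, h2⟩
  · have k : ∀ v : Fin 3, Relation.EqvGen (Lk nxI srcI feI) (false, v) (true, v) := by
      intro v
      refine .rel _ _ ⟨rfl, (false, v), (true, v + 1), by simp, ?_, Or.inl rfl, Or.inr ?_⟩
      · revert v; decide
      · revert v; decide
    rintro ⟨b, v⟩ ⟨b', v'⟩ hv
    have : v = v' := Fin.ext hv
    subst this
    rcases b with _ | _ <;> rcases b' with _ | _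
    · exact .refl _
    · exact k v
    · exact .symm _ _ (k v)
    · exact .refl _

theorem fac_perm {x y z a b c : ℕ} (h : ({x, y, z} : Finset ℕ) = {a, b, c}) (hab : a ≠ b) (hbc : b ≠ c) (hac : a ≠ c) (n : ℕ) (M : Multiset (Finset ℕ)) :
    ({x, y, n} : Finset ℕ) ::ₘ {y, z, n} ::ₘ {z, x, n} ::ₘ M = {n, a, b} ::ₘ {n, b, c} ::ₘ {n, a, c} ::ₘ M := by
  have sw : ∀ p q r : ℕ, ({p, q, r} : Finset ℕ) = {r, p, q} := by
    intro p q r; ext; simp; tauto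
  have sw2 : ∀ p q r : ℕ, ({p, q, r} : Finset ℕ) = {p, r, q} := by
    intro p q r; ext; simp; tauto
  have m1 : ∀ (p q r : Finset ℕ), p ::ₘ q ::ₘ r ::ₘ M = p ::ₘ r ::ₘ q ::ₘ M := fun p q r => by rw [Multiset.cons_swap q r]
  have m2 : ∀ (p q r : Finset ℕ), p ::ₘ q ::ₘ r ::ₘ M = q ::ₘ p ::ₘ r ::ₘ M := fun p q r => by rw [Multiset.cons_swap p q]
  have ha : a ∈ ({x, y, z} : Finset ℕ) := by rw [h]; simp
  have hb : b ∈ ({x, y, z} : Finset ℕ) := by rw [h]; simp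
  have hc : c ∈ ({x, y, z} : Finset ℕ) := by rw [h]; simp
  simp only [Finset.mem_insert, Finset.mem_singleton] at ha hb hc
  rw [sw x y n, sw y z n, sw z x n]
  rcases ha with rfl | rfl | rfl <;> rcases hb with rfl | rfl | rfl <;> rcases hc with rfl | rfl | rfl <;> try contradiction
  all_goals
    simp only [← Multiset.singleton_add]
    first
    | (rw [sw2 n c a]; done)
    | (rw [sw2 n c a]; abel; done)
    | (rw [sw2 n b a]; done)
    | (rw [sw2 n b a]; abel; done)
    | (rw [sw2 n c b]; done)
    | (rw [sw2 n c b]; abel; done)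
    | (rw [sw2 n c a, sw2 n b a]; done)
    | (rw [sw2 n c a, sw2 n b a]; abel; done)
    | (rw [sw2 n c b, sw2 n b a]; done)
    | (rw [sw2 n c b, sw2 n b a]; abel; done)
    | (rw [sw2 n c b, sw2 n c a]; done)
    | (rw [sw2 n c b, sw2 n c a]; abel; done)
    | (rw [sw2 n c b, sw2 n c a, sw2 n b a]; done)
    | (rw [sw2 n c b, sw2 n c a, sw2 n b a]; abel; done)

theorem Apol.DEex {n : ℕ} {M : Multiset (Finset ℕ)} {A : ℕ → ℕ → Prop} (h : Apol n M A) :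
    ∃ (D E : Type) (nx : D → D) (src : D → ℕ) (fe : D → E) (ends : E → Sym2 ℕ), Finite D ∧ Finite E ∧
      DE nx src fe ends n ∧ 3 * n + Nat.card D = 3 * Nat.card E + 6 ∧ (∀ x y, A x y → ∃ e, ends e = s(x, y)) ∧
      ∃ Rs : Multiset D, M = Rs.map (fac nx src) ∧ Rs.Nodup ∧ ∀ d ∈ Rs, nx d ∉ Rs ∧ nx (nx d) ∉ Rs := by
  induction h with
  | init =>
    refine ⟨Bool × Fin 3, Fin 3, nxI, srcI, feI, endsI, inferInstance, inferInstance, DE.init, by simp, ?_, ?_⟩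
    · rintro x y ⟨hx, hy, hxy⟩
      interval_cases x <;> interval_cases y <;> first | contradiction | (revert hxy; decide)
    · refine ⟨(false, 0) ::ₘ (true, 0) ::ₘ 0, by decide, by decide, by decide⟩
  | @step n M A a b c h hab hbc hac ih =>
    obtain ⟨D, E, nx, src, fe, ends, fD, fE, hDE, hc, hA, Rs, hM, hnd, hR⟩ := ih
    have hm : ({a, b, c} : Finset ℕ) ∈ Rs.map (fac nx src) := by rw [← hM]; simp
    obtain ⟨d0, hd0, hf⟩ := Multiset.mem_map.1 hm
    obtain ⟨Rs', rfl⟩ := Multiset.exists_cons_of_mem hd0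
    rw [Multiset.map_cons, hf, Multiset.cons_inj_right] at hM
    have n0 := hDE.nxne d0
    have n1 := hDE.nxne (nx d0)
    have n2 := hDE.nxne (nx (nx d0))
    rw [hDE.nx3] at n2
    have N0 : nx6 nx d0 (.inl d0) = .inr 0 := by simp [nx6]
    have N1 : nx6 nx d0 (.inl (nx d0)) = .inr 2 := by simp [nx6, n0]
    have N2 : nx6 nx d0 (.inl (nx (nx d0))) = .inr 4 := by simp [nx6, n1, n2.symm]
    have M0 : nx6 nx d0 (.inr 0) = .inr 1 := rfl
    have M2 : nx6 nx d0 (.inr 2) = .inr 3 := rfl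
    have M4 : nx6 nx d0 (.inr 4) = .inr 5 := rfl
    have inj : ∀ x y, nx x = nx y → x = y := fun x y e => by rw [← hDE.nx3 x, e, hDE.nx3]
    obtain ⟨hn1, hn2⟩ := Multiset.nodup_cons.1 hnd
    have hR0 := hR d0 (by simp)
    simp only [Multiset.mem_cons, not_or] at hR0
    have old : ∀ d ∈ Rs', (d ≠ d0 ∧ d ≠ nx d0 ∧ d ≠ nx (nx d0)) ∧ nx6 nx d0 (.inl d) = .inl (nx d) ∧ nx6 nx d0 (.inl (nx d)) = .inl (nx (nx d)) := by
      intro d hd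
      have h1 : d ≠ d0 := by rintro rfl; exact hn1 hd
      have h2 : d ≠ nx d0 := by rintro rfl; exact hR0.1.2 hd
      have h3 : d ≠ nx (nx d0) := by rintro rfl; exact hR0.2.2 hd
      have g1 : nx d ≠ d0 := fun e => h3 (by rw [← e, hDE.nx3])
      have g2 : nx d ≠ nx d0 := fun e => h1 (inj _ _ e)
      have g3 : nx d ≠ nx (nx d0) := fun e => h2 (inj _ _ e)
      exact ⟨⟨h1, h2, h3⟩, by simp [nx6, h1, h2, h3], by simp [nx6, g1, g2, g3]⟩
    refine ⟨D ⊕ Fin 6, E ⊕ Fin 3, _, _, _, _, inferInstance, inferInstance, hDE.step d0, ?_, ?_, ?_⟩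
    · simp only [Nat.card_sum, Nat.card_fin]; omega
    · have hz : ∀ z, (z = a ∨ z = b ∨ z = c) → ∃ e, ends3 nx src n d0 ends e = s(n, z) := by
        intro z hz
        have : z ∈ fac nx src d0 := by rw [hf]; simpa using hz
        simp only [fac, Finset.mem_insert, Finset.mem_singleton] at this
        rcases this with rfl | rfl | rfl
        · exact ⟨.inr 0, rfl⟩
        · exact ⟨.inr 1, rfl⟩
        · exact ⟨.inr 2, rfl⟩
      rintro x y (hxy | ⟨rfl, hy⟩ | ⟨rfl, hx⟩)
      · obtain ⟨e, he⟩ := hA x y hxy; exact ⟨.inl e, he⟩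
      · exact hz y hy
      · rw [Sym2.eq_swap]; exact hz x hx
    · refine ⟨.inl d0 ::ₘ .inl (nx d0) ::ₘ .inl (nx (nx d0)) ::ₘ Rs'.map Sum.inl, ?_, ?_, ?_⟩
      · simp only [Multiset.map_cons, Multiset.map_map]
        rw [← fac_perm hf hab hbc hac, hM]
        congr 1
        · simp only [fac, N0, M0]; rfl
        congr 1
        · simp only [fac, N1, M2]; rfl
        congr 1
        · simp only [fac, N2, M4]; rfl
        apply Multiset.map_congr rfl
        intro d hd
        simp only [fac, Function.comp, (old d hd).2.1, (old d hd).2.2]; rfl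
      · simp only [Multiset.nodup_cons, Multiset.mem_cons, Multiset.mem_map]
        refine ⟨?_, ?_, ?_, hn2.map Sum.inl_injective⟩
        · simp [n0.symm, n2, hn1]
        · simp [n1.symm, hR0.1.2]
        · simp [hR0.2.2]
      · intro d hd
        simp only [Multiset.mem_cons, Multiset.mem_map] at hd
        rcases hd with rfl | rfl | rfl | ⟨d, hd, rfl⟩
        · simp [N0, M0]
        · simp [N1, M2]
        · simp [N2, M4]
        · obtain ⟨⟨h1, h2, h3⟩, h4, h5⟩ := old d hd
          have := hR d (by simp [hd])
          simp only [Multiset.mem_cons, not_or] at this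
          rw [h4, h5]
          simp only [Multiset.mem_cons, Multiset.mem_map, Sum.inl.injEq, exists_eq_right, not_or]
          refine ⟨⟨this.1.1, fun e => h1 (inj _ _ e), fun e => h2 (inj _ _ e), this.1.2⟩, ⟨this.2.1, ?_, fun e => h1 (inj _ _ (inj _ _ e)), this.2.2⟩⟩
          intro e; exact this.1.1 (inj _ _ e)

theorem EqvGen_lift {n : ℕ} {E : Type} (ends : E → Sym2 ℕ) (ends' : E → Sym2 (Fin n)) (he : ∀ e, (ends' e).map (fun x : Fin n => (x : ℕ)) = ends e) (G : SimpleGraph (Fin n))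
    (hG : ∀ x y, x ≠ y → (∃ e, ends' e = s(x, y)) → G.Adj x y) (x y : ℕ)
    (h : Relation.EqvGen (fun x y => ∃ e, ends e = s(x, y)) x y) : x = y ∨ ∃ (hx : x < n) (hy : y < n), G.Reachable ⟨x, hx⟩ ⟨y, hy⟩ := by
  induction h with
  | rel x y h =>
    obtain ⟨e, h⟩ := h
    by_cases hxy : x = y
    · exact Or.inl hxy
    right
    have h1 := he e
    rw [h] at h1
    obtain ⟨a, b, hab⟩ : ∃ a b, ends' e = s(a, b) := by
      generalize ends' e = z
      induction z with | _ a b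
      exact ⟨a, b, rfl⟩
    rw [hab, Sym2.map_mk, Sym2.eq_iff] at h1
    have : ∀ a b : Fin n, ends' e = s(a, b) → (a : ℕ) = x → (b : ℕ) = y → ∃ (hx : x < n) (hy : y < n), G.Reachable ⟨x, hx⟩ ⟨y, hy⟩ := by
      intro a b hab h1 h2
      subst h1 h2
      exact ⟨a.2, b.2, (hG _ _ (fun e => hxy (congrArg _ e)) ⟨e, hab⟩).reachable⟩
    rcases h1 with ⟨h1, h2⟩ | ⟨h1, h2⟩
    · exact this _ _ hab h1 h2
    · exact this _ _ (hab.trans Sym2.eq_swap) h2 h1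
  | refl x => exact Or.inl rfl
  | symm x y _ ih =>
    rcases ih with rfl | ⟨hx, hy, h⟩
    · exact Or.inl rfl
    · exact Or.inr ⟨hy, hx, h.symm⟩
  | trans x y z _ _ h1 h2 =>
    rcases h1 with rfl | ⟨hx, hy, h⟩
    · exact h2
    · rcases h2 with rfl | ⟨hy', hz, h'⟩
      · exact Or.inr ⟨hx, hy, h⟩
      · exact Or.inr ⟨hx, hz, h.trans h'⟩

theorem Apol.planar {n : ℕ} {M : Multiset (Finset ℕ)} {A : ℕ → ℕ → Prop} (h : Apol n M A) (hA hA') : IsPlanar (HG n A hA hA') := by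
  obtain ⟨D, E, nx, src, fe, ends, fD, fE, hDE, hcard, hAe, -⟩ := h.DEex
  have hnpos : 0 < n := by clear * - h; cases h <;> omega
  have inj : ∀ x y, nx x = nx y → x = y := fun x y e => by rw [← hDE.nx3 x, e, hDE.nx3]
  -- faces
  let sd : Setoid D := ⟨fun x y => y = x ∨ y = nx x ∨ y = nx (nx x), by
    constructor
    · intro x; exact Or.inl rfl
    · rintro x y (rfl | rfl | rfl)
      · exact Or.inl rfl
      · exact Or.inr (Or.inr (hDE.nx3 _).symm)
      · exact Or.inr (Or.inl (hDE.nx3 _).symm)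
    · rintro x y z (rfl | rfl | rfl) (rfl | rfl | rfl) <;> simp [hDE.nx3]⟩
  let F := Quotient sd
  let o : F → D := Quotient.out
  have hper : ∀ d i, nx^[i + 3] d = nx^[i] d := by
    intro d i; rw [Function.iterate_add_apply]; congr 1; exact hDE.nx3 d
  -- positions
  have posE : ∀ d : D, ∃ p : F × ℕ, p.2 < 3 ∧ nx^[p.2] (o p.1) = d := by
    intro d
    have : sd.r (o ⟦d⟧) d := Quotient.exact (Quotient.out_eq (s := sd) ⟦d⟧)
    rcases this with h | h | h
    · exact ⟨(⟦d⟧, 0), by simp, h.symm⟩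
    · exact ⟨(⟦d⟧, 1), by simp, h.symm⟩
    · exact ⟨(⟦d⟧, 2), by simp, h.symm⟩
  have cls : ∀ (f : F) i, i < 3 → (⟦nx^[i] (o f)⟧ : F) = f := by
    intro f i hi
    have h1 : (⟦o f⟧ : F) = f := Quotient.out_eq f
    rw [← h1]
    apply Quotient.sound
    apply sd.symm
    rw [h1]
    interval_cases i
    · exact Or.inl rfl
    · exact Or.inr (Or.inl rfl)
    · exact Or.inr (Or.inr rfl)
  have posI : ∀ p q : F × ℕ, p.2 < 3 → q.2 < 3 → nx^[p.2] (o p.1) = nx^[q.2] (o q.1) → p = q := by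
    rintro ⟨f, i⟩ ⟨f', j⟩ hi hj hpq
    have : f = f' := by rw [← cls f i hi, ← cls f' j hj]; exact congrArg _ hpq
    subst this
    simp only at hi hj hpq
    have n0 := hDE.nxne (o f)
    have n1 := hDE.nxne (nx (o f))
    have n2 := hDE.nxne (nx (nx (o f)))
    rw [hDE.nx3] at n2
    congr 1
    clear * - hi hj hpq n0 n1 n2
    interval_cases i <;> interval_cases j <;> first | rfl | (exfalso; first | exact n0 hpq | exact n0 hpq.symm | exact n1 hpq | exact n1 hpq.symm | exact n2 hpq | exact n2 hpq.symm)
  choose pos pos3 hpos using posE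
  have hposnx : ∀ p : F × ℕ, p.2 < 3 → pos (nx (nx^[p.2] (o p.1))) = (p.1, (p.2 + 1) % 3) := by
    rintro ⟨f, i⟩ hi
    apply posI _ _ (pos3 _) (Nat.mod_lt _ (by norm_num))
    rw [hpos]
    simp only at hi ⊢
    interval_cases i
    · rfl
    · rfl
    · exact hDE.nx3 _
  let ends' : E → Sym2 (Fin n) := fun e => by
    exact Sym2.map (fun x : ℕ => if hx : x < n then ⟨x, hx⟩ else ⟨0, hnpos⟩) (ends e)
  have hends' : ∀ d, ends' (fe d) = s((⟨src d, hDE.src_lt d⟩ : Fin n), ⟨src (nx d), hDE.src_lt _⟩) := by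
    intro d
    simp only [ends', hDE.hends d, Sym2.map_mk, hDE.src_lt, dif_pos]
  have hends2 : ∀ e, (ends' e).map (fun x : Fin n => (x : ℕ)) = ends e := by
    intro e
    obtain ⟨p, p', -, hp⟩ := hDE.twice e
    have : fe p = e := (hp p).2 (Or.inl rfl)
    rw [← this, hends', hDE.hends, Sym2.map_mk]
  let Mg : Multigraph (Fin n) E := ⟨ends'⟩
  let bd : F → Mg.CWalk := fun f =>
    { len := 3, len_pos := by norm_num
      vtx := fun i => ⟨src (nx^[i] (o f)), hDE.src_lt _⟩
      edge := fun i => fe (nx^[i] (o f))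
      vtx_per := fun i => by simp only [hper]
      edge_per := fun i => by simp only [hper]
      compat := fun i => by
        show ends' _ = _
        rw [hends', Function.iterate_succ_apply'] }
  have hLk : ∀ (v : Fin n) (c c' : D), src c = v → Lk nx src fe c c' → Multigraph.CornerLinked bd v (pos c) (pos c') := by
    rintro v c c' hv ⟨hs, p, p', hne, hfe, h1, h2⟩
    have e1 : ∀ x q, (x = q ∨ x = nx q) → Multigraph.EndOf bd (pos x) (pos q) := by
      rintro x q (rfl | rfl)
      · exact ⟨rfl, Or.inl rfl⟩
      · have := hposnx (pos q) (pos3 q)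
        rw [hpos] at this
        rw [this]
        exact ⟨rfl, Or.inr rfl⟩
    refine ⟨⟨pos3 c, Fin.ext ?_⟩, ⟨pos3 c', Fin.ext ?_⟩, fe p, pos p, pos p', ?_, ⟨pos3 p, ?_⟩, ⟨pos3 p', ?_⟩, e1 _ _ h1, e1 _ _ h2⟩
    · show src (nx^[_] (o _)) = v; rw [hpos, hv]
    · show src (nx^[_] (o _)) = v; rw [hpos, ← hs, hv]
    · intro e; apply hne; rw [← hpos p, e, hpos]
    · show fe (nx^[_] (o _)) = _; rw [hpos]
    · show fe (nx^[_] (o _)) = _; rw [hpos, hfe]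
  have emb : Mg.Embedding F := 
    { boundary := bd
      conn := by
        rw [SimpleGraph.connected_iff_exists_forall_reachable]
        refine ⟨⟨0, hnpos⟩, fun v => ?_⟩
        rcases EqvGen_lift ends ends' hends2 Mg.simple (fun x y hxy he => ⟨hxy, he⟩) 0 v (hDE.conn v v.2) with h | ⟨h1, h2, h⟩
        · have : (⟨0, hnpos⟩ : Fin n) = v := Fin.ext h
          rw [this]
        · exact h
      edge_twice := by
        intro e
        obtain ⟨p, p', hne, hp⟩ := hDE.twice e
        have : {q : F × ℕ | Multigraph.IsOcc bd e q} = {pos p, pos p'} := by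
          ext q
          simp only [Set.mem_setOf_eq, Set.mem_insert_iff, Set.mem_singleton_iff]
          constructor
          · rintro ⟨h1, h2⟩
            rcases (hp _).1 h2 with h | h
            · left; apply posI _ _ h1 (pos3 _); rw [hpos]; exact h
            · right; apply posI _ _ h1 (pos3 _); rw [hpos]; exact h
          · rintro (rfl | rfl)
            · refine ⟨pos3 _, ?_⟩; show fe (nx^[_] (o _)) = _; rw [hpos, hp]; simp
            · refine ⟨pos3 _, ?_⟩; show fe (nx^[_] (o _)) = _; rw [hpos, hp]; simp
        rw [this, Set.ncard_pair]
        intro e; apply hne; rw [← hpos p, e, hpos]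
      link_conn := by
        rintro v c c' ⟨hc1, hc2⟩ ⟨hc1', hc2'⟩
        have k1 : src (nx^[c.2] (o c.1)) = v := congrArg Fin.val hc2
        have k2 : src (nx^[c'.2] (o c'.1)) = v := congrArg Fin.val hc2'
        have := hDE.link _ _ (k1.trans k2.symm)
        have q1 : pos (nx^[c.2] (o c.1)) = c := posI _ _ (pos3 _) hc1 (hpos _)
        have q2 : pos (nx^[c'.2] (o c'.1)) = c' := posI _ _ (pos3 _) hc1' (hpos _)
        rw [← q1, ← q2]
        clear q1 q2
        generalize nx^[c.2] (o c.1) = x at *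
        generalize nx^[c'.2] (o c'.1) = y at *
        have key : src x = src y ∧ (src x = v → Relation.EqvGen (Multigraph.CornerLinked bd v) (pos x) (pos y)) := by
          clear k1 k2 hc1 hc1' hc2 hc2'
          induction this with
          | rel x y h => exact ⟨h.1, fun hv => .rel _ _ (hLk v x y hv h)⟩
          | refl x => exact ⟨rfl, fun _ => .refl _⟩
          | symm x y _ ih => exact ⟨ih.1.symm, fun hv => .symm _ _ (ih.2 (ih.1.trans hv))⟩
          | trans x y z _ _ h1 h2 => exact ⟨h1.1.trans h2.1, fun hv => .trans _ _ _ (h1.2 hv) (h2.2 (h1.1.symm.trans hv))⟩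
        exact key.2 k1 }
  have hDF : Nat.card D = 3 * Nat.card F := by
    have e : D ≃ F × Fin 3 := 
      { toFun := fun d => ((pos d).1, ⟨(pos d).2, pos3 d⟩)
        invFun := fun p => nx^[p.2] (o p.1)
        left_inv := fun d => hpos d
        right_inv := fun p => by
          have := posI (pos (nx^[(p.2 : ℕ)] (o p.1))) (p.1, p.2) (pos3 _) p.2.2 (hpos _)
          have a1 := congrArg Prod.fst this
          have a2 := congrArg Prod.snd this
          apply Prod.ext
          · exact a1
          · exact Fin.ext a2 }
    rw [Nat.card_congr e, Nat.card_prod, Nat.card_fin, mul_comm]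
  refine ⟨Fin n, E, F, inferInstance, fE, inferInstance, Mg, emb, ?_, ⟨⟨id, ?_⟩, Function.injective_id⟩⟩
  · simp only [Multigraph.Embedding.eulerGenus, Nat.card_fin]
    omega
  · intro a b hab
    have hab' : A a b := hab
    have hne : a ≠ b := hab.ne
    obtain ⟨e, he⟩ := hAe a b hab'
    refine ⟨hne, e, ?_⟩
    show ends' e = _
    simp [ends', he]


section Walks
variable {W E : Type}

def Wk : W → List (W × Option E × W) → W → Prop
  | u, [], v => u = v
  | u, s :: l, v => s.1 = u ∧ Wk s.2.2 l v

def srcs (l : List (W × Option E × W)) : List W := l.map (·.1)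
def lbl (l : List (W × Option E × W)) : List (Option E) := l.map (·.2.1)
def flp (s : W × Option E × W) : W × Option E × W := (s.2.2, s.2.1, s.1)
def rv (l : List (W × Option E × W)) : List (W × Option E × W) := (l.map flp).reverse
def gd (en : E → Sym2 W) (s : W × Option E × W) : Prop := ∀ e, s.2.1 = some e → en e = s(s.1, s.2.2)
def gd0 (s : W × Option E × W) : Prop := s.2.1 = none → s.1 = s.2.2

theorem Wk.app {A B : List (W × Option E × W)} : ∀ {u v : W}, Wk u (A ++ B) v ↔ ∃ m, Wk u A m ∧ Wk m B v := by
  induction A with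
  | nil => intro u v; simp [Wk]
  | cons s A ih =>
    intro u v
    simp only [List.cons_append, Wk, ih]
    constructor
    · rintro ⟨h, m, h1, h2⟩; exact ⟨m, ⟨h, h1⟩, h2⟩
    · rintro ⟨m, ⟨h, h1⟩, h2⟩; exact ⟨h, m, h1, h2⟩

theorem Wk.rv {A : List (W × Option E × W)} : ∀ {u v : W}, Wk u A v → Wk v (rv A) u := by
  induction A with
  | nil => intro u v h; exact Eq.symm h
  | cons s A ih =>
    intro u v h
    have : _root_.rv (s :: A) = _root_.rv A ++ [flp s] := by simp [_root_.rv]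
    rw [this, Wk.app]
    exact ⟨s.2.2, ih h.2, rfl, h.1⟩

theorem Wk.tgts {A : List (W × Option E × W)} : ∀ {u v : W}, Wk u A v → u :: A.map (·.2.2) = srcs A ++ [v] := by
  induction A with
  | nil => intro u v h; simp [srcs, show u = v from h]
  | cons s A ih => intro u v h; simp only [List.map_cons, srcs, List.cons_append]; rw [h.1]; congr 1; exact ih h.2

theorem srcs_rv {A : List (W × Option E × W)} : srcs (rv A) = (A.map (·.2.2)).reverse := by
  simp [srcs, rv, flp, Function.comp_def]

theorem Wk.RRp {A : List (W × Option E × W)} (hA : A ≠ []) : ∀ {u v : W}, Wk u A v →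
    RR (srcs A ++ [v]) {p | ∃ s ∈ A, p = s(s.1, s.2.2)} := by
  induction A with
  | nil => exact absurd rfl hA
  | cons s A ih =>
    intro u v h
    rcases A with _ | ⟨t, A⟩
    · have : s.2.2 = v := h.2
      subst this
      exact RR.leaf _ _ _ (by rintro p ⟨s', hs, rfl⟩; simp at hs; subst hs; simp)
    · have h1 := ih (by simp) h.2
      have ht : t.1 = s.2.2 := h.2.1
      refine RR.tri s.1 t.1 v [s.1] (srcs A ++ [v]) _ _ _ rfl (by simp) (RR.leaf _ _ {s(s.1, t.1)} (by simp)) h1 ?_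
      rintro p ⟨s', hs, rfl⟩
      rcases List.mem_cons.1 hs with rfl | hs
      · left; left; rw [ht]; rfl
      · left; right; exact ⟨s', hs, rfl⟩

theorem Wk.RRc {l : List (W × Option E × W)} (hl : 2 ≤ l.length) {u : W} (h : Wk u l u) :
    RR (srcs l) {p | ∃ s ∈ l, p = s(s.1, s.2.2)} := by
  rcases List.eq_nil_or_concat l with rfl | ⟨l', s, rfl⟩
  · simp at hl
  rw [List.concat_eq_append] at *
  obtain ⟨m, h1, h2, h3⟩ := Wk.app.1 h
  have h3 : s.2.2 = u := h3
  have hne : l' ≠ [] := by rintro rfl; simp at hl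
  have r := h1.RRp hne
  rcases l' with _ | ⟨t, l'⟩
  · exact absurd rfl hne
  have := r.closing (u := t.1) (v := m) (by simp [srcs]) (by simp)
  rw [← h2] at this
  have e : srcs (t :: l' ++ [s]) = srcs (t :: l') ++ [s.1] := by simp [srcs]
  rw [e]
  refine this.mono ?_
  rintro p ⟨s', hs, rfl⟩
  rcases List.mem_append.1 hs with hs | hs
  · left; exact ⟨s', hs, rfl⟩
  · right; simp at hs; subst hs; rw [h3, ← h1.1, Sym2.eq_swap]; rfl

structure PG (en : E → Sym2 W) (l : List (W × Option E × W)) (P : Set (Sym2 W)) : Prop where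
  cl : ∃ u, Wk u l u
  gd : ∀ s ∈ l, gd en s ∧ gd0 s
  len : 2 ≤ l.length
  rr : RR (srcs l) P

theorem PG.rot {en : E → Sym2 W} {A B : List (W × Option E × W)} {P : Set (Sym2 W)} (h : PG en (A ++ B) P) : PG en (B ++ A) P := by
  obtain ⟨u, hu⟩ := h.cl
  obtain ⟨m, h1, h2⟩ := Wk.app.1 hu
  refine ⟨⟨m, Wk.app.2 ⟨u, h2, h1⟩⟩, fun s hs => h.gd s ?_, ?_, ?_⟩
  · simp only [List.mem_append] at hs ⊢; exact hs.symm
  · have := h.len; simp at this ⊢; omega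
  · have := h.rr
    simp only [srcs, List.map_append] at this ⊢
    exact this.rot

theorem PG.rev {en : E → Sym2 W} {A : List (W × Option E × W)} {P : Set (Sym2 W)} (h : PG en A P) : PG en (rv A) P := by
  obtain ⟨u, hu⟩ := h.cl
  refine ⟨⟨u, hu.rv⟩, ?_, by simpa [rv] using h.len, ?_⟩
  · intro s hs
    simp only [rv, List.mem_reverse, List.mem_map] at hs
    obtain ⟨s, hs, rfl⟩ := hs
    refine ⟨fun e he => ?_, fun he => ((h.gd s hs).2 he).symm⟩
    rw [(h.gd s hs).1 e he, Sym2.eq_swap]; rfl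
  · rw [srcs_rv]
    apply RR.rev
    have := hu.tgts
    rcases A with _ | ⟨s, A⟩
    · have := h.len; simp at this
    have h2 : srcs (s :: A) = u :: srcs A := by simp [srcs, hu.1]
    rw [h2] at this
    have h3 : (s :: A).map (·.2.2) = srcs A ++ [u] := by simpa using this
    rw [h3]
    have h4 := h.rr
    rw [h2] at h4
    exact h4.rot1 _ _ rfl

theorem perm_mid {α : Type} {a : α} {l : List α} (h : a ∈ l) : ∃ A B, l = A ++ a :: B := List.append_of_mem h

open Classical in
theorem PG.merge {en : E → Sym2 W} {L M : List (W × Option E × W)} {P Q : Set (Sym2 W)} (hL : PG en L P) (hM : PG en M Q) (e : E)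
    (h1 : some e ∈ lbl L) (h2 : some e ∈ lbl M) : ∃ N, PG en N (P ∪ Q) ∧ ∀ x, (lbl N).count x + (if x = some e then 2 else 0) = (lbl L).count x + (lbl M).count x := by
  simp only [lbl, List.mem_map] at h1 h2
  obtain ⟨⟨u, o, v⟩, hs, ho⟩ := h1
  obtain ⟨⟨u', o', v'⟩, ht, ho'⟩ := h2
  simp only at ho ho'
  subst ho ho'
  obtain ⟨A1, A2, rfl⟩ := perm_mid hs
  have hL' := hL.rot (A := A1) (B := (u, some e, v) :: A2)
  obtain ⟨M', hM', hc, B, rfl⟩ : ∃ M', PG en M' Q ∧ (∀ x, (lbl M').count x = (lbl M).count x) ∧ ∃ B, M' = (v, some e, u) :: B := by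
    obtain ⟨B1, B2, rfl⟩ := perm_mid ht
    have e1 : s(u, v) = s(u', v') := by
      rw [← (hL.gd _ hs).1 e rfl, (hM.gd _ ht).1 e rfl]
    rcases Sym2.eq_iff.1 e1 with ⟨rfl, rfl⟩ | ⟨rfl, rfl⟩
    · have e2 : rv (B1 ++ (u, some e, v) :: B2) = rv B2 ++ (v, some e, u) :: rv B1 := by simp [rv, flp]
      have hr := hM.rev
      rw [e2] at hr
      refine ⟨_, hr.rot, ?_, _, rfl⟩
      intro x
      simp [lbl, rv, flp, List.count_append, List.count_cons, Function.comp_def, List.map_reverse]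
      omega
    · refine ⟨_, hM.rot (A := B1) (B := (v, some e, u) :: B2), ?_, _, rfl⟩
      intro x
      simp [lbl, List.count_append, List.count_cons]; omega
  have hcL : ∀ x, (lbl (A1 ++ (u, some e, v) :: A2)).count x = (lbl (A2 ++ A1)).count x + (if x = some e then 1 else 0) := by
    intro x
    simp [lbl, List.count_append, List.count_cons, @eq_comm _ (some e) x]; omega
  have hcM : ∀ x, (lbl ((v, some e, u) :: B)).count x = (lbl B).count x + (if x = some e then 1 else 0) := by
    intro x
    simp [lbl, List.count_cons, @eq_comm _ (some e) x]
  rw [List.cons_append] at hL'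
  generalize A2 ++ A1 = A at *
  obtain ⟨w, hw1, hw2⟩ := hL'.cl
  obtain ⟨w', hw1', hw2'⟩ := hM'.cl
  simp only at hw1 hw1' hw2 hw2'
  subst hw1 hw1'
  refine ⟨A ++ B, ⟨⟨v, Wk.app.2 ⟨_, hw2, hw2'⟩⟩, ?_, ?_, ?_⟩, ?_⟩
  · intro s hs
    rcases List.mem_append.1 hs with h | h
    · exact hL'.gd s (by simp [h])
    · exact hM'.gd s (by simp [h])
  · have a := hL'.len
    have b := hM'.len
    simp at a b ⊢; omega
  · have a := hL'.rr
    have b := hM'.rr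
    have a' := hL'.len
    have b' := hM'.len
    rcases A with _ | ⟨s, A⟩
    · simp at a'
    rcases B with _ | ⟨t, B⟩
    · simp at b'
    have k1 : s.1 = v := hw2.1
    have k2 : t.1 = u := hw2'.1
    simp only [srcs, List.map_cons, List.map_append, List.cons_append, k1, k2] at a b ⊢
    exact RR.glue (a.rot1 _ _ rfl) (b.rot1 _ _ rfl)
  · intro x
    rw [← hc, hcL, hcM]
    simp only [lbl, List.map_append, List.count_append]
    split_ifs <;> omega
end Walks


section Cx
variable {W E F : Type}

open Classical in
noncomputable def cnt (l : List (W × Option E × W)) (e : E) : ℕ := (lbl l).count (some e)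

theorem cnt_pos {l : List (W × Option E × W)} {e : E} : 0 < cnt l e ↔ some e ∈ lbl l := by
  classical
  exact List.count_pos_iff

theorem cnt_nil {e : E} : cnt ([] : List (W × Option E × W)) e = 0 := rfl

open Classical in
theorem cnt_cons {s : W × Option E × W} {l : List (W × Option E × W)} {e : E} :
    cnt (s :: l) e = cnt l e + (if s.2.1 = some e then 1 else 0) := by
  simp [cnt, lbl, List.count_cons]

theorem cnt_app {A B : List (W × Option E × W)} {e : E} : cnt (A ++ B) e = cnt A e + cnt B e := by
  simp [cnt, lbl, List.count_append]

open Classical in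
theorem PG.merge' {en : E → Sym2 W} {L M : List (W × Option E × W)} {P Q : Set (Sym2 W)} (hL : PG en L P) (hM : PG en M Q) (e : E)
    (h1 : 0 < cnt L e) (h2 : 0 < cnt M e) : ∃ N, PG en N (P ∪ Q) ∧ ∀ x, cnt N x + (if x = e then 2 else 0) = cnt L x + cnt M x := by
  obtain ⟨N, hN, h⟩ := hL.merge hM e (cnt_pos.1 h1) (cnt_pos.1 h2)
  refine ⟨N, hN, fun x => ?_⟩
  have := h (some x)
  simpa [cnt] using this

def hphi (φ : W → ZMod 2) : Sym2 W → ZMod 2 := Sym2.lift ⟨fun a b => φ a + φ b, fun a b => add_comm _ _⟩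

theorem zmod2_self (x : ZMod 2) : x + x = 0 := by revert x; decide

theorem Wk.pot [Fintype E] {en : E → Sym2 W} (φ : W → ZMod 2) {l : List (W × Option E × W)} : ∀ {u v : W}, (∀ s ∈ l, gd en s ∧ gd0 s) → Wk u l v →
    ∑ e, (cnt l e : ZMod 2) * hphi φ (en e) = φ u + φ v := by
  classical
  induction l with
  | nil =>
    intro u v _ h
    have : u = v := h
    subst this
    simp [cnt_nil, zmod2_self]
  | cons s l ih =>
    intro u v hg h
    have := ih (fun t ht => hg t (by simp [ht])) h.2
    simp only [cnt_cons, Nat.cast_add, add_mul, Finset.sum_add_distrib, this]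
    have hs := hg s (by simp)
    rw [← h.1]
    rcases hse : s.2.1 with _ | e
    · rw [hs.2 hse]; simp
    · simp [hs.1 e hse, hphi]
      have := zmod2_self (φ s.2.2)
      linear_combination this

structure Cplx [Fintype F] (en : E → Sym2 W) (fc : F → List (W × Option E × W)) (K : F → Set (Sym2 W)) : Prop where
  pg : ∀ f, PG en (fc f) (K f)
  twice : ∀ e, ∑ f, cnt (fc f) e = 2
  on : ∀ w, ∃ f, w ∈ srcs (fc f)
  dual : ∀ P : F → Prop, (∃ f, P f) → (∀ e f f', 0 < cnt (fc f) e → 0 < cnt (fc f') e → P f → P f') → ∀ f, P f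

structure Tr (en : E → Sym2 W) (r : W) (par : W → W) (dep : W → ℕ) (te : W → Option E) : Prop where
  r1 : par r = r
  r2 : te r = none
  dp : ∀ v, v ≠ r → dep (par v) < dep v
  tee : ∀ v, v ≠ r → ∃ e, te v = some e ∧ en e = s(v, par v)
  ed : ∀ e u v, en e = s(u, v) → dep u ≤ dep v + 1

theorem Tr.ex (en : E → Sym2 W) (r : W) (conn : ∀ P : W → Prop, P r → (∀ e u v, en e = s(u, v) → P u → P v) → ∀ w, P w) :
    ∃ par dep te, Tr en r par dep te := by
  classical
  let G : SimpleGraph W := Multigraph.simple ⟨en⟩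
  have hr : ∀ w, G.Reachable r w := by
    apply conn
    · exact SimpleGraph.Reachable.refl _
    · intro e u v he hu
      by_cases h : u = v
      · exact h ▸ hu
      · exact hu.trans (SimpleGraph.Adj.reachable ⟨h, e, he⟩)
  have hc : G.Connected := (SimpleGraph.connected_iff_exists_forall_reachable G).2 ⟨r, hr⟩
  have key : ∀ v, v ≠ r → ∃ x e, en e = s(v, x) ∧ G.dist x r < G.dist v r := by
    intro v hv
    obtain ⟨p, hp⟩ := hc.exists_walk_length_eq_dist v r
    rcases p with _ | @⟨_, x, _, ha, p⟩
    · exact absurd rfl hv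
    · obtain ⟨e, he⟩ := ha.2
      refine ⟨x, e, he, ?_⟩
      have := SimpleGraph.dist_le p
      rw [SimpleGraph.Walk.length_cons] at hp
      omega
  choose x e he hd using key
  refine ⟨fun v => if h : v = r then r else x v h, fun v => G.dist v r, fun v => if h : v = r then none else some (e v h), by simp, by simp, ?_, ?_, ?_⟩
  · intro v hv; simp only [hv, dif_neg, not_false_iff]; exact hd v hv
  · intro v hv; exact ⟨e v hv, by simp [hv], by simp [hv, he v hv]⟩
  · intro e u v h
    by_cases huv : u = v
    · subst huv; omega
    · have h1 : G.Adj u v := ⟨huv, e, h⟩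
      have h2 := hc.dist_triangle (u := u) (v := v) (w := r)
      rw [SimpleGraph.dist_eq_one_iff_adj.2 h1] at h2
      omega

variable {en : E → Sym2 W} {r : W} {par : W → W} {dep : W → ℕ} {te : W → Option E}

theorem Tr.anc (h : Tr en r par dep te) : ∀ v, Anc par r v := by
  intro v
  generalize hn : dep v = n
  induction n using Nat.strong_induction_on generalizing v with
  | _ n ih =>
    by_cases hv : v = r
    · subst hv; exact Anc.refl _
    · obtain ⟨k, hk⟩ := ih _ (hn ▸ h.dp v hv) _ rfl
      exact ⟨k + 1, by rwa [Function.iterate_succ_apply]⟩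

theorem Tr.anc_dep (h : Tr en r par dep te) {w v : W} (ha : Anc par w v) : w = v ∨ dep w < dep v := by
  obtain ⟨k, hk⟩ := ha
  induction k generalizing v with
  | zero => exact Or.inl hk.symm
  | succ k ih =>
    rw [Function.iterate_succ_apply] at hk
    by_cases hv : v = r
    · subst hv; rw [h.r1] at hk; exact ih hk
    · have := h.dp v hv
      rcases ih hk with h1 | h1
      · right; rw [h1]; exact this
      · right; omega

theorem Tr.inj (h : Tr en r par dep te) {v v' : W} {e : E} (h1 : te v = some e) (h2 : te v' = some e) : v = v' := by
  have hv : v ≠ r := by rintro rfl; rw [h.r2] at h1; cases h1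
  have hv' : v' ≠ r := by rintro rfl; rw [h.r2] at h2; cases h2
  obtain ⟨e1, a1, a2⟩ := h.tee v hv
  obtain ⟨e2, b1, b2⟩ := h.tee v' hv'
  rw [h1] at a1; rw [h2] at b1
  cases a1; cases b1
  rw [a2] at b2
  rcases Sym2.eq_iff.1 b2 with ⟨h, -⟩ | ⟨h3, h4⟩
  · exact h
  · have := h.dp v hv; have := h.dp v' hv'; rw [h4] at *; rw [← h3] at *; omega

theorem Tr.cross (h : Tr en r par dep te) {w u : W} {e : E} (hu : te u = some e) :
    u = w ∨ (Anc par w u ↔ Anc par w (par u)) := by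
  by_cases huw : u = w
  · exact Or.inl huw
  right
  constructor
  · rintro ⟨k, hk⟩
    cases k with
    | zero => exact absurd hk huw
    | succ k => exact ⟨k, by rwa [Function.iterate_succ_apply] at hk⟩
  · rintro ⟨k, hk⟩; exact ⟨k + 1, by rwa [Function.iterate_succ_apply]⟩

theorem Tr.en_te (h : Tr en r par dep te) {u : W} {e : E} (hu : te u = some e) : u ≠ r ∧ en e = s(u, par u) := by
  have hv : u ≠ r := by rintro rfl; rw [h.r2] at hu; cases hu
  obtain ⟨e1, a1, a2⟩ := h.tee u hv
  rw [hu] at a1; cases a1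
  exact ⟨hv, a2⟩

open Classical in
theorem Cplx.nontree [Fintype F] [Fintype E] {fc : F → List (W × Option E × W)} {K : F → Set (Sym2 W)} (hC : Cplx en fc K)
    (h : Tr en r par dep te) (P : F → Prop) (hP : ∃ f, P f)
    (hcl : ∀ e f f', (∀ v, te v ≠ some e) → 0 < cnt (fc f) e → 0 < cnt (fc f') e → P f → P f') : ∀ f, P f := by
  refine hC.dual P hP fun e f f' hf hf' hPf => ?_
  by_cases hT : ∀ v, te v ≠ some e
  · exact hcl e f f' hT hf hf' hPf
  push Not at hT
  obtain ⟨v, hv⟩ := hT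
  by_contra hPf'
  obtain ⟨hvr, hve⟩ := h.en_te hv
  let φ : W → ZMod 2 := fun w => if Anc par v w then 1 else 0
  have hsum : ∑ e, ((∑ f with P f, cnt (fc f) e : ℕ) : ZMod 2) * hphi φ (en e) = 0 := by
    simp only [Nat.cast_sum, Finset.sum_mul]
    rw [Finset.sum_comm]
    apply Finset.sum_eq_zero
    intro f _
    obtain ⟨u, hu⟩ := (hC.pg f).cl
    rw [Wk.pot φ (hC.pg f).gd hu, zmod2_self]
  have hne : ¬ Anc par v (par v) := by
    intro ha
    have := h.dp v hvr
    rcases h.anc_dep ha with h1 | h1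
    · rw [← h1] at this; omega
    · omega
  have split : ∀ e, ∑ f with P f, cnt (fc f) e + ∑ f with ¬ P f, cnt (fc f) e = 2 := by
    intro e; rw [Finset.sum_filter_add_sum_filter_not, hC.twice]
  rw [Finset.sum_eq_single e] at hsum
  · have h1 : hphi φ (en e) = 1 := by
      simp [hve, hphi, φ, hne, Anc.refl]
    have h2 : cnt (fc f) e ≤ ∑ f with P f, cnt (fc f) e := Finset.single_le_sum (f := fun f => cnt (fc f) e) (by simp) (by simpa using hPf)
    have h3 : cnt (fc f') e ≤ ∑ f with ¬ P f, cnt (fc f) e := Finset.single_le_sum (f := fun f => cnt (fc f) e) (by simp) (by simpa using hPf')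
    have h4 : ∑ f with P f, cnt (fc f) e = 1 := by have := split e; omega
    rw [h4, h1] at hsum
    exact absurd hsum (by decide)
  · intro e' _ hne'
    by_cases hT : ∀ v, te v ≠ some e'
    · by_cases hex : ∃ f, P f ∧ 0 < cnt (fc f) e'
      · obtain ⟨f1, hf1, hf2⟩ := hex
        have : ∑ f with ¬ P f, cnt (fc f) e' = 0 := by
          apply Finset.sum_eq_zero
          intro f2 hf
          simp only [Finset.mem_filter, Finset.mem_univ, true_and] at hf
          by_contra hc
          exact hf (hcl e' f1 f2 hT hf2 (by omega) hf1)
        have := split e'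
        rw [show ∑ f with P f, cnt (fc f) e' = 2 by omega]
        have : ((2 : ℕ) : ZMod 2) = 0 := by decide
        rw [this, zero_mul]
      · have : ∑ f with P f, cnt (fc f) e' = 0 := by
          apply Finset.sum_eq_zero
          intro f2 hf
          simp only [Finset.mem_filter, Finset.mem_univ, true_and] at hf
          by_contra hc
          exact hex ⟨f2, hf, by omega⟩
        rw [this]; simp
    · push Not at hT
      obtain ⟨u, hu⟩ := hT
      have huv : u ≠ v := by rintro rfl; rw [hv] at hu; cases hu; exact hne' rfl
      rcases h.cross (w := v) hu with h1 | h1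
      · exact absurd h1 huv
      · rw [(h.en_te hu).2]
        simp only [hphi, Sym2.lift_mk, φ, h1, zmod2_self, mul_zero]
  · simp

open Classical in
theorem Cplx.poly [Fintype F] [Fintype E] {fc : F → List (W × Option E × W)} {K : F → Set (Sym2 W)} (hC : Cplx en fc K)
    (h : Tr en r par dep te) [Nonempty F] : ∃ (L : List (W × Option E × W)) (P : Set (Sym2 W)) (Q : Finset E), PG en L P ∧ (∀ f, K f ⊆ P) ∧
      (∀ e ∈ Q, ∀ v, te v ≠ some e) ∧ Q.card + 1 = Fintype.card F ∧ ∀ e, cnt L e + (if e ∈ Q then 2 else 0) = 2 := by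
  have key : ∀ n, n + 1 ≤ Fintype.card F → ∃ (S : Finset F) (L : List (W × Option E × W)) (P : Set (Sym2 W)) (Q : Finset E), S.card = n + 1 ∧ PG en L P ∧ (∀ f ∈ S, K f ⊆ P) ∧
      (∀ e ∈ Q, ∀ v, te v ≠ some e) ∧ Q.card + 1 = S.card ∧ ∀ e, cnt L e + (if e ∈ Q then 2 else 0) = ∑ f ∈ S, cnt (fc f) e := by
    intro n
    induction n with
    | zero =>
      intro _
      let f0 : F := Classical.arbitrary F
      exact ⟨{f0}, fc f0, K f0, ∅, by simp, hC.pg f0, by simp, by simp, by simp, by simp⟩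
    | succ n ih =>
      intro hn
      obtain ⟨S, L, P, Q, h1, h2, h3, h4, h5, h6⟩ := ih (by omega)
      have hex : ∃ e f f', (∀ v, te v ≠ some e) ∧ 0 < cnt (fc f) e ∧ 0 < cnt (fc f') e ∧ f ∈ S ∧ f' ∉ S := by
        by_contra hcon
        push Not at hcon
        have hne : S.Nonempty := by rw [← Finset.card_pos]; omega
        have := hC.nontree h (fun f => f ∈ S) hne (fun e f f' a b c d => hcon e f f' a b c d)
        have : S = Finset.univ := by ext f; simp [this f]
        rw [this, Finset.card_univ] at h1
        omega
      obtain ⟨e, f, f', hT, hf, hf', hS, hS'⟩ := hex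
      have t := hC.twice e
      have t1 : cnt (fc f) e ≤ ∑ f ∈ S, cnt (fc f) e := Finset.single_le_sum (f := fun f => cnt (fc f) e) (by simp) hS
      have t2 : ∑ f ∈ insert f' S, cnt (fc f) e ≤ ∑ f, cnt (fc f) e := Finset.sum_le_sum_of_subset (Finset.subset_univ _)
      rw [Finset.sum_insert hS'] at t2
      have heQ : e ∉ Q := by
        intro hQ
        have := h6 e
        rw [if_pos hQ] at this
        omega
      have h6e := h6 e
      rw [if_neg heQ] at h6e
      obtain ⟨N, hN, hc⟩ := h2.merge' (hC.pg f') e (by omega) hf'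
      refine ⟨insert f' S, N, P ∪ K f', insert e Q, ?_, hN, ?_, ?_, ?_, ?_⟩
      · rw [Finset.card_insert_of_notMem hS']; omega
      · intro x hx
        rcases Finset.mem_insert.1 hx with rfl | hx
        · exact Set.subset_union_right
        · exact (h3 x hx).trans Set.subset_union_left
      · intro x hx
        rcases Finset.mem_insert.1 hx with rfl | hx
        · exact hT
        · exact h4 x hx
      · rw [Finset.card_insert_of_notMem hS', Finset.card_insert_of_notMem heQ]; omega
      · intro x
        have a := h6 x
        have b := hc x
        rw [Finset.sum_insert hS']
        by_cases hx : x = e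
        · subst hx
          simp only [Finset.mem_insert, true_or, if_true] at *
          omega
        · simp only [Finset.mem_insert, hx, false_or, if_false] at *
          omega
  obtain ⟨S, L, P, Q, h1, h2, h3, h4, h5, h6⟩ := key (Fintype.card F - 1) (by have := Fintype.card_pos (α := F); omega)
  have hpos := Fintype.card_pos (α := F)
  have hS : S = Finset.univ := by rw [← Finset.card_eq_iff_eq_univ]; omega
  subst hS
  refine ⟨L, P, Q, h2, fun f => h3 f (by simp), h4, by rw [h5, Finset.card_univ], fun e => ?_⟩
  rw [h6, hC.twice]

end Cx


section Cx
variable {W E F : Type}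

open Classical in
theorem Wk.alt (B : W → Prop) {l : List (W × Option E × W)} : ∀ {u v : W}, Wk u l v → ∀ m : List W, List.Sublist m (srcs l) →
    m.IsChain (fun x y => ¬ (B x ↔ B y)) →
    m.length ≤ l.countP (fun s => ¬ (B s.1 ↔ B s.2.2)) + 1 ∧ (∀ x, m.head? = some x → ¬ (B x ↔ B u) → m.length ≤ l.countP (fun s => ¬ (B s.1 ↔ B s.2.2))) := by
  induction l with
  | nil =>
    intro u v _ m hm _
    have : m = [] := by simpa [srcs] using hm
    subst this; simp
  | cons s l ih =>
    intro u v h m hm hch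
    have hle : l.countP (fun s => ¬ (B s.1 ↔ B s.2.2)) ≤ (s :: l).countP (fun s => ¬ (B s.1 ↔ B s.2.2)) := by
      rw [List.countP_cons]; omega
    have tail : ∀ m : List W, List.Sublist m (srcs l) → m.IsChain (fun x y => ¬ (B x ↔ B y)) → ∀ x, m.head? = some x → ¬ (B x ↔ B u) →
        m.length ≤ (s :: l).countP (fun s => ¬ (B s.1 ↔ B s.2.2)) := by
      intro m hm hch x hx hxu
      obtain ⟨i1, i2⟩ := ih h.2 m hm hch
      by_cases hc : B s.1 ↔ B s.2.2
      · refine (i2 x hx ?_).trans hle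
        rw [← hc, h.1]; exact hxu
      · rw [List.countP_cons, if_pos (by simpa using hc)]; exact i1
    rcases m with _ | ⟨x, m⟩
    · simp
    rcases List.sublist_cons_iff.1 hm with hm | ⟨m', hm', hm⟩
    · exact ⟨(ih h.2 _ hm hch).1.trans (by omega), tail _ hm hch⟩
    · cases hm'
      have hx : B s.1 ↔ B u := by rw [h.1]
      refine ⟨?_, fun x hx' hxu => ?_⟩
      · rcases m with _ | ⟨y, m⟩
        · simp
        rw [List.isChain_cons_cons] at hch
        have := tail _ hm hch.2 y rfl (fun h' => hch.1 (by rw [hx, h']))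
        simp only [List.length_cons] at *; omega
      · simp only [List.head?_cons, Option.some.injEq] at hx'; subst hx'
        exact absurd hx hxu

theorem Wk.nc (B : W → Prop) {l : List (W × Option E × W)} {u v : W} (h : Wk u l v) (e : E) (he : cnt l e ≤ 2)
    (hB : ∀ s ∈ l, ¬ (B s.1 ↔ B s.2.2) → s.2.1 = some e) : NC B (srcs l) := by
  classical
  have hle : l.countP (fun s => ¬ (B s.1 ↔ B s.2.2)) ≤ 2 := by
    refine le_trans ?_ he
    rw [cnt, lbl, List.count, List.countP_map]
    apply List.countP_mono_left
    intro s hs h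
    simp only [decide_eq_true_eq] at h
    simp [hB s hs h]
  intro p q s t hs
  constructor
  · rintro ⟨h1, h2, h3, h4⟩
    have := (h.alt B _ hs (by simp [h1, h2, h3, h4])).1
    simp only [List.length_cons, List.length_nil] at this
    omega
  · rintro ⟨h1, h2, h3, h4⟩
    have := (h.alt B _ hs (by simp [h1, h2, h3, h4])).1
    simp only [List.length_cons, List.length_nil] at this
    omega

variable {en : E → Sym2 W}

theorem Wk.const (P : W → Prop) (hP : ∀ e u v, en e = s(u, v) → P u → P v) {l : List (W × Option E × W)} : ∀ {u v : W}, (∀ s ∈ l, gd en s ∧ gd0 s) →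
    Wk u l v → ∀ s ∈ l, (P s.1 ↔ P u) ∧ (P s.2.2 ↔ P u) := by
  induction l with
  | nil => intro u v _ _ s hs; simp at hs
  | cons t l ih =>
    intro u v hg h s hs
    have ht : P t.1 ↔ P t.2.2 := by
      have := hg t (by simp)
      rcases hh : t.2.1 with _ | e
      · rw [this.2 hh]
      · exact ⟨hP e _ _ (this.1 e hh), hP e _ _ ((this.1 e hh).trans Sym2.eq_swap)⟩
    rw [← h.1]
    rcases List.mem_cons.1 hs with rfl | hs
    · exact ⟨Iff.rfl, ht.symm⟩
    · have := ih (fun s hs => hg s (by simp [hs])) h.2 s hs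
      rw [ht]; exact this

theorem Cplx.conn [Fintype F] {fc : F → List (W × Option E × W)} {K : F → Set (Sym2 W)} (hC : Cplx en fc K) (r : W)
    (P : W → Prop) (hr : P r) (hP : ∀ e u v, en e = s(u, v) → P u → P v) : ∀ w, P w := by
  have loc : ∀ f, ∃ b : Prop, ∀ s ∈ fc f, (P s.1 ↔ b) ∧ (P s.2.2 ↔ b) := by
    intro f
    obtain ⟨u, hu⟩ := (hC.pg f).cl
    exact ⟨P u, Wk.const P hP (hC.pg f).gd hu⟩
  choose b hb using loc
  have hon : ∀ w, ∃ f, P w ↔ b f := by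
    intro w
    obtain ⟨f, hf⟩ := hC.on w
    simp only [srcs, List.mem_map] at hf
    obtain ⟨s, hs, rfl⟩ := hf
    exact ⟨f, (hb f s hs).1⟩
  have all : ∀ f, b f := by
    apply hC.dual
    · obtain ⟨f, hf⟩ := hon r; exact ⟨f, hf.1 hr⟩
    · intro e f f' h1 h2 hbf
      rw [cnt_pos] at h1 h2
      simp only [lbl, List.mem_map] at h1 h2
      obtain ⟨s, hs, he⟩ := h1
      obtain ⟨s', hs', he'⟩ := h2
      have a1 := ((hC.pg f).gd s hs).1 e he
      have a2 := ((hC.pg f').gd s' hs').1 e he'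
      rw [a1] at a2
      rcases Sym2.eq_iff.1 a2 with ⟨h, -⟩ | ⟨h, -⟩
      · rw [← (hb f' s' hs').1, ← h]; exact (hb f s hs).1.2 hbf
      · rw [← (hb f' s' hs').2, ← h]; exact (hb f s hs).1.2 hbf
  intro w
  obtain ⟨f, hf⟩ := hon w
  exact hf.2 (all f)

theorem Wk.mem_srcs {l : List (W × Option E × W)} {u : W} (h : Wk u l u) {s : W × Option E × W} (hs : s ∈ l) : s.1 ∈ srcs l ∧ s.2.2 ∈ srcs l := by
  refine ⟨List.mem_map_of_mem hs, ?_⟩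
  have h1 : s.2.2 ∈ u :: l.map (·.2.2) := List.mem_cons_of_mem _ (List.mem_map_of_mem hs)
  rw [h.tgts] at h1
  rcases List.mem_append.1 h1 with h2 | h2
  · exact h2
  · simp at h2; rw [h2]
    rcases l with _ | ⟨t, l⟩
    · simp at hs
    · simp [srcs, ← h.1]

theorem partII [Fintype W] [Fintype E] [Fintype F] [Nonempty F] {fc : F → List (W × Option E × W)} {K : F → Set (Sym2 W)} (hC : Cplx en fc K) (g : ℕ)
    (hg : Fintype.card E + 2 ≤ Fintype.card W + Fintype.card F + g) :
    ∃ (par : W → W) (dep : W → ℕ) (Zl : List W) (S : St W), (∀ v, par v = v ∨ dep (par v) < dep v) ∧ Zl.length ≤ max (2 * g) 1 ∧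
      (∀ e u v, en e = s(u, v) → dep u ≤ dep v + 1) ∧ WF par {v | ∃ z ∈ Zl, Anc par v z} S ∧ (∀ v, v ∈ S.U) ∧
      ∀ f x y, s(x, y) ∈ K f → Okay S x y := by
  classical
  obtain ⟨r⟩ : Nonempty W := by
    obtain ⟨u, -⟩ := (hC.pg (Classical.arbitrary F)).cl; exact ⟨u⟩
  obtain ⟨par, dep, te, h⟩ := Tr.ex en r (hC.conn r)
  obtain ⟨L, P, Q, hL, hK, hQ, hQc, hcnt⟩ := hC.poly h
  let X : Finset E := {e | (∀ v, te v ≠ some e) ∧ e ∉ Q}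
  let T : Finset E := {e | ∃ v, te v = some e}
  have hT : Fintype.card W ≤ T.card + 1 := by
    have : (Finset.univ.erase r).card ≤ (T.map Function.Embedding.some).card := by
      apply Finset.card_le_card_of_injOn te
      · intro v hv
        have hv : v ≠ r := by simpa using hv
        obtain ⟨e, he, -⟩ := h.tee v hv
        simp only [T, Finset.coe_map, Set.mem_image, Finset.coe_filter, Finset.mem_univ, true_and, Set.mem_setOf_eq]
        exact ⟨e, ⟨v, he⟩, he.symm⟩
      · intro v hv w hw hvw
        have hv : v ≠ r := by simpa using hv
        obtain ⟨e, he, -⟩ := h.tee v hv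
        exact h.inj he (hvw ▸ he)
    rw [Finset.card_map] at this
    rw [Finset.card_erase_of_mem (Finset.mem_univ _), Finset.card_univ] at this
    omega
  have hX : X.card ≤ g := by
    have h1 : Disjoint X Q := Finset.disjoint_left.2 (fun e he => by simp only [X, Finset.mem_filter] at he; exact he.2.2)
    have h2 : Disjoint (X ∪ Q) T := by
      rw [Finset.disjoint_left]
      intro e he hT
      simp only [T, Finset.mem_filter, Finset.mem_univ, true_and] at hT
      obtain ⟨v, hv⟩ := hT
      rcases Finset.mem_union.1 he with he | he
      · simp only [X, Finset.mem_filter] at he; exact he.2.1 v hv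
      · exact hQ e he v hv
    have h3 : ((X ∪ Q) ∪ T).card ≤ Fintype.card E := Finset.card_le_univ _
    rw [Finset.card_union_of_disjoint h2, Finset.card_union_of_disjoint h1] at h3
    omega
  have hends : ∀ e, ∃ p : W × W, en e = s(p.1, p.2) := by
    intro e; induction en e with | _ a b
    exact ⟨(a, b), rfl⟩
  choose p hp using hends
  obtain ⟨Zl, hZ1, hZ2, hZ3⟩ : ∃ Zl : List W, Zl.length ≤ max (2 * g) 1 ∧ Zl ≠ [] ∧ ∀ e ∈ X, (p e).1 ∈ Zl ∧ (p e).2 ∈ Zl := by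
    by_cases hXe : X = ∅
    · exact ⟨[r], by simp, by simp, by simp [hXe]⟩
    · refine ⟨X.toList.map (fun e => (p e).1) ++ X.toList.map (fun e => (p e).2), ?_, ?_, ?_⟩
      · simp; omega
      · simp [hXe]
      · intro e he
        constructor
        · apply List.mem_append_left; exact List.mem_map_of_mem (f := fun e => (p e).1) (by simpa using he)
        · apply List.mem_append_right; exact List.mem_map_of_mem (f := fun e => (p e).2) (by simpa using he)
  obtain ⟨z0, hz0⟩ := List.exists_mem_of_ne_nil _ hZ2
  obtain ⟨u0, hu0⟩ := hL.cl
  have hrZ : ∃ z ∈ Zl, Anc par r z := ⟨z0, hz0, h.anc z0⟩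
  obtain ⟨S, hS1, hS2, hS3, hS4⟩ := coreIII par {v | ∃ z ∈ Zl, Anc par v z} (by
      rintro v ⟨z, hz, hv⟩
      exact ⟨z, hz, Anc.trans ⟨1, rfl⟩ hv⟩) (by
      intro v
      obtain ⟨k, hk⟩ := h.anc v
      exact ⟨k, by rw [hk]; exact hrZ⟩) (srcs L) P hL.rr (by
      intro w hw
      have hwr : w ≠ r := by rintro rfl; exact hw hrZ
      obtain ⟨e, he, hee⟩ := h.tee w hwr
      have hle : ∀ e, cnt L e ≤ 2 := fun e => by have := hcnt e; omega
      refine hu0.nc _ e (hle e) ?_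
      intro s hs hcr
      rcases hse : s.2.1 with _ | e'
      · exact absurd (by rw [(hL.gd s hs).2 hse]) hcr
      have hen := (hL.gd s hs).1 e' hse
      have hpos : 0 < cnt L e' := cnt_pos.2 (hse ▸ List.mem_map_of_mem (f := fun s => s.2.1) hs)
      have heQ : e' ∉ Q := by
        intro hq
        have := hcnt e'
        rw [if_pos hq] at this; omega
      by_cases hTe : ∀ v, te v ≠ some e'
      · exfalso
        have hx : e' ∈ X := by simp only [X, Finset.mem_filter, Finset.mem_univ, true_and]; exact ⟨hTe, heQ⟩
        have hz : s.1 ∈ Zl ∧ s.2.2 ∈ Zl := by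
          have := hp e'
          rw [hen] at this
          rcases Sym2.eq_iff.1 this with ⟨a, b⟩ | ⟨a, b⟩
          · rw [a, b]; exact hZ3 e' hx
          · rw [a, b]; exact (hZ3 e' hx).symm
        have n1 : ¬ Anc par w s.1 := fun ha => hw ⟨_, hz.1, ha⟩
        have n2 : ¬ Anc par w s.2.2 := fun ha => hw ⟨_, hz.2, ha⟩
        exact hcr (by simp [n1, n2])
      · push Not at hTe
        obtain ⟨u, hu⟩ := hTe
        have hu2 := (h.en_te hu).2
        rcases h.cross (w := w) hu with rfl | hc
        · rw [← hu, he]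
        · exfalso
          rw [hen] at hu2
          rcases Sym2.eq_iff.1 hu2 with ⟨a, b⟩ | ⟨a, b⟩
          · rw [a, b] at hcr; exact hcr hc
          · rw [a, b] at hcr; exact hcr hc.symm)
  refine ⟨par, dep, Zl, S, ?_, hZ1, h.ed, hS1, ?_, fun f x y hxy => hS4 x y (hK f hxy)⟩
  · intro v
    by_cases hv : v = r
    · subst hv; exact Or.inl h.r1
    · exact Or.inr (h.dp v hv)
  · intro v
    by_cases hv : v = r
    · subst hv; exact hS2 _ hrZ
    · obtain ⟨e, he, hee⟩ := h.tee v hv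
      have heQ : e ∉ Q := fun hq => hQ e hq v he
      have := hcnt e
      rw [if_neg heQ] at this
      have : 0 < cnt L e := by omega
      rw [cnt_pos] at this
      simp only [lbl, List.mem_map] at this
      obtain ⟨s, hs, hse⟩ := this
      have hen := (hL.gd s hs).1 e hse
      rw [hee] at hen
      apply hS3
      rcases Sym2.eq_iff.1 hen with ⟨a, b⟩ | ⟨a, b⟩
      · rw [a]; exact (hu0.mem_srcs hs).1
      · rw [a]; exact (hu0.mem_srcs hs).2
end Cx


theorem dep_iter {W : Type} {par : W → W} {dep : W → ℕ} (h : ∀ v, par v = v ∨ dep (par v) < dep v) (k : ℕ) (t : W) :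
    par^[k] t = t ∨ dep (par^[k] t) < dep t := by
  induction k generalizing t with
  | zero => exact Or.inl rfl
  | succ k ih =>
    rw [Function.iterate_succ_apply]
    rcases h t with h1 | h1
    · rw [h1]; exact ih t
    · rcases ih (par t) with h2 | h2
      · rw [h2]; exact Or.inr h1
      · exact Or.inr (by omega)

theorem anc_eq {W : Type} {par : W → W} {dep : W → ℕ} (h : ∀ v, par v = v ∨ dep (par v) < dep v) {u v t : W} (hu : Anc par u t)
    (hv : Anc par v t) (hd : dep u = dep v) : u = v := by
  obtain ⟨j, rfl⟩ := hu
  obtain ⟨k, rfl⟩ := hv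
  wlog hjk : j ≤ k generalizing j k
  · exact (this k j hd.symm (by omega)).symm
  obtain ⟨i, rfl⟩ := Nat.exists_eq_add_of_le' hjk
  rw [Function.iterate_add_apply] at hd ⊢
  rcases dep_iter h i (par^[j] t) with h1 | h1
  · exact h1.symm
  · omega

open Classical in
theorem fib_card {W : Type} [Fintype W] {par : W → W} {dep : W → ℕ} (h : ∀ v, par v = v ∨ dep (par v) < dep v) (T : List W) (l : ℕ)
    (s : Finset W) (hs : ∀ w ∈ s, dep w / 2 = l ∧ ∃ t ∈ T, Anc par w t) : s.card ≤ 2 * T.length := by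
  have : ∀ w : W, ∃ t, w ∈ s → t ∈ T ∧ Anc par w t := by
    intro w
    by_cases hw : w ∈ s
    · obtain ⟨t, ht⟩ := (hs w hw).2; exact ⟨t, fun _ => ht⟩
    · exact ⟨w, fun h => absurd h hw⟩
  choose t ht using this
  have h1 : s.card ≤ (T.toFinset ×ˢ Finset.range 2).card := by
    apply Finset.card_le_card_of_injOn (fun w => (t w, dep w % 2))
    · intro w hw
      have := (ht w hw).1
      simp [this]; omega
    · intro w hw w' hw' he
      simp only [Prod.mk.injEq] at he
      have a := (ht w hw).2
      have b := (ht w' hw').2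
      rw [← he.1] at b
      refine anc_eq h a b ?_
      have := (hs w hw).1
      have := (hs w' hw').1
      omega
  rw [Finset.card_product, Finset.card_range] at h1
  have := T.toFinset_card_le
  omega

theorem exists_inj_of_card {W : Type} (m : ℕ) (hm : 0 < m) (s : Finset W) (hs : s.card ≤ m) : ∃ f : W → Fin m, Set.InjOn f s := by
  classical
  obtain ⟨f⟩ : Nonempty (s ↪ Fin m) := Function.Embedding.nonempty_of_card_le (by simpa using hs)
  refine ⟨fun w => if h : w ∈ s then f ⟨w, h⟩ else ⟨0, hm⟩, ?_⟩
  intro a ha b hb hab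
  have ha : a ∈ s := ha
  have hb : b ∈ s := hb
  simp only [ha, hb, dif_pos] at hab
  have := f.injective hab
  simpa using this

theorem assemble (g : ℕ) {V W : Type} (G : SimpleGraph V) [Fintype W] (ι : V → W) (hι : Function.Injective ι) (par : W → W) (dep : W → ℕ) (Zl : List W) (S : St W)
    (hpar : ∀ v, par v = v ∨ dep (par v) < dep v) (hZl : Zl.length ≤ max (2 * g) 1) (hS : WF par {v | ∃ z ∈ Zl, Anc par v z} S) (hU : ∀ v, v ∈ S.U)
    (hG : ∀ u v, G.Adj u v → Okay S (ι u) (ι v) ∧ dep (ι u) ≤ dep (ι v) + 2) :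
    ∃ (W : Type) (H : SimpleGraph W) (n : ℕ),
      IsPlanar H ∧ TreewidthLE H 3 ∧
      G.IsContainedIn
        ((H.strongProd (SimpleGraph.pathGraph n)).strongProd
          (SimpleGraph.completeGraph (Fin (max (4 * g) 7)))) := by
  classical
  have hA := hS.apol.symm
  have hA' : ∀ x y, S.A x y → x ≠ y := fun x y h => (hS.apol.lt _ _ h).2.2
  have hfib : ∀ p : ℕ × ℕ, ∃ f : W → Fin (max (4 * g) 7), Set.InjOn f (({w | S.c w = p.1 ∧ dep w / 2 = p.2} : Finset W) : Set W) := by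
    rintro ⟨h, l⟩
    apply exists_inj_of_card _ (by omega)
    by_cases hh : h = 0
    · have := fib_card hpar Zl l {w | S.c w = h ∧ dep w / 2 = l} (by
        intro w hw
        simp only [Finset.mem_filter, Finset.mem_univ, true_and] at hw
        exact ⟨hw.2, hS.zero w (hU w) (hw.1.trans hh)⟩)
      refine this.trans ?_
      omega
    · obtain ⟨T, hT1, hT2⟩ := hS.parts h hh
      have := fib_card hpar T l {w | S.c w = h ∧ dep w / 2 = l} (by
        intro w hw
        simp only [Finset.mem_filter, Finset.mem_univ, true_and] at hw
        exact ⟨hw.2, hT2 w (hU w) hw.1⟩)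
      refine this.trans ?_
      omega
  choose f hf using hfib
  let N := ∑ w, dep w + 1
  have hN : ∀ w, dep w / 2 < N := by
    intro w
    have : dep w ≤ ∑ w, dep w := Finset.single_le_sum (f := dep) (by simp) (Finset.mem_univ w)
    have : dep w / 2 ≤ dep w := Nat.div_le_self _ _
    omega
  refine ⟨Fin S.n, HG S.n S.A hA hA', N, hS.apol.planar hA hA', hS.apol.treewidth hA hA', ?_⟩
  let F : V → (Fin S.n × Fin N) × Fin (max (4 * g) 7) := fun v => ((⟨S.c (ι v), hS.clt _⟩, ⟨dep (ι v) / 2, hN _⟩), f (S.c (ι v), dep (ι v) / 2) (ι v))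
  have hF : Function.Injective F := by
    intro u v huv
    simp only [F, Prod.mk.injEq, Fin.mk.injEq] at huv
    obtain ⟨⟨h1, h2⟩, h3⟩ := huv
    rw [h1, h2] at h3
    apply hι
    exact hf _ (by simp [h1, h2]) (by simp) h3
  refine ⟨⟨F, ?_⟩, hF⟩
  intro u v huv
  obtain ⟨⟨-, -, hok⟩, hd⟩ := hG u v huv
  have hd' := (hG v u huv.symm).2
  refine ⟨fun e => huv.ne (hF e), ?_, ?_⟩
  · by_cases h1 : (F u).1 = (F v).1
    · exact Or.inl h1
    · refine Or.inr ⟨h1, ?_, ?_⟩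
      · rcases hok with h | h
        · left; exact Fin.ext h
        · right; exact h
      · by_cases h2 : (F u).1.2 = (F v).1.2
        · exact Or.inl h2
        · right
          rw [SimpleGraph.pathGraph_adj]
          have h2 : dep (ι u) / 2 ≠ dep (ι v) / 2 := fun e => h2 (Fin.ext e)
          show dep (ι u) / 2 + 1 = dep (ι v) / 2 ∨ dep (ι v) / 2 + 1 = dep (ι u) / 2
          omega
  · by_cases h : (F u).2 = (F v).2
    · exact Or.inl h
    · exact Or.inr h


section Euler
variable {W E : Type}

theorem Wk.end_mem {l : List (W × Option E × W)} {u : W} (h : Wk u l u) {s : W × Option E × W} (hs : s ∈ l) : s.2.2 ∈ srcs l := by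
  have h1 := h.tgts
  have h2 : s.2.2 ∈ u :: l.map (·.2.2) := List.mem_cons_of_mem _ (List.mem_map.2 ⟨s, hs, rfl⟩)
  rw [h1] at h2
  rcases List.mem_append.1 h2 with h3 | h3
  · exact h3
  · rw [List.mem_singleton.1 h3]
    rcases l with _ | ⟨t, l⟩
    · simp at hs
    · simp [srcs, h.1]

theorem Wk.rot_to {l : List (W × Option E × W)} {u w : W} (h : Wk u l u) (hw : w ∈ srcs l) :
    ∃ l', Wk w l' w ∧ l'.Perm l := by
  obtain ⟨s, hs, rfl⟩ := List.mem_map.1 hw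
  obtain ⟨A, B, rfl⟩ := perm_mid hs
  obtain ⟨m, h1, h2⟩ := Wk.app.1 h
  have : m = s.1 := h2.1.symm
  subst this
  exact ⟨(s :: B) ++ A, Wk.app.2 ⟨u, h2, h1⟩, List.perm_append_comm⟩

theorem cnt_perm {l l' : List (W × Option E × W)} (h : l.Perm l') (e : E) : cnt l e = cnt l' e := by
  classical
  exact (h.map _).count_eq _

theorem hphi_ind {p : Sym2 W} {v : W} [DecidableEq W] (h : hphi (fun w => if w = v then 1 else 0) p ≠ 0) : ∃ u, p = s(v, u) := by
  induction p with
  | _ a b =>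
    simp only [hphi, Sym2.lift_mk] at h
    by_cases ha : a = v
    · exact ⟨b, by rw [ha]⟩
    · by_cases hb : b = v
      · exact ⟨a, by rw [hb, Sym2.eq_swap]⟩
      · simp [ha, hb] at h

open Classical in
theorem euler_circuit [Fintype E] (en : E → Sym2 W) (S : Finset E) (hS : S.Nonempty)
    (hev : ∀ φ : W → ZMod 2, ∑ e ∈ S, hphi φ (en e) = 0)
    (hconn : ∀ P : E → Prop, (∀ e ∈ S, ∀ e' ∈ S, ∀ w, w ∈ en e → w ∈ en e' → P e → P e') → ∀ e ∈ S, ∀ e' ∈ S, P e → P e') :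
    ∃ u l, Wk u l u ∧ (∀ s ∈ l, gd en s ∧ gd0 s) ∧ ∀ e, cnt l e = if e ∈ S then 1 else 0 := by
  let T : ℕ → Prop := fun n => ∃ u v l, Wk u l v ∧ (∀ s ∈ l, gd en s ∧ s.2.1 ≠ none) ∧ (∀ e, cnt l e ≤ if e ∈ S then 1 else 0) ∧ l.length = n
  have hlen : ∀ l : List (W × Option E × W), (∀ s ∈ l, s.2.1 ≠ none) → l.length = ∑ e, cnt l e := by
    intro l
    induction l with
    | nil => intro _; simp [cnt_nil]
    | cons s l ih =>
      intro h
      have := ih (fun t ht => h t (by simp [ht]))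
      simp only [cnt_cons, Finset.sum_add_distrib, ← this, List.length_cons]
      have hs := h s (by simp)
      obtain ⟨e, he⟩ := Option.ne_none_iff_exists'.1 hs
      simp [he]
  have hb : ∀ n, T n → n ≤ S.card := by
    rintro n ⟨u, v, l, h1, h2, h3, rfl⟩
    rw [hlen l fun s hs => (h2 s hs).2]
    refine (Finset.sum_le_sum fun e _ => h3 e).trans ?_
    simp
  obtain ⟨e0, he0⟩ := hS
  have h0 : T 0 := by
    obtain ⟨w, -⟩ : ∃ w, w ∈ en e0 := by
      induction en e0 with | _ a b => exact ⟨a, by simp⟩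
    exact ⟨w, w, [], rfl, by simp, by simp [cnt_nil], rfl⟩
  obtain ⟨n, hn, hmax⟩ : ∃ n, T n ∧ ¬ T (n + 1) := by
    by_contra hc
    push Not at hc
    have : ∀ n, T n := fun n => Nat.rec h0 (fun n ih => hc n ih) n
    have := hb _ (this (S.card + 1))
    omega
  obtain ⟨u, v, l, h1, h2, h3, h4⟩ := hn
  have hext : ∀ u v l', Wk u l' v → l'.Perm l → ∀ e ∈ S, cnt l e = 0 → v ∉ en e := by
    intro u v l' hw hp e heS he hv
    obtain ⟨w, hw'⟩ := Sym2.mem_iff_exists.1 hv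
    apply hmax
    refine ⟨u, w, l' ++ [(v, some e, w)], Wk.app.2 ⟨v, hw, rfl, rfl⟩, ?_, ?_, ?_⟩
    · intro s hs
      rcases List.mem_append.1 hs with hs | hs
      · exact h2 s (hp.mem_iff.1 hs)
      · rw [List.mem_singleton.1 hs]
        refine ⟨fun e' he' => ?_, by simp⟩
        simp only [Option.some.injEq] at he'
        rw [← he', hw']
    · intro e'
      rw [cnt_app, cnt_perm hp, cnt_cons, cnt_nil]
      have := h3 e'
      by_cases hee : e = e'
      · subst hee; simp [he, heS]
      · simpa [hee] using this
    · simp [hp.length_eq, h4]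
  have huv : u = v := by
    by_contra hne
    have hp := h1.pot (en := en) (fun w => if w = v then 1 else 0) (fun s hs => ⟨(h2 s hs).1, fun h => absurd h (h2 s hs).2⟩)
    have he := hev (fun w => if w = v then 1 else 0)
    have : ∑ e ∈ S, hphi (fun w => if w = v then 1 else 0) (en e) ≠ ∑ e ∈ S, (cnt l e : ZMod 2) * hphi (fun w => if w = v then 1 else 0) (en e) := by
      rw [he]
      rw [← Finset.sum_subset (Finset.subset_univ S)] at hp
      · rw [hp]; simp [hne]
      · intro e _ heS
        have := h3 e
        simp only [heS, if_false] at this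
        simp [Nat.le_zero.1 this]
    have this' : ∃ e ∈ S, hphi (fun w => if w = v then 1 else 0) (en e) ≠ (cnt l e : ZMod 2) * hphi (fun w => if w = v then 1 else 0) (en e) := by
      by_contra hc
      push Not at hc
      exact this (Finset.sum_congr rfl hc)
    obtain ⟨e, heS, hne'⟩ := this'
    have h5 := h3 e
    simp only [heS, if_true] at h5
    have h6 : cnt l e = 0 := by
      by_contra h6
      have : cnt l e = 1 := by omega
      rw [this] at hne'
      simp at hne'
    rw [h6] at hne'
    obtain ⟨w, hw⟩ := hphi_ind (p := en e) (v := v) (by simpa using hne')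
    exact hext u v l h1 (List.Perm.refl _) e heS h6 (by rw [hw]; simp)
  subst huv
  have hl : l ≠ [] := by
    rintro rfl
    apply hmax
    have : n = 0 := by simpa using h4.symm
    subst this
    rcases he : en e0 with ⟨a, b⟩
    refine ⟨a, b, [(a, some e0, b)], ⟨rfl, rfl⟩, ?_, ?_, rfl⟩
    · intro s hs
      rw [List.mem_singleton.1 hs]
      refine ⟨fun e' he' => ?_, by simp⟩
      simp only [Option.some.injEq] at he'
      rw [← he', he]
    · intro e'
      rw [cnt_cons, cnt_nil]
      by_cases hee : e0 = e'
      · subst hee; simp [he0]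
      · simp [hee]
  refine ⟨u, l, h1, fun s hs => ⟨(h2 s hs).1, fun h => absurd h (h2 s hs).2⟩, ?_⟩
  obtain ⟨s0, hs0⟩ := List.exists_mem_of_ne_nil _ hl
  obtain ⟨e1, he1⟩ := Option.ne_none_iff_exists'.1 (h2 s0 hs0).2
  have hpos1 : 0 < cnt l e1 := cnt_pos.2 (List.mem_map.2 ⟨s0, hs0, he1⟩)
  have hmem : ∀ e, 0 < cnt l e → e ∈ S := by
    intro e he
    by_contra heS
    have := h3 e
    simp only [heS, if_false] at this
    omega
  have key := hconn (fun e => 0 < cnt l e) (by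
    intro e heS e' heS' w hw hw' hpos
    by_contra hz
    obtain ⟨s, hs, hse⟩ := List.mem_map.1 (cnt_pos.1 hpos)
    have hen := (h2 s hs).1 e hse
    rw [hen] at hw
    have hws : w ∈ srcs l := by
      rcases Sym2.mem_iff.1 hw with rfl | rfl
      · exact List.mem_map.2 ⟨s, hs, rfl⟩
      · exact h1.end_mem hs
    obtain ⟨l', hl', hp⟩ := h1.rot_to hws
    exact hext w w l' hl' hp e' heS' (by omega) hw')
  intro e
  have := h3 e
  by_cases heS : e ∈ S
  · have h6 := key e1 (hmem e1 hpos1) e heS hpos1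
    simp only [heS, if_true] at this ⊢
    omega
  · simp only [heS, if_false] at this ⊢
    omega

def Sg : W → List (W × List (W × Option E × W)) → W → Prop
  | u, [], v => u = v
  | u, s :: l, v => s.1 = u ∧ ∃ m, Wk u s.2 m ∧ Sg m l v

theorem Sg.ins {S : List (W × List (W × Option E × W))} {v t : W} : ∀ {u : W}, Sg u S v → t ∈ srcs (S.flatMap (·.2)) →
    ∃ S', Sg u S' v ∧ S'.length = S.length + 1 ∧ S'.flatMap (·.2) = S.flatMap (·.2) ∧ (∀ x ∈ S.map (·.1), x ∈ S'.map (·.1)) ∧ t ∈ S'.map (·.1) := by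
  induction S with
  | nil => intro u _ h; simp [srcs] at h
  | cons s S ih =>
    intro u h ht
    obtain ⟨h1, m, h2, h3⟩ := h
    rw [List.flatMap_cons, srcs, List.map_append] at ht
    rcases List.mem_append.1 ht with ht | ht
    · obtain ⟨r, hr, rfl⟩ := List.mem_map.1 ht
      obtain ⟨A, B, hAB⟩ := perm_mid hr
      rw [hAB] at h2
      obtain ⟨m', h4, h5⟩ := Wk.app.1 h2
      have : m' = r.1 := h5.1.symm
      subst this
      refine ⟨(s.1, A) :: (r.1, r :: B) :: S, ⟨h1, r.1, h4, rfl, m, h5, h3⟩, by simp, by simp [hAB], ?_, by simp⟩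
      intro x hx
      simp only [List.map_cons, List.mem_cons] at hx ⊢
      tauto
    · obtain ⟨S', a1, a2, a3, a4, a5⟩ := ih h3 ht
      refine ⟨s :: S', ⟨h1, m, h2, a1⟩, by simp [a2], by simp [a3], ?_, ?_⟩
      · intro x hx
        simp only [List.map_cons, List.mem_cons] at hx ⊢
        exact hx.imp_right (a4 x)
      · simp only [List.map_cons, List.mem_cons]; exact Or.inr a5

theorem four_seg {l : List (W × Option E × W)} {u : W} (h : Wk u l u) (t : Fin 4 → W) (ht : ∀ k, t k ∈ srcs l) :
    ∃ (n : Fin 4 → W) (sg : Fin 4 → List (W × Option E × W)), (∀ k, Wk (n k) (sg k) (n (k + 1))) ∧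
      (∀ e, ∑ k, cnt (sg k) e = cnt l e) ∧ (∀ k, ∀ s ∈ sg k, s ∈ l) ∧ ∀ k, ∃ j, n j = t k := by
  obtain ⟨l', h', hp⟩ := h.rot_to (ht 0)
  have ht' : ∀ k, t k ∈ srcs l' := fun k => (hp.map (fun s => s.1)).mem_iff.2 (ht k)
  have g0 : Sg (t 0) [(t 0, l')] (t 0) := ⟨rfl, t 0, h', rfl⟩
  obtain ⟨S1, a1, a2, a3, a4, a5⟩ := g0.ins (t := t 1) (by simpa using ht' 1)
  obtain ⟨S2, b1, b2, b3, b4, b5⟩ := a1.ins (t := t 2) (by rw [a3]; simpa using ht' 2)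
  obtain ⟨S3, c1, c2, c3, c4, c5⟩ := b1.ins (t := t 3) (by rw [b3, a3]; simpa using ht' 3)
  rw [b3, a3] at c3
  have hm : ∀ k, t k ∈ S3.map (·.1) := by
    intro k
    fin_cases k
    · exact c4 _ (b4 _ (a4 _ (by simp)))
    · exact c4 _ (b4 _ a5)
    · exact c4 _ b5
    · exact c5
  rw [b2, a2] at c2
  clear a1 a2 a3 a4 a5 b1 b2 b3 b4 b5 c4 c5 g0
  rcases S3 with _ | ⟨⟨n0, s0⟩, _ | ⟨⟨n1, s1⟩, _ | ⟨⟨n2, s2⟩, _ | ⟨⟨n3, s3⟩, _ | ⟨_, _⟩⟩⟩⟩⟩ <;> simp at c2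
  simp only [List.flatMap_cons, List.flatMap_nil, List.append_nil] at c3
  obtain ⟨e0, m1, w0, e1, m2, w1, e2, m3, w2, e3, m4, w3, e4⟩ := c1
  simp only at e0 e1 e2 e3 e4 w0 w1 w2 w3
  have e4 : m4 = t 0 := e4
  subst e1 e2 e3 e4
  rw [← e0] at w0 w3
  refine ⟨![n0, n1, n2, n3], ![s0, s1, s2, s3], ?_, ?_, ?_, ?_⟩
  · intro k; fin_cases k
    · exact w0
    · exact w1
    · exact w2
    · exact w3
  · intro e
    rw [← cnt_perm hp, ← c3]
    simp [Fin.sum_univ_four, cnt_app]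
    omega
  · intro k s hs
    rw [← hp.mem_iff, ← c3]
    simp only [List.mem_append]
    fin_cases k
    · exact Or.inl hs
    · exact Or.inr (Or.inl hs)
    · exact Or.inr (Or.inr (Or.inl hs))
    · exact Or.inr (Or.inr (Or.inr hs))
  · intro k
    have := hm k
    simp only [List.map_cons, List.map_nil, List.mem_cons, List.not_mem_nil, or_false] at this
    rcases this with h | h | h | h
    · exact ⟨0, h.symm⟩
    · exact ⟨1, h.symm⟩
    · exact ⟨2, h.symm⟩
    · exact ⟨3, h.symm⟩

end Euler


section Posn
variable {V E F : Type} {M : Multigraph V E}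

abbrev Pos (emb : M.Embedding F) : Type := Σ f : F, Fin (emb.boundary f).len

variable (emb : M.Embedding F)

def pos (f : F) (i : ℕ) : Pos emb := ⟨f, ⟨i % (emb.boundary f).len, Nat.mod_lt _ (emb.boundary f).len_pos⟩⟩
def vt (p : Pos emb) : V := (emb.boundary p.1).vtx p.2
def ed (p : Pos emb) : E := (emb.boundary p.1).edge p.2
def nx (p : Pos emb) : Pos emb := pos emb p.1 (p.2 + 1)

theorem per_mod {α : Type} {h : ℕ → α} {n : ℕ} (hp : ∀ i, h (i + n) = h i) (i : ℕ) : h (i % n) = h i := by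
  have : Function.Periodic h n := hp
  exact this.map_mod_nat i

theorem vt_pos (f : F) (i : ℕ) : vt emb (pos emb f i) = (emb.boundary f).vtx i := per_mod (emb.boundary f).vtx_per i
theorem ed_pos (f : F) (i : ℕ) : ed emb (pos emb f i) = (emb.boundary f).edge i := per_mod (emb.boundary f).edge_per i
theorem nx_pos (f : F) (i : ℕ) : nx emb (pos emb f i) = pos emb f (i + 1) := by
  simp [nx, pos]
theorem pos_self (p : Pos emb) : pos emb p.1 p.2 = p := by
  obtain ⟨f, i, hi⟩ := p
  simp only [pos, Nat.mod_eq_of_lt hi]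
theorem ends_ed (p : Pos emb) : M.ends (ed emb p) = s(vt emb p, vt emb (nx emb p)) := by
  rw [nx, vt_pos]; exact (emb.boundary p.1).compat _
theorem nx_fst (p : Pos emb) : (nx emb p).1 = p.1 := rfl

theorem nx_surj : Function.Surjective (nx emb) := by
  intro p
  have hl := (emb.boundary p.1).len_pos
  refine ⟨pos emb p.1 (p.2 + (emb.boundary p.1).len - 1), ?_⟩
  rw [nx_pos, Nat.sub_add_cancel (by omega)]
  conv_rhs => rw [← pos_self emb p]
  simp [pos]

theorem link (v : V) (P : Pos emb → Prop)
    (h : ∀ q q' p p', ed emb q = ed emb q' → (p = q ∨ p = nx emb q) → (p' = q' ∨ p' = nx emb q') → vt emb p = v → vt emb p' = v → P p → P p') :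
    ∀ p p', vt emb p = v → vt emb p' = v → P p → P p' := by
  intro p p' hp hp' hP
  have hl := emb.link_conn v (p.1, p.2) (p'.1, p'.2) ⟨p.2.2, hp⟩ ⟨p'.2.2, hp'⟩
  have hE : ∀ (c q : F × ℕ), c.2 < (emb.boundary c.1).len → q.2 < (emb.boundary q.1).len → Multigraph.EndOf emb.boundary c q →
      pos emb c.1 c.2 = pos emb q.1 q.2 ∨ pos emb c.1 c.2 = nx emb (pos emb q.1 q.2) := by
    rintro ⟨f, i⟩ ⟨f', j⟩ _ _ ⟨h1, h2⟩
    simp only at h1 h2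
    subst h1
    rw [nx_pos]
    rcases h2 with h2 | h2
    · left; rw [h2]
    · right; simp [pos, h2]
  have hk : ∀ c c' : F × ℕ, Multigraph.CornerLinked emb.boundary v c c' → (P (pos emb c.1 c.2) ↔ P (pos emb c'.1 c'.2)) := by
    rintro c c' ⟨hc, hc', e, q, q', -, ho, ho', he, he'⟩
    have e1 : ed emb (pos emb q.1 q.2) = e := by rw [ed_pos]; exact ho.2
    have e2 : ed emb (pos emb q'.1 q'.2) = e := by rw [ed_pos]; exact ho'.2
    have v1 : vt emb (pos emb c.1 c.2) = v := by rw [vt_pos]; exact hc.2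
    have v2 : vt emb (pos emb c'.1 c'.2) = v := by rw [vt_pos]; exact hc'.2
    exact ⟨h _ _ _ _ (e1.trans e2.symm) (hE _ _ hc.1 ho.1 he) (hE _ _ hc'.1 ho'.1 he') v1 v2,
      h _ _ _ _ (e2.trans e1.symm) (hE _ _ hc'.1 ho'.1 he') (hE _ _ hc.1 ho.1 he) v2 v1⟩
  have : P (pos emb p.1 p.2) ↔ P (pos emb p'.1 p'.2) := by
    have gen : ∀ c c' : F × ℕ, Relation.EqvGen (Multigraph.CornerLinked emb.boundary v) c c' → (P (pos emb c.1 c.2) ↔ P (pos emb c'.1 c'.2)) := by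
      intro c c' hcc
      induction hcc with
      | rel _ _ h => exact hk _ _ h
      | refl _ => exact Iff.rfl
      | symm _ _ _ ih => exact ih.symm
      | trans _ _ _ _ _ ih1 ih2 => exact ih1.trans ih2
    exact gen _ _ hl
  rw [pos_self, pos_self] at this
  exact this.1 hP

variable [Fintype F]

theorem nx_bij : Function.Bijective (nx emb) := Finite.surjective_iff_bijective.1 (nx_surj emb)

theorem sum_nx {A : Type} [AddCommMonoid A] (h : Pos emb → A) : ∑ p, h (nx emb p) = ∑ p, h p :=
  (nx_bij emb).sum_comp h

open Classical in
theorem occ_card (e : E) : (Finset.univ.filter fun p : Pos emb => ed emb p = e).card = 2 := by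
  rw [← emb.edge_twice e, ← Set.ncard_coe_finset]
  refine Set.ncard_congr (fun p _ => (p.1, p.2.1)) ?_ ?_ ?_
  · rintro p hp
    simp only [Finset.coe_filter, Finset.mem_univ, true_and, Set.mem_setOf_eq] at hp
    exact ⟨p.2.2, hp⟩
  · rintro ⟨f, i, hi⟩ ⟨f', i', hi'⟩ _ _ h
    simp only [Prod.mk.injEq] at h
    obtain ⟨rfl, rfl⟩ := h
    rfl
  · rintro ⟨f, i⟩ ⟨h1, h2⟩
    refine ⟨⟨f, i, h1⟩, ?_, rfl⟩
    simp only [Finset.coe_filter, Finset.mem_univ, true_and, Set.mem_setOf_eq]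
    exact h2

theorem occ_ex (e : E) : ∃ p : Pos emb, ed emb p = e := by
  classical
  have h := occ_card emb e
  obtain ⟨p, hp⟩ : (Finset.univ.filter fun p : Pos emb => ed emb p = e).Nonempty := by
    rw [← Finset.card_pos]; omega
  exact ⟨p, by simpa using hp⟩

theorem sum_ed [Fintype E] {A : Type} [AddCommMonoid A] (h : E → A) : ∑ p, h (ed emb p) = ∑ e, 2 • h e := by
  classical
  rw [← Finset.sum_fiberwise Finset.univ (ed emb)]
  refine Finset.sum_congr rfl fun e _ => ?_
  rw [Finset.sum_congr rfl (g := fun _ => h e) (by intro p hp; rw [(Finset.mem_filter.1 hp).2]), Finset.sum_const, occ_card]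

theorem corner_ex [Nonempty E] (v : V) : ∃ p : Pos emb, vt emb p = v := by
  obtain ⟨e, he⟩ : ∃ e, v ∈ M.ends e := by
    by_cases hs : ∃ w, w ≠ v
    · obtain ⟨w, hw⟩ := hs
      obtain ⟨q⟩ := emb.conn.preconnected v w
      rcases q with _ | ⟨hq, q⟩
      · exact absurd rfl hw
      · obtain ⟨-, e, he⟩ := hq
        exact ⟨e, by rw [he]; simp⟩
    · push Not at hs
      obtain ⟨e⟩ := ‹Nonempty E›
      refine ⟨e, ?_⟩
      rcases he : M.ends e with ⟨a, b⟩
      rw [← hs a]; exact Sym2.mem_mk_left _ _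
  obtain ⟨p, rfl⟩ := occ_ex emb e
  rw [ends_ed, Sym2.mem_iff] at he
  rcases he with rfl | rfl
  · exact ⟨p, rfl⟩
  · exact ⟨_, rfl⟩

end Posn


section Cons
variable {V E F : Type} {M : Multigraph V E} (emb : M.Embedding F) (C : Set V)

abbrev NW (M : Multigraph V E) (C : Set V) : Type := {v // v ∉ C} ⊕ {e : E // ∀ v ∈ M.ends e, v ∈ C}
abbrev NE : Type := {e : E // ∀ v ∈ M.ends e, v ∉ C} ⊕ {q : Pos emb // vt emb (nx emb q) ∈ C} ⊕ (C × Fin 4)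
abbrev NF (F : Type) (C : Set V) : Type := F ⊕ (C × Fin 4) ⊕ C

open Classical in
noncomputable def lab (M : Multigraph V E) (e : E) : NW M C :=
  if h : ∃ v ∈ M.ends e, v ∉ C then Sum.inl ⟨h.choose, h.choose_spec.2⟩ else Sum.inr ⟨e, by push Not at h; exact h⟩

open Classical in
noncomputable def ss (p : Pos emb) : NW M C := if h : vt emb p ∉ C then Sum.inl ⟨vt emb p, h⟩ else lab C M (ed emb p)
open Classical in
noncomputable def tt (p : Pos emb) : NW M C := if h : vt emb (nx emb p) ∉ C then Sum.inl ⟨vt emb (nx emb p), h⟩ else lab C M (ed emb p)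

variable {C}

theorem lab_inl {e : E} {x v : V} (hx : x ∈ C) (hv : v ∉ C) (he : M.ends e = s(x, v)) : lab C M e = Sum.inl ⟨v, hv⟩ := by
  have h : ∃ v ∈ M.ends e, v ∉ C := ⟨v, by simp [he], hv⟩
  rw [lab, dif_pos h]
  congr 2
  have h2 := h.choose_spec
  have h4 : h.choose ∈ s(x, v) := by rw [← he]; exact h2.1
  rcases Sym2.mem_iff.1 h4 with h3 | h3
  · exact absurd hx (h3 ▸ h2.2)
  · exact h3

theorem ss_C {p : Pos emb} (h : vt emb p ∈ C) : ss emb C p = lab C M (ed emb p) := by simp [ss, h]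
theorem tt_C {p : Pos emb} (h : vt emb (nx emb p) ∈ C) : tt emb C p = lab C M (ed emb p) := by simp [tt, h]
theorem ss_N {p : Pos emb} (h : vt emb p ∉ C) : ss emb C p = Sum.inl ⟨_, h⟩ := by simp [ss, h]
theorem tt_N {p : Pos emb} (h : vt emb (nx emb p) ∉ C) : tt emb C p = Sum.inl ⟨_, h⟩ := by simp [tt, h]

theorem ss_eq_tt {p : Pos emb} (h : ¬ ∀ v ∈ M.ends (ed emb p), v ∉ C) : ss emb C p = tt emb C p := by
  rw [ends_ed] at h
  by_cases h1 : vt emb p ∈ C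
  · rw [ss_C emb h1]
    by_cases h2 : vt emb (nx emb p) ∈ C
    · rw [tt_C emb h2]
    · rw [tt_N emb h2, lab_inl h1 h2 (ends_ed emb p)]
  · by_cases h2 : vt emb (nx emb p) ∈ C
    · rw [tt_C emb h2, ss_N emb h1, lab_inl h2 h1 ((ends_ed emb p).trans Sym2.eq_swap)]
    · exact absurd (by simp [h1, h2]) h

variable [Fintype F]

noncomputable def nen (n : C → Fin 4 → NW M C) : NE emb C → Sym2 (NW M C)
  | Sum.inl e => s(ss emb C (occ_ex emb e.1).choose, tt emb C (occ_ex emb e.1).choose)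
  | Sum.inr (Sum.inl q) => s(tt emb C q.1, ss emb C (nx emb q.1))
  | Sum.inr (Sum.inr (x, k)) => s(n x k, n x (k + 1))

theorem nen_old (n : C → Fin 4 → NW M C) {p : Pos emb} (h : ∀ v ∈ M.ends (ed emb p), v ∉ C) :
    nen emb n (Sum.inl ⟨ed emb p, h⟩) = s(ss emb C p, tt emb C p) := by
  have h1 := (occ_ex emb (ed emb p)).choose_spec
  simp only [nen]
  generalize (occ_ex emb (ed emb p)).choose = q at h1
  have h2 := ends_ed emb q
  rw [h1, ends_ed emb p] at h2
  rw [ends_ed] at h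
  have a1 : vt emb p ∉ C := h _ (by simp)
  have a2 : vt emb (nx emb p) ∉ C := h _ (by simp)
  have b1 : vt emb q ∉ C := h _ (by rw [h2]; simp)
  have b2 : vt emb (nx emb q) ∉ C := h _ (by rw [h2]; simp)
  rw [ss_N emb a1, ss_N emb b1, tt_N emb a2, tt_N emb b2]
  rcases Sym2.eq_iff.1 h2 with ⟨h3, h4⟩ | ⟨h3, h4⟩
  · simp [h3, h4]
  · simp [h3, h4]

open Classical in
noncomputable def st1 (p : Pos emb) : NW M C × Option (NE emb C) × NW M C :=
  (ss emb C p, if h : ∀ v ∈ M.ends (ed emb p), v ∉ C then some (Sum.inl ⟨ed emb p, h⟩) else none, tt emb C p)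
open Classical in
noncomputable def st2 (p : Pos emb) : NW M C × Option (NE emb C) × NW M C :=
  (tt emb C p, if h : vt emb (nx emb p) ∈ C then some (Sum.inr (Sum.inl ⟨p, h⟩)) else none, ss emb C (nx emb p))

noncomputable def oldW (C : Set V) (f : F) (m : ℕ) : List (NW M C × Option (NE emb C) × NW M C) :=
  (List.range m).flatMap fun i => [st1 emb (pos emb f i), st2 emb (pos emb f i)]

theorem oldW_succ (f : F) (m : ℕ) : oldW emb C f (m + 1) = oldW emb C f m ++ [st1 emb (pos emb f m), st2 emb (pos emb f m)] := by
  simp [oldW, List.range_succ, List.flatMap_append]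

theorem oldW_wk (f : F) (m : ℕ) : Wk (ss emb C (pos emb f 0)) (oldW emb C f m) (ss emb C (pos emb f m)) := by
  induction m with
  | zero => exact rfl
  | succ m ih =>
    rw [oldW_succ, Wk.app]
    refine ⟨_, ih, rfl, rfl, ?_⟩
    show ss emb C (nx emb _) = _
    rw [nx_pos]

theorem oldW_gd (n : C → Fin 4 → NW M C) (f : F) (m : ℕ) : ∀ s ∈ oldW emb C f m, gd (nen emb n) s ∧ gd0 s := by
  intro s hs
  simp only [oldW, List.mem_flatMap, List.mem_cons, List.not_mem_nil, or_false] at hs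
  obtain ⟨i, -, rfl | rfl⟩ := hs
  · by_cases h : ∀ v ∈ M.ends (ed emb (pos emb f i)), v ∉ C
    · refine ⟨fun e he => ?_, fun h0 => ?_⟩
      · simp only [st1, dif_pos h, Option.some.injEq] at he ⊢
        rw [← he, nen_old]
      · simp only [st1, dif_pos h] at h0
        simp at h0
    · refine ⟨fun e he => ?_, fun h0 => ?_⟩
      · simp only [st1, dif_neg h] at he
        simp at he
      · exact ss_eq_tt emb h
  · by_cases h : vt emb (nx emb (pos emb f i)) ∈ C
    · refine ⟨fun e he => ?_, fun h0 => ?_⟩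
      · simp only [st2, dif_pos h, Option.some.injEq] at he ⊢
        rw [← he]; rfl
      · simp only [st2, dif_pos h] at h0
        simp at h0
    · refine ⟨fun e he => ?_, fun h0 => ?_⟩
      · simp only [st2, dif_neg h] at he
        simp at he
      · simp only [st2, tt_N emb h, ss_N emb h]

theorem mem_oldW (p : Pos emb) : st1 emb p ∈ oldW emb C p.1 (emb.boundary p.1).len ∧ st2 emb p ∈ oldW emb C p.1 (emb.boundary p.1).len := by
  have : pos emb p.1 p.2 = p := pos_self emb p
  constructor <;> refine List.mem_flatMap.2 ⟨p.2, by simp, ?_⟩ <;> rw [this] <;> simp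

open Classical in
theorem oldW_cnt (e : NE emb C) : ∑ f, cnt (oldW emb C f (emb.boundary f).len) e =
    ∑ p : Pos emb, ((if (st1 (C := C) emb p).2.1 = some e then 1 else 0) + (if (st2 (C := C) emb p).2.1 = some e then 1 else 0)) := by
  rw [Fintype.sum_sigma]
  refine Finset.sum_congr rfl fun f _ => ?_
  have : ∀ m, cnt (oldW emb C f m) e = ∑ i ∈ Finset.range m, ((if (st1 (C := C) emb (pos emb f i)).2.1 = some e then 1 else 0) + (if (st2 (C := C) emb (pos emb f i)).2.1 = some e then 1 else 0)) := by
    intro m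
    induction m with
    | zero => simp [oldW, cnt_nil]
    | succ m ih => rw [oldW_succ, cnt_app, ih, Finset.sum_range_succ, cnt_cons, cnt_cons, cnt_nil]; split_ifs <;> omega
  rw [this, ← Fin.sum_univ_eq_sum_range (fun i => (if (st1 (C := C) emb (pos emb f i)).2.1 = some e then 1 else 0) + (if (st2 (C := C) emb (pos emb f i)).2.1 = some e then 1 else 0))]
  refine Finset.sum_congr rfl fun i _ => ?_
  have h := pos_self emb ⟨f, i⟩
  simp only at h
  rw [h]

open Classical in
theorem oldW_cnt_inl (e) : ∑ f, cnt (oldW emb C f (emb.boundary f).len) (Sum.inl e) = 2 := by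
  rw [oldW_cnt, ← occ_card emb e.1, Finset.card_filter]
  refine Finset.sum_congr rfl fun p _ => ?_
  have h2 : (st2 (C := C) emb p).2.1 ≠ some (Sum.inl e) := by
    unfold st2; split_ifs <;> simp
  rw [if_neg h2, add_zero]
  have : (st1 (C := C) emb p).2.1 = some (Sum.inl e) ↔ ed emb p = e.1 := by
    by_cases h : ∀ v ∈ M.ends (ed emb p), v ∉ C
    · simp only [st1, dif_pos h, Option.some.injEq, Sum.inl.injEq, Subtype.ext_iff]
    · simp only [st1, dif_neg h]
      constructor
      · intro h; simp at h
      · intro h'; exact absurd (h' ▸ e.2) h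
  simp only [this]

open Classical in
theorem oldW_cnt_cor (q) : ∑ f, cnt (oldW emb C f (emb.boundary f).len) (Sum.inr (Sum.inl q)) = 1 := by
  rw [oldW_cnt, Finset.sum_eq_single q.1]
  · have h1 : (st1 (C := C) emb q.1).2.1 ≠ some (Sum.inr (Sum.inl q)) := by
      unfold st1; split_ifs <;> simp
    rw [if_neg h1, if_pos]
    simp [st2, q.2]
  · intro p _ hp
    have h1 : (st1 (C := C) emb p).2.1 ≠ some (Sum.inr (Sum.inl q)) := by
      unfold st1; split_ifs <;> simp
    have h2 : (st2 (C := C) emb p).2.1 ≠ some (Sum.inr (Sum.inl q)) := by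
      unfold st2; split_ifs
      · simp only [ne_eq, Option.some.injEq, Sum.inr.injEq, Sum.inl.injEq]
        rintro rfl; exact hp rfl
      · simp
    rw [if_neg h1, if_neg h2]; rfl
  · simp

theorem oldW_cnt_kap (f : F) (m : ℕ) (q) : cnt (oldW emb C f m) (Sum.inr (Sum.inr q)) = 0 := by
  by_contra h
  have := cnt_pos.1 (Nat.pos_of_ne_zero h)
  simp only [lbl, oldW, List.mem_map, List.mem_flatMap, List.mem_cons, List.not_mem_nil, or_false] at this
  obtain ⟨s, ⟨i, -, rfl | rfl⟩, hs⟩ := this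
  · unfold st1 at hs; split_ifs at hs <;> simp at hs
  · unfold st2 at hs; split_ifs at hs <;> simp at hs

end Cons


section Circ
variable {V E F : Type} {M : Multigraph V E} (emb : M.Embedding F) {C : Set V}

def isCor (x : C) : NE emb C → Prop
  | Sum.inl _ => False
  | Sum.inr (Sum.inl q) => vt emb (nx emb q.1) = x.1
  | Sum.inr (Sum.inr _) => False

variable [Fintype V] [Fintype E] [Fintype F]

open Classical in
theorem cor_even (n : C → Fin 4 → NW M C) (x : C) (φ : NW M C → ZMod 2) :
    ∑ e ∈ Finset.univ.filter (isCor emb x), hphi φ (nen emb n e) = 0 := by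
  rw [Finset.sum_filter, Fintype.sum_sum_type, Fintype.sum_sum_type]
  rw [Finset.sum_eq_zero (fun e _ => if_neg (fun h : isCor emb x (Sum.inl e) => h)), zero_add]
  rw [Finset.sum_eq_zero (s := Finset.univ (α := C × Fin 4)) (fun e _ => if_neg (fun h : isCor emb x (Sum.inr (Sum.inr e)) => h)), add_zero]
  have h1 : ∀ q : {q : Pos emb // vt emb (nx emb q) ∈ C}, (if isCor emb x (Sum.inr (Sum.inl q)) then hphi φ (nen emb n (Sum.inr (Sum.inl q))) else 0) =
      (fun q : Pos emb => if vt emb (nx emb q) = x.1 then φ (lab C M (ed emb q)) + φ (lab C M (ed emb (nx emb q))) else 0) q.1 := by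
    intro q
    have hi : isCor emb x (Sum.inr (Sum.inl q)) ↔ vt emb (nx emb q.1) = x.1 := Iff.rfl
    simp only [hi, nen, hphi, Sym2.lift_mk, tt_C emb q.2, ss_C emb q.2]
  rw [Finset.sum_congr rfl fun q _ => h1 q, ← Finset.sum_subtype (Finset.univ.filter fun q : Pos emb => vt emb (nx emb q) ∈ C) (by simp)
    (fun q : Pos emb => if vt emb (nx emb q) = x.1 then φ (lab C M (ed emb q)) + φ (lab C M (ed emb (nx emb q))) else 0)]
  rw [Finset.sum_subset (Finset.subset_univ _) (by
    intro q _ hq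
    rw [if_neg]
    intro h
    exact hq (by simp [h]))]
  have h2 : ∀ q : Pos emb, (if vt emb (nx emb q) = x.1 then φ (lab C M (ed emb q)) + φ (lab C M (ed emb (nx emb q))) else 0) =
      (if vt emb (nx emb q) = x.1 then φ (lab C M (ed emb q)) else 0) + (fun q => if vt emb q = x.1 then φ (lab C M (ed emb q)) else 0) (nx emb q) := by
    intro q
    by_cases h : vt emb (nx emb q) = x.1 <;> simp [h]
  rw [Finset.sum_congr rfl fun q _ => h2 q, Finset.sum_add_distrib, sum_nx emb (fun q : Pos emb => if vt emb q = x.1 then φ (lab C M (ed emb q)) else 0), ← Finset.sum_add_distrib]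
  have h3 : ∀ q : Pos emb, (if vt emb (nx emb q) = x.1 then φ (lab C M (ed emb q)) else 0) + (if vt emb q = x.1 then φ (lab C M (ed emb q)) else 0) =
      (fun e => φ (lab C M e) * hphi (fun v => if v = x.1 then 1 else 0) (M.ends e)) (ed emb q) := by
    intro q
    simp only [ends_ed, hphi, Sym2.lift_mk]
    split_ifs <;> simp [mul_add]
  rw [Finset.sum_congr rfl fun q _ => h3 q, sum_ed emb (fun e => φ (lab C M e) * hphi (fun v => if v = x.1 then 1 else 0) (M.ends e))]
  refine Finset.sum_eq_zero fun e _ => ?_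
  rw [two_nsmul, zmod2_self]

theorem cor_mem (n : C → Fin 4 → NW M C) {q r : Pos emb} (hq : vt emb (nx emb q) ∈ C) (h : nx emb q = r ∨ nx emb q = nx emb r) :
    lab C M (ed emb r) ∈ nen emb n (Sum.inr (Sum.inl ⟨q, hq⟩)) := by
  simp only [nen, tt_C emb hq, ss_C emb hq]
  rcases h with rfl | h
  · simp
  · rw [(nx_bij emb).1 h]; simp

open Classical in
theorem cor_conn (n : C → Fin 4 → NW M C) (x : C) (P : NE emb C → Prop)
    (hP : ∀ e ∈ Finset.univ.filter (isCor emb x), ∀ e' ∈ Finset.univ.filter (isCor emb x), ∀ w, w ∈ nen emb n e → w ∈ nen emb n e' → P e → P e') :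
    ∀ e ∈ Finset.univ.filter (isCor emb x), ∀ e' ∈ Finset.univ.filter (isCor emb x), P e → P e' := by
  intro e he e' he' hPe
  simp only [Finset.mem_filter, Finset.mem_univ, true_and] at he he' hP
  obtain ⟨q, hq⟩ : ∃ q, e = Sum.inr (Sum.inl q) := by
    rcases e with _ | q | _
    · exact he.elim
    · exact ⟨q, rfl⟩
    · exact he.elim
  obtain ⟨q', hq'⟩ : ∃ q, e' = Sum.inr (Sum.inl q) := by
    rcases e' with _ | q | _
    · exact he'.elim
    · exact ⟨q, rfl⟩
    · exact he'.elim
  subst hq hq'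
  have := link emb x.1 (fun p => ∀ q h, nx emb q = p → P (Sum.inr (Sum.inl ⟨q, h⟩))) (by
    intro r r' p p' hr hp hp' hv hv' hPp q' hq'C hq'
    obtain ⟨q, rfl⟩ := nx_surj emb p
    have hqC : vt emb (nx emb q) ∈ C := hv ▸ x.2
    refine hP (Sum.inr (Sum.inl ⟨q, hqC⟩)) hv (Sum.inr (Sum.inl ⟨q', hq'C⟩)) (by rw [← hq'] at hv'; exact hv') (lab C M (ed emb r)) (cor_mem emb n hqC hp) ?_ (hPp q hqC rfl)
    rw [hr]
    subst hq'
    exact cor_mem emb n hq'C hp') (nx emb q.1) (nx emb q'.1) he he' (by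
    intro q2 h2 h3
    have := (nx_bij emb).1 h3
    subst this
    exact hPe)
  exact this q'.1 q'.2 rfl

open Classical in
theorem circ [Nonempty E] (nb : C → Fin 4 → {v // v ∉ C}) (hnb : ∀ x k, ∃ e, M.ends e = s(x.1, (nb x k).1)) (x : C) :
    ∃ (n : Fin 4 → NW M C) (sg : Fin 4 → List (NW M C × Option (NE emb C) × NW M C)),
      (∀ k, Wk (n k) (sg k) (n (k + 1))) ∧ (∀ e, ∑ k, cnt (sg k) e = if isCor emb x e then 1 else 0) ∧
      (∀ n', ∀ k, ∀ s ∈ sg k, gd (nen emb n') s ∧ gd0 s) ∧ ∀ k, ∃ j, n j = Sum.inl (nb x k) := by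
  let n0 : C → Fin 4 → NW M C := fun x k => Sum.inl (nb x k)
  obtain ⟨u, l, h1, h2, h3⟩ := euler_circuit (nen emb n0) (Finset.univ.filter (isCor emb x)) (by
    obtain ⟨p, hp⟩ := corner_ex emb x.1
    obtain ⟨q, rfl⟩ := nx_surj emb p
    exact ⟨Sum.inr (Sum.inl ⟨q, hp ▸ x.2⟩), by simp only [Finset.mem_filter, Finset.mem_univ, true_and]; exact hp⟩)
    (cor_even emb n0 x) (fun P hP => cor_conn emb n0 x P hP)
  simp only [Finset.mem_filter, Finset.mem_univ, true_and] at h3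
  have hm : ∀ k, (Sum.inl (nb x k) : NW M C) ∈ srcs l := by
    intro k
    obtain ⟨e, he⟩ := hnb x k
    have hl := lab_inl x.2 (nb x k).2 he
    obtain ⟨r, rfl⟩ := occ_ex emb e
    obtain ⟨q, hqx, hq⟩ : ∃ q, vt emb (nx emb q) = x.1 ∧ (nx emb q = r ∨ nx emb q = nx emb r) := by
      have : x.1 ∈ M.ends (ed emb r) := by rw [he]; simp
      rw [ends_ed, Sym2.mem_iff] at this
      rcases this with h | h
      · obtain ⟨q, rfl⟩ := nx_surj emb r
        exact ⟨q, h.symm, Or.inl rfl⟩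
      · exact ⟨r, h.symm, Or.inr rfl⟩
    have hqC : vt emb (nx emb q) ∈ C := hqx ▸ x.2
    have hc := cor_mem emb n0 hqC hq
    have hp : 0 < cnt l (Sum.inr (Sum.inl ⟨q, hqC⟩)) := by
      rw [h3, if_pos]
      · exact Nat.one_pos
      · exact hqx
    obtain ⟨s, hs, hse⟩ := List.mem_map.1 (cnt_pos.1 hp)
    rw [(h2 s hs).1 _ hse, hl] at hc
    rcases Sym2.mem_iff.1 hc with h | h
    · rw [h]; exact List.mem_map.2 ⟨s, hs, rfl⟩
    · rw [h]; exact h1.end_mem hs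
  obtain ⟨n, sg, a1, a2, a3, a4⟩ := four_seg h1 (fun k => Sum.inl (nb x k)) hm
  refine ⟨n, sg, a1, fun e => (a2 e).trans (h3 e), ?_, a4⟩
  intro n' k s hs
  refine ⟨fun e he => ?_, (h2 s (a3 k s hs)).2⟩
  have hp : 0 < cnt l e := cnt_pos.2 (List.mem_map.2 ⟨s, a3 k s hs, he⟩)
  have hi : isCor emb x e := by
    by_contra hi
    rw [h3, if_neg hi] at hp
    omega
  have := (h2 s (a3 k s hs)).1 e he
  rcases e with _ | q | _
  · exact hi.elim
  · exact this
  · exact hi.elim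

def nE (h : V → ℕ) : Sym2 V → ℕ := Sym2.lift ⟨fun a b => h a + h b, fun a b => add_comm _ _⟩

open Classical in
theorem euler_count (g : ℕ) (hg : emb.eulerGenus ≤ (g : ℤ)) :
    Fintype.card (NE emb C) + 2 ≤ Fintype.card (NW M C) + Fintype.card (NF F C) + g := by
  have hg' : Fintype.card E + 2 ≤ Fintype.card V + Fintype.card F + g := by
    simp only [Multigraph.Embedding.eulerGenus, Nat.card_eq_fintype_card] at hg
    omega
  have hV : Fintype.card V = Fintype.card {v // v ∉ C} + Fintype.card C := by
    have := Fintype.card_subtype_compl (fun v => v ∈ C)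
    have h2 := Fintype.card_subtype_le (fun v => v ∈ C)
    have h3 : Fintype.card C = Fintype.card {v // v ∈ C} := Fintype.card_congr (Equiv.refl _)
    omega
  have hQ : Fintype.card {q : Pos emb // vt emb (nx emb q) ∈ C} = ∑ e, nE (fun v => if v ∈ C then 1 else 0) (M.ends e) := by
    rw [Fintype.card_subtype, Finset.card_filter]
    have h1 := sum_nx emb (fun p => if vt emb p ∈ C then 1 else 0)
    have h2 := sum_ed emb (fun e => nE (fun v => if v ∈ C then 1 else 0) (M.ends e))
    simp only [ends_ed, nE, Sym2.lift_mk, Finset.sum_add_distrib, ← Finset.smul_sum] at h1 h2 ⊢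
    simp only [smul_eq_mul] at h2
    omega
  have hE : Fintype.card {e : E // ∀ v ∈ M.ends e, v ∉ C} + Fintype.card {q : Pos emb // vt emb (nx emb q) ∈ C} =
      Fintype.card E + Fintype.card {e : E // ∀ v ∈ M.ends e, v ∈ C} := by
    rw [hQ, Fintype.card_subtype, Fintype.card_subtype, Finset.card_filter, Finset.card_filter, Fintype.card_eq_sum_ones, ← Finset.sum_add_distrib, ← Finset.sum_add_distrib]
    refine Finset.sum_congr rfl fun e _ => ?_
    rcases M.ends e with ⟨a, b⟩
    change (if ∀ v ∈ s(a, b), v ∉ C then 1 else 0) + ((if a ∈ C then 1 else 0) + (if b ∈ C then 1 else 0)) = 1 + if ∀ v ∈ s(a, b), v ∈ C then 1 else 0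
    by_cases ha : a ∈ C <;> by_cases hb : b ∈ C <;> simp [ha, hb]
  simp only [Fintype.card_sum, Fintype.card_prod, Fintype.card_fin]
  omega

end Circ


section Fcx
variable {V E F : Type} {M : Multigraph V E} (emb : M.Embedding F) {C : Set V}
variable [Fintype V] [Fintype E] [Fintype F]

noncomputable def nfc (n : C → Fin 4 → NW M C) (sg : C → Fin 4 → List (NW M C × Option (NE emb C) × NW M C)) :
    NF F C → List (NW M C × Option (NE emb C) × NW M C)
  | Sum.inl f => oldW emb C f (emb.boundary f).len
  | Sum.inr (Sum.inl (x, k)) => sg x k ++ [(n x (k + 1), some (Sum.inr (Sum.inr (x, k))), n x k), (n x k, none, n x k)]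
  | Sum.inr (Sum.inr x) => [(n x 0, some (Sum.inr (Sum.inr (x, 0))), n x 1), (n x 1, some (Sum.inr (Sum.inr (x, 1))), n x 2),
      (n x 2, some (Sum.inr (Sum.inr (x, 2))), n x 3), (n x 3, some (Sum.inr (Sum.inr (x, 3))), n x 0)]

def nK (n : C → Fin 4 → NW M C) (sg : C → Fin 4 → List (NW M C × Option (NE emb C) × NW M C)) : NF F C → Set (Sym2 (NW M C))
  | Sum.inl f => {p | ∃ s ∈ nfc emb n sg (Sum.inl f), p = s(s.1, s.2.2)}
  | Sum.inr (Sum.inl y) => {p | ∃ s ∈ nfc emb n sg (Sum.inr (Sum.inl y)), p = s(s.1, s.2.2)}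
  | Sum.inr (Sum.inr x) => {p | ∃ j k, j ≠ k ∧ p = s(n x j, n x k)}

theorem RR.four {W : Type} (n : Fin 4 → W) : RR [n 0, n 1, n 2, n 3] {p | ∃ j k, j ≠ k ∧ p = s(n j, n k)} := by
  refine RR.quad (n 0) (n 1) (n 2) (n 3) [n 0] [] [n 3] {s(n 0, n 1)} {s(n 1, n 2)} {s(n 2, n 3)} _ rfl rfl
    (RR.leaf _ _ _ subset_rfl) (RR.leaf _ _ _ subset_rfl) (RR.leaf _ _ _ subset_rfl) ?_
  rintro p ⟨j, k, hjk, rfl⟩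
  have key : ∀ j k : Fin 4, j < k → s(n j, n k) ∈ (({s(n 0, n 1)} ∪ {s(n 1, n 2)} ∪ {s(n 2, n 3)} ∪ {s(n 0, n 3), s(n 0, n 2), s(n 1, n 3)}) : Set (Sym2 W)) := by
    intro j k h
    fin_cases j <;> fin_cases k <;> first | exact absurd h (by decide) | simp
  rcases lt_or_gt_of_ne hjk with h | h
  · exact key j k h
  · have := key k j h
    rwa [Sym2.eq_swap (a := n k)] at this

variable {emb} in
open Classical in
theorem n_pg {n : C → Fin 4 → NW M C} {sg : C → Fin 4 → List (NW M C × Option (NE emb C) × NW M C)}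
    (h1 : ∀ x k, Wk (n x k) (sg x k) (n x (k + 1))) (h3 : ∀ x k, ∀ s ∈ sg x k, gd (nen emb n) s ∧ gd0 s) (f : NF F C) :
    PG (nen emb n) (nfc emb n sg f) (nK emb n sg f) := by
  rcases f with f | ⟨x, k⟩ | x
  · have hw : Wk (ss emb C (pos emb f 0)) (oldW emb C f (emb.boundary f).len) (ss emb C (pos emb f 0)) := by
      have h := oldW_wk (C := C) emb f (emb.boundary f).len
      have e : pos emb f (emb.boundary f).len = pos emb f 0 := by simp [pos]
      rw [e] at h
      exact h
    have hl : 2 ≤ (oldW emb C f (emb.boundary f).len).length := by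
      have := (emb.boundary f).len_pos
      simp [oldW]
      omega
    exact ⟨⟨_, hw⟩, oldW_gd emb n f _, hl, hw.RRc hl⟩
  · have hw : Wk (n x k) (nfc emb n sg (Sum.inr (Sum.inl (x, k)))) (n x k) := Wk.app.2 ⟨_, h1 x k, rfl, rfl, rfl⟩
    have hl : 2 ≤ (nfc emb n sg (Sum.inr (Sum.inl (x, k)))).length := by simp [nfc]
    refine ⟨⟨_, hw⟩, ?_, hl, hw.RRc hl⟩
    intro s hs
    rcases List.mem_append.1 hs with hs | hs
    · exact h3 x k s hs
    · simp only [List.mem_cons, List.not_mem_nil, or_false] at hs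
      rcases hs with rfl | rfl
      · refine ⟨fun e he => ?_, fun h => by simp at h⟩
        simp only [Option.some.injEq] at he
        rw [← he]; exact Sym2.eq_swap
      · exact ⟨fun e he => by simp at he, fun _ => rfl⟩
  · refine ⟨⟨n x 0, rfl, rfl, rfl, rfl, rfl⟩, ?_, by simp [nfc], RR.four (n x)⟩
    intro s hs
    simp only [nfc, List.mem_cons, List.not_mem_nil, or_false] at hs
    rcases hs with rfl | rfl | rfl | rfl <;>
    · refine ⟨fun e he => ?_, fun h => by simp at h⟩
      simp only [Option.some.injEq] at he
      rw [← he]; rfl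

variable {emb} in
open Classical in
theorem n_twice {n : C → Fin 4 → NW M C} {sg : C → Fin 4 → List (NW M C × Option (NE emb C) × NW M C)}
    (h2 : ∀ x e, ∑ k, cnt (sg x k) e = if isCor emb x e then 1 else 0) (e : NE emb C) : ∑ f, cnt (nfc emb n sg f) e = 2 := by
  have hsg : ∀ x k, ¬ isCor emb x e → cnt (sg x k) e = 0 := by
    intro x k hx
    have := h2 x e
    rw [if_neg hx, Finset.sum_eq_zero_iff] at this
    exact this k (Finset.mem_univ _)
  have hsum : ∑ y : C × Fin 4, cnt (sg y.1 y.2) e = ∑ x : C, if isCor emb x e then 1 else 0 := by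
    rw [Fintype.sum_prod_type]
    exact Finset.sum_congr rfl fun x _ => h2 x e
  rw [Fintype.sum_sum_type, Fintype.sum_sum_type]
  rcases e with e | q | ⟨x, k⟩
  · have a1 : ∑ f, cnt (nfc emb n sg (Sum.inl f)) (Sum.inl e) = 2 := oldW_cnt_inl emb e
    have a3 : ∑ x, cnt (nfc emb n sg (Sum.inr (Sum.inr x))) (Sum.inl e) = 0 := by
      refine Finset.sum_eq_zero fun x _ => ?_
      simp [nfc, cnt_cons, cnt_nil]
    have a2 : ∑ y, cnt (nfc emb n sg (Sum.inr (Sum.inl y))) (Sum.inl e) = 0 := by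
      refine Finset.sum_eq_zero ?_
      rintro ⟨x, k⟩ _
      have := hsg x k (fun h => h)
      simp [nfc, cnt_app, cnt_cons, cnt_nil, this]
    rw [a1, a2, a3]; rfl
  · have a1 : ∑ f, cnt (nfc emb n sg (Sum.inl f)) (Sum.inr (Sum.inl q)) = 1 := oldW_cnt_cor emb q
    have a3 : ∑ x, cnt (nfc emb n sg (Sum.inr (Sum.inr x))) (Sum.inr (Sum.inl q)) = 0 := by
      refine Finset.sum_eq_zero fun x _ => ?_
      simp [nfc, cnt_cons, cnt_nil]
    have a2 : ∑ y, cnt (nfc emb n sg (Sum.inr (Sum.inl y))) (Sum.inr (Sum.inl q)) = 1 := by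
      have : ∀ y : C × Fin 4, cnt (nfc emb n sg (Sum.inr (Sum.inl y))) (Sum.inr (Sum.inl q)) = cnt (sg y.1 y.2) (Sum.inr (Sum.inl q)) := by
        rintro ⟨x, k⟩
        simp [nfc, cnt_app, cnt_cons, cnt_nil]
      rw [Finset.sum_congr rfl fun y _ => this y, hsum, Finset.sum_eq_single ⟨_, q.2⟩]
      · exact if_pos rfl
      · intro x _ hx
        refine if_neg fun h => hx ?_
        exact Subtype.ext (Eq.symm h)
      · simp
    rw [a1, a2, a3]; rfl
  · have a1 : ∑ f, cnt (nfc emb n sg (Sum.inl f)) (Sum.inr (Sum.inr (x, k))) = 0 :=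
      Finset.sum_eq_zero fun f _ => oldW_cnt_kap emb f _ _
    have a2 : ∑ y, cnt (nfc emb n sg (Sum.inr (Sum.inl y))) (Sum.inr (Sum.inr (x, k))) = 1 := by
      rw [Finset.sum_eq_single (x, k)]
      · have := hsg x k (fun h => h)
        simp [nfc, cnt_app, cnt_cons, cnt_nil, this]
      · rintro ⟨y, j⟩ _ hy
        have := hsg y j (fun h => h)
        simpa [nfc, cnt_app, cnt_cons, cnt_nil, this] using hy
      · simp
    have a3 : ∑ y, cnt (nfc emb n sg (Sum.inr (Sum.inr y))) (Sum.inr (Sum.inr (x, k))) = 1 := by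
      rw [Finset.sum_eq_single x]
      · fin_cases k <;> simp [nfc, cnt_cons, cnt_nil]
      · rintro y _ hy
        simp [nfc, cnt_cons, cnt_nil, hy]
      · simp
    rw [a1, a2, a3]; rfl

theorem src_old (n : C → Fin 4 → NW M C) (sg : C → Fin 4 → List (NW M C × Option (NE emb C) × NW M C)) (p : Pos emb) :
    ss emb C p ∈ srcs (nfc emb n sg (Sum.inl p.1)) := List.mem_map.2 ⟨_, (mem_oldW emb p).1, rfl⟩

theorem n_on [Nonempty E] (n : C → Fin 4 → NW M C) (sg : C → Fin 4 → List (NW M C × Option (NE emb C) × NW M C)) (w : NW M C) :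
    ∃ f, w ∈ srcs (nfc emb n sg f) := by
  rcases w with ⟨v, hv⟩ | ⟨e, he⟩
  · obtain ⟨p, rfl⟩ := corner_ex emb v
    refine ⟨Sum.inl p.1, ?_⟩
    rw [← ss_N emb hv]; exact src_old emb n sg p
  · obtain ⟨p, rfl⟩ := occ_ex emb e
    refine ⟨Sum.inl p.1, ?_⟩
    have h1 : vt emb p ∈ C := he _ (by rw [ends_ed]; simp)
    have : ss emb C p = Sum.inr ⟨ed emb p, he⟩ := by
      rw [ss_C emb h1, lab, dif_neg]
      rintro ⟨v, hv, hvC⟩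
      exact hvC (he v hv)
    rw [← this]; exact src_old emb n sg p

variable {emb} in
open Classical in
theorem n_dual [Nonempty E] {n : C → Fin 4 → NW M C} {sg : C → Fin 4 → List (NW M C × Option (NE emb C) × NW M C)}
    (h2 : ∀ x e, ∑ k, cnt (sg x k) e = if isCor emb x e then 1 else 0) (P : NF F C → Prop) (h0 : ∃ f, P f)
    (hP : ∀ e f f', 0 < cnt (nfc emb n sg f) e → 0 < cnt (nfc emb n sg f') e → P f → P f') : ∀ f, P f := by
  have hP' : ∀ e f f', 0 < cnt (nfc emb n sg f) e → 0 < cnt (nfc emb n sg f') e → (P f ↔ P f') :=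
    fun e f f' a b => ⟨hP e f f' a b, hP e f' f b a⟩
  have sq : ∀ x k, P (Sum.inr (Sum.inl (x, k))) ↔ P (Sum.inr (Sum.inr x)) := by
    intro x k
    refine hP' (Sum.inr (Sum.inr (x, k))) _ _ ?_ ?_
    · simp [nfc, cnt_app, cnt_cons, cnt_nil]
    · fin_cases k <;> simp [nfc, cnt_cons, cnt_nil]
  have oq : ∀ (p : Pos emb) (x : C), vt emb p = x.1 → (P (Sum.inl p.1) ↔ P (Sum.inr (Sum.inr x))) := by
    intro p x hx
    obtain ⟨q, rfl⟩ := nx_surj emb p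
    have hqC : vt emb (nx emb q) ∈ C := hx ▸ x.2
    obtain ⟨k, hk⟩ : ∃ k, 0 < cnt (sg x k) (Sum.inr (Sum.inl ⟨q, hqC⟩)) := by
      by_contra hc
      push Not at hc
      have := h2 x (Sum.inr (Sum.inl ⟨q, hqC⟩))
      rw [if_pos (show isCor emb x (Sum.inr (Sum.inl ⟨q, hqC⟩)) from hx), Finset.sum_eq_zero fun k _ => Nat.le_zero.1 (hc k)] at this
      omega
    rw [← sq x k]
    refine hP' (Sum.inr (Sum.inl ⟨q, hqC⟩)) _ _ ?_ ?_
    · refine cnt_pos.2 (List.mem_map.2 ⟨_, (mem_oldW emb q).2, ?_⟩)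
      simp [st2, hqC]
    · simp only [nfc, cnt_app]; omega
  have oo : ∀ p p' : Pos emb, vt emb p = vt emb p' → P (Sum.inl p.1) → P (Sum.inl p'.1) := by
    intro p p' hpp
    by_cases hC : vt emb p ∈ C
    · exact ((oq p ⟨_, hC⟩ rfl).trans (oq p' ⟨_, hC⟩ hpp.symm).symm).1
    · refine link emb (vt emb p) (fun p => P (Sum.inl p.1)) ?_ p p' rfl hpp.symm
      intro q q' r r' hq hr hr' _ _ hPr
      have e1 : r.1 = q.1 := by rcases hr with rfl | rfl <;> rfl
      have e2 : r'.1 = q'.1 := by rcases hr' with rfl | rfl <;> rfl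
      rw [e1] at hPr
      rw [e2]
      by_cases hN : ∀ v ∈ M.ends (ed emb q), v ∉ C
      · refine hP (Sum.inl ⟨ed emb q, hN⟩) _ _ ?_ ?_ hPr
        · refine cnt_pos.2 (List.mem_map.2 ⟨_, (mem_oldW emb q).1, ?_⟩)
          simp only [st1, dif_pos hN]
        · refine cnt_pos.2 (List.mem_map.2 ⟨_, (mem_oldW emb q').1, ?_⟩)
          have hN' : ∀ v ∈ M.ends (ed emb q'), v ∉ C := hq ▸ hN
          simp only [st1, dif_pos hN', hq]
      · push Not at hN
        obtain ⟨x, hx, hxC⟩ := hN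
        have hx' := hx
        rw [hq] at hx'
        have oe : ∀ q : Pos emb, x ∈ M.ends (ed emb q) → (P (Sum.inl q.1) ↔ P (Sum.inr (Sum.inr ⟨x, hxC⟩))) := by
          intro q hx
          rw [ends_ed, Sym2.mem_iff] at hx
          rcases hx with hx | hx
          · exact oq q ⟨x, hxC⟩ hx.symm
          · exact oq (nx emb q) ⟨x, hxC⟩ hx.symm
        exact (oe q' hx').2 ((oe q hx).1 hPr)
  have hold : ∃ p : Pos emb, P (Sum.inl p.1) := by
    obtain ⟨f | ⟨x, k⟩ | x, hf⟩ := h0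
    · exact ⟨pos emb f 0, hf⟩
    · obtain ⟨p, hp⟩ := corner_ex emb x.1
      exact ⟨p, (oq p x hp).2 ((sq x k).1 hf)⟩
    · obtain ⟨p, hp⟩ := corner_ex emb x.1
      exact ⟨p, (oq p x hp).2 hf⟩
  obtain ⟨p0, hp0⟩ := hold
  have hall : ∀ p : Pos emb, P (Sum.inl p.1) := by
    have : ∀ u v, Relation.ReflTransGen M.simple.Adj u v → (∀ p, vt emb p = u → P (Sum.inl p.1)) → ∀ p, vt emb p = v → P (Sum.inl p.1) := by
      intro u v huv hu
      induction huv with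
      | refl => exact hu
      | tail _ hadj ih =>
        obtain ⟨-, e, he⟩ := hadj
        obtain ⟨q, rfl⟩ := occ_ex emb e
        rw [ends_ed] at he
        intro p hp
        rcases Sym2.eq_iff.1 he with ⟨h3, h4⟩ | ⟨h3, h4⟩
        · exact oo (nx emb q) p (h4.trans hp.symm) (ih q h3)
        · exact oo q p (h3.trans hp.symm) (ih (nx emb q) h4)
    intro p
    exact this (vt emb p0) (vt emb p) ((SimpleGraph.reachable_iff_reflTransGen _ _).1 (emb.conn.preconnected _ _)) (fun q hq => oo p0 q hq.symm hp0) p rfl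
  intro f
  rcases f with f | ⟨x, k⟩ | x
  · exact hall (pos emb f 0)
  · obtain ⟨p, hp⟩ := corner_ex emb x.1
    exact (sq x k).2 ((oq p x hp).1 (hall p))
  · obtain ⟨p, hp⟩ := corner_ex emb x.1
    exact (oq p x hp).1 (hall p)

end Fcx


theorem chord2 {W : Type} (n : Fin 4 → W) (dep : W → ℕ) (h : ∀ k, dep (n k) ≤ dep (n (k + 1)) + 1 ∧ dep (n (k + 1)) ≤ dep (n k) + 1) (j k : Fin 4) :
    dep (n j) ≤ dep (n k) + 2 := by
  have h0 := h 0
  have h1 := h 1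
  have h2 := h 2
  have h3 := h 3
  simp only [show (0 : Fin 4) + 1 = 1 from rfl, show (1 : Fin 4) + 1 = 2 from rfl, show (2 : Fin 4) + 1 = 3 from rfl, show (3 : Fin 4) + 1 = 0 from rfl] at h0 h1 h2 h3
  fin_cases j <;> fin_cases k <;> simp only [Fin.zero_eta, Fin.mk_one, Fin.reduceFinMk] <;> omega

theorem triv_case (g : ℕ) {V : Type} (G : SimpleGraph V) [Subsingleton V] :
    ∃ (W : Type) (H : SimpleGraph W) (n : ℕ),
      IsPlanar H ∧ TreewidthLE H 3 ∧
      G.IsContainedIn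
        ((H.strongProd (SimpleGraph.pathGraph n)).strongProd
          (SimpleGraph.completeGraph (Fin (max (4 * g) 7)))) := by
  have hS := Apol.init
  have hA := hS.symm
  have hA' : ∀ x y : ℕ, (x < 3 ∧ y < 3 ∧ x ≠ y) → x ≠ y := fun x y h => h.2.2
  refine ⟨Fin 3, HG 3 _ hA hA', 1, hS.planar hA hA', hS.treewidth hA hA', ?_⟩
  refine ⟨⟨fun _ => ((0, 0), ⟨0, by omega⟩), ?_⟩, fun u v _ => Subsingleton.elim u v⟩
  intro u v h
  exact absurd (Subsingleton.elim u v) h.ne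

theorem one_planar_product_structure (g : ℕ) {V : Type} (G : SimpleGraph V)
    (hG : IsG1Planar G g) :
    ∃ (W : Type) (H : SimpleGraph W) (n : ℕ),
      IsPlanar H ∧ TreewidthLE H 3 ∧
      G.IsContainedIn
        ((H.strongProd (SimpleGraph.pathGraph n)).strongProd
          (SimpleGraph.completeGraph (Fin (max (4 * g) 7)))) := by
  classical
  obtain ⟨I, a, b, c, d, -, -, -, V', E', F', hV, hE, hF, M, emb, hg, φ, hφ⟩ := hG
  have := Fintype.ofFinite V'
  have := Fintype.ofFinite E'
  have := Fintype.ofFinite F'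
  by_cases hne : Nonempty E'
  swap
  · have hsub : Subsingleton V := by
      constructor
      intro u v
      by_contra huv
      obtain ⟨q⟩ := emb.conn.preconnected (φ (Sum.inl u)) (φ (Sum.inl v))
      have hn : φ (Sum.inl u) ≠ φ (Sum.inl v) := fun h => huv (by simpa using hφ h)
      generalize φ (Sum.inl u) = x at q hn
      rcases q with _ | ⟨hq, q⟩
      · exact hn rfl
      · obtain ⟨-, e, -⟩ := hq
        exact hne ⟨e⟩
    exact triv_case g G
  let C : Set V' := Set.range fun i => φ (Sum.inr i)
  have hN : ∀ v, φ (Sum.inl v) ∉ C := by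
    rintro v ⟨i, hi⟩
    have := hφ hi
    simp at this
  choose idx hidx using fun x : C => x.2
  simp only at hidx
  let ab : I → Fin 4 → V := fun i => ![a i, b i, c i, d i]
  let nb : C → Fin 4 → {v // v ∉ C} := fun x k => ⟨φ (Sum.inl (ab (idx x) k)), hN _⟩
  have hnb : ∀ x k, ∃ e, M.ends e = s(x.1, (nb x k).1) := by
    intro x k
    have hadj : (planarization G a b c d).Adj (Sum.inr (idx x)) (Sum.inl (ab (idx x) k)) := by
      refine Or.inr ⟨ab (idx x) k, idx x, Or.inr ⟨rfl, rfl⟩, ?_⟩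
      fin_cases k <;> simp [ab]
    obtain ⟨-, e, he⟩ := φ.map_rel hadj
    refine ⟨e, ?_⟩
    rw [← hidx x]; exact he
  choose n sg h1 h2 h3 h4 using circ emb nb hnb
  have hC : Cplx (nen emb n) (nfc emb n sg) (nK emb n sg) :=
    ⟨n_pg h1 (fun x => h3 x n), n_twice h2, n_on emb n sg, fun P h0 hP => n_dual h2 P h0 hP⟩
  have : Nonempty (NF F' C) := by
    obtain ⟨e⟩ := hne
    obtain ⟨p, -⟩ := occ_ex emb e
    exact ⟨Sum.inl p.1⟩
  obtain ⟨par, dep, Zl, S, b1, b2, b3, b4, b5, b6⟩ := partII hC g (euler_count emb g hg)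
  let ι : V → NW M C := fun v => Sum.inl ⟨φ (Sum.inl v), hN v⟩
  have hι : Function.Injective ι := by
    intro u v h
    simp only [ι, Sum.inl.injEq, Subtype.mk.injEq] at h
    simpa using hφ h
  refine assemble g G ι hι par dep Zl S b1 b2 b4 b5 ?_
  intro u v huv
  have hcr : ∀ i j k, u = ab i j → v = ab i k → Okay S (ι u) (ι v) ∧ dep (ι u) ≤ dep (ι v) + 2 := by
    intro i j k hu hv
    let x : C := ⟨φ (Sum.inr i), i, rfl⟩
    have hx : idx x = i := by
      have := hφ (hidx x)
      simpa using this
    obtain ⟨j', hj⟩ := h4 x j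
    obtain ⟨k', hk⟩ := h4 x k
    have hj : n x j' = ι u := by rw [hj]; simp only [nb, ι, hx, ← hu]
    have hk : n x k' = ι v := by rw [hk]; simp only [nb, ι, hx, ← hv]
    constructor
    · refine b6 (Sum.inr (Sum.inr x)) _ _ ⟨j', k', ?_, by rw [hj, hk]⟩
      rintro rfl
      exact huv.ne (hι (hj.symm.trans hk))
    · rw [← hj, ← hk]
      refine chord2 (n x) dep (fun m => ⟨b3 (Sum.inr (Sum.inr (x, m))) _ _ rfl, b3 (Sum.inr (Sum.inr (x, m))) _ _ Sym2.eq_swap⟩) _ _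
  by_cases hc : ∃ i, s(u, v) = s(a i, b i) ∨ s(u, v) = s(c i, d i)
  · obtain ⟨i, hi | hi⟩ := hc
    · rcases Sym2.eq_iff.1 hi with ⟨e1, e2⟩ | ⟨e1, e2⟩
      · exact hcr i 0 1 e1 e2
      · exact hcr i 1 0 e1 e2
    · rcases Sym2.eq_iff.1 hi with ⟨e1, e2⟩ | ⟨e1, e2⟩
      · exact hcr i 2 3 e1 e2
      · exact hcr i 3 2 e1 e2
  · push Not at hc
    have hadj : (planarization G a b c d).Adj (Sum.inl u) (Sum.inl v) := Or.inl ⟨u, v, rfl, rfl, huv, hc⟩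
    obtain ⟨-, e, he⟩ := φ.map_rel hadj
    obtain ⟨p, rfl⟩ := occ_ex emb e
    have hNe : ∀ w ∈ M.ends (ed emb p), w ∉ C := by
      rw [he]
      intro w hw
      rcases Sym2.mem_iff.1 hw with rfl | rfl
      · exact hN u
      · exact hN v
    have hp : s(ss emb C p, tt emb C p) = s(ι u, ι v) := by
      have e2 := ends_ed emb p
      have c1 : vt emb p ∉ C := hNe _ (by rw [e2]; simp)
      have c2 : vt emb (nx emb p) ∉ C := hNe _ (by rw [e2]; simp)
      rw [ss_N emb c1, tt_N emb c2]
      rw [he] at e2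
      rcases Sym2.eq_iff.1 e2 with ⟨e3, e4⟩ | ⟨e3, e4⟩
      · simp only [ι, ← e3, ← e4]
      · simp only [ι, ← e3, ← e4]; exact Sym2.eq_swap
    constructor
    · refine b6 (Sum.inl p.1) _ _ ⟨st1 emb p, (mem_oldW emb p).1, hp.symm⟩
    · have := b3 (Sum.inl ⟨ed emb p, hNe⟩) (ι u) (ι v) ((nen_old emb n hNe).trans hp)
      omega
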